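/- Let n ≥ 3, let q be a prime power, and let c be a code word of C_{n-1}(n,q) with (3q−6)θ_{n-2}+3 ≤ wt(c) ≤ B_{n,q}. Let Π₁ and Π₂ be two k-spaces of PG(n,q), 2 ≤ k < n, of types T₁, T₂ ∈ {T^odd, T^△, T^★} respectively, having a 3-secant to supp(c) in common. Then T₁ = T^★, or T₂ = T^★, or T₁ = T₂; moreover, if T₁ = T₂, then wt(c|_{Π₁}) = wt(c|_{Π₂}). -/

import Mathlib

open scoped Classical

noncomputable section

namespace PGCode

open Projectivization

/-- The points of `PG(n, q)`, where the field `F` has order `q`. -/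
abbrev Pt (F : Type) [Field F] (n : ℕ) := Projectivization F (Fin (n + 1) → F)

variable {F : Type} [Field F]

/-- A point of `PG(n,q)` lies in the projective subspace determined by a linear subspace `W`. -/
def ptIn {n : ℕ} (P : Pt F n) (W : Submodule F (Fin (n + 1) → F)) : Prop :=
  Projectivization.submodule P ≤ W

/-- The set of points of the projective subspace determined by a linear subspace `W`. -/
def ptsIn {n : ℕ} (W : Submodule F (Fin (n + 1) → F)) : Set (Pt F n) :=
  {P | ptIn P W}

/-- The incidence vector (over `F_p = ZMod p`) of the projective subspace determined by `W`. -/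
def incVec (p : ℕ) {n : ℕ} (W : Submodule F (Fin (n + 1) → F)) : Pt F n → ZMod p :=
  fun P => if ptIn P W then (1 : ZMod p) else 0

/-- The code `C_{n-1}(n,q)`: the `F_p`-span of the incidence vectors of all hyperplanes
(projective dimension `n-1`, i.e. linear dimension `n`). -/
def code (F : Type) [Field F] (p n : ℕ) : Submodule (ZMod p) (Pt F n → ZMod p) :=
  Submodule.span (ZMod p)
    {v | ∃ W : Submodule F (Fin (n + 1) → F), Module.finrank F W = n ∧ v = incVec p W}

/-- The support of a word. -/
def supp {p n : ℕ} (v : Pt F n → ZMod p) : Set (Pt F n) := {P | v P ≠ 0}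

/-- The weight of a word. -/
def wt {p n : ℕ} (v : Pt F n → ZMod p) : ℕ := (supp v).ncard

/-- The weight of the restriction of a word to the subspace determined by `W`. -/
def wtRes {p n : ℕ} (c : Pt F n → ZMod p) (W : Submodule F (Fin (n + 1) → F)) : ℕ :=
  (ptsIn W ∩ supp c).ncard

/-- `θ_m = (q^(m+1) - 1)/(q - 1)`, with `θ_m = 0` for `m < 0`. -/
def theta (q : ℕ) (m : ℤ) : ℕ :=
  if m < 0 then 0 else ∑ i ∈ Finset.range (m.toNat + 1), q ^ i

/-- The bound `B_{n,q}` from the paper. -/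
def B (n q : ℕ) : ℝ :=
  if q < 7 ∨ q = 8 ∨ q = 9 ∨ q = 16 ∨ q = 25 ∨ q = 27 ∨ q = 49 then
    2 * (q : ℝ) ^ (n - 1)
  else if q = 7 ∨ q = 11 ∨ q = 13 ∨ q = 17 then
    (3 * q - Real.sqrt (6 * q) - 1 / 2) * (q : ℝ) ^ (n - 2)
  else if q = 19 ∨ q = 121 then
    (3 * q - Real.sqrt (6 * q) + 9 / 2) * (q : ℝ) ^ (n - 2)
  else if q = 29 ∨ q = 31 ∨ q = 32 then
    (4 * q - 4 * Real.sqrt q - 25 / 2) * (q : ℝ) ^ (n - 2)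
  else
    (4 * q - Real.sqrt (8 * q) - 33 / 2) * (q : ℝ) ^ (n - 2)

/-- A line of `PG(n,q)`: a linear subspace of dimension `2`. -/
def IsLine {n : ℕ} (l : Submodule F (Fin (n + 1) → F)) : Prop := Module.finrank F l = 2

/-- A plane of `PG(n,q)`: a linear subspace of dimension `3`. -/
def IsPlane {n : ℕ} (W : Submodule F (Fin (n + 1) → F)) : Prop := Module.finrank F W = 3

/-- The line `l` is an `α`-secant to `supp c`. -/
def secant {p n : ℕ} (c : Pt F n → ZMod p) (l : Submodule F (Fin (n + 1) → F)) (α : ℕ) : Prop :=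
  IsLine l ∧ (ptsIn l ∩ supp c).ncard = α

/-- The restriction of `c` to the plane `W` is a linear combination of at most two lines of `W`. -/
def TwoLineComb (p : ℕ) {n : ℕ} (c : Pt F n → ZMod p) (W : Submodule F (Fin (n + 1) → F)) :
    Prop :=
  ∃ l₁ l₂ : Submodule F (Fin (n + 1) → F), IsLine l₁ ∧ IsLine l₂ ∧ l₁ ≤ W ∧ l₂ ≤ W ∧
    ∃ a b : ZMod p, ∀ P : Pt F n, ptIn P W → c P = a * incVec p l₁ P + b * incVec p l₂ P

/-- Type `T^△`: the restriction of `c` to the plane `W` is a linear combination (with nonzero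
coefficients) of three nonconcurrent lines of `W`. -/
def TypeTri (p : ℕ) {n : ℕ} (c : Pt F n → ZMod p) (W : Submodule F (Fin (n + 1) → F)) : Prop :=
  ∃ l₁ l₂ l₃ : Submodule F (Fin (n + 1) → F),
    IsLine l₁ ∧ IsLine l₂ ∧ IsLine l₃ ∧ l₁ ≤ W ∧ l₂ ≤ W ∧ l₃ ≤ W ∧
    l₁ ≠ l₂ ∧ l₁ ≠ l₃ ∧ l₂ ≠ l₃ ∧
    (¬ ∃ P : Pt F n, ptIn P l₁ ∧ ptIn P l₂ ∧ ptIn P l₃) ∧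
    ∃ a₁ a₂ a₃ : ZMod p, a₁ ≠ 0 ∧ a₂ ≠ 0 ∧ a₃ ≠ 0 ∧
      ∀ P : Pt F n, ptIn P W →
        c P = a₁ * incVec p l₁ P + a₂ * incVec p l₂ P + a₃ * incVec p l₃ P

/-- Type `T^★`: the restriction of `c` to the plane `W` is a linear combination (with nonzero
coefficients) of three distinct concurrent lines of `W`. -/
def TypeStar (p : ℕ) {n : ℕ} (c : Pt F n → ZMod p) (W : Submodule F (Fin (n + 1) → F)) : Prop :=
  ∃ l₁ l₂ l₃ : Submodule F (Fin (n + 1) → F),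
    IsLine l₁ ∧ IsLine l₂ ∧ IsLine l₃ ∧ l₁ ≤ W ∧ l₂ ≤ W ∧ l₃ ≤ W ∧
    l₁ ≠ l₂ ∧ l₁ ≠ l₃ ∧ l₂ ≠ l₃ ∧
    (∃ P : Pt F n, ptIn P l₁ ∧ ptIn P l₂ ∧ ptIn P l₃) ∧
    ∃ a₁ a₂ a₃ : ZMod p, a₁ ≠ 0 ∧ a₂ ≠ 0 ∧ a₃ ≠ 0 ∧
      ∀ P : Pt F n, ptIn P W →
        c P = a₁ * incVec p l₁ P + a₂ * incVec p l₂ P + a₃ * incVec p l₃ P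

/-- The base code word `c₀` of the `T^odd` construction on `PG(2,p)`:
`c₀(0,1,a) = a`, `c₀(1,0,b) = b`, `c₀(1,1,c) = -c`, and `c₀ = 0` elsewhere. -/
def oddBase (p : ℕ) [Fact p.Prime] : Pt (ZMod p) 2 → ZMod p := fun P =>
  if P.rep 0 = 0 ∧ P.rep 1 ≠ 0 then P.rep 2 / P.rep 1
  else if P.rep 1 = 0 ∧ P.rep 0 ≠ 0 then P.rep 2 / P.rep 0
  else if P.rep 0 = P.rep 1 ∧ P.rep 0 ≠ 0 then -(P.rep 2 / P.rep 0)
  else 0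

/-- The line `m : X₀ = 0` of `PG(2,p)`. -/
def lineM1 (p : ℕ) [Fact p.Prime] : Submodule (ZMod p) (Fin 3 → ZMod p) :=
  LinearMap.ker (LinearMap.proj 0 : (Fin 3 → ZMod p) →ₗ[ZMod p] ZMod p)

/-- The line `m' : X₁ = 0` of `PG(2,p)`. -/
def lineM2 (p : ℕ) [Fact p.Prime] : Submodule (ZMod p) (Fin 3 → ZMod p) :=
  LinearMap.ker (LinearMap.proj 1 : (Fin 3 → ZMod p) →ₗ[ZMod p] ZMod p)

/-- The line `m'' : X₀ = X₁` of `PG(2,p)`. -/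
def lineM3 (p : ℕ) [Fact p.Prime] : Submodule (ZMod p) (Fin 3 → ZMod p) :=
  LinearMap.ker ((LinearMap.proj 0 : (Fin 3 → ZMod p) →ₗ[ZMod p] ZMod p) - LinearMap.proj 1)

/-- The code word `d = (γ c₀ + λ m + λ' m' + λ'' m'')^π` of the `T^odd` construction, where the
collineation `π` of `PG(2,p)` is the inverse of the homography induced by the linear
equivalence `g`. -/
def oddWord (p : ℕ) [Fact p.Prime] (g : (Fin 3 → ZMod p) ≃ₗ[ZMod p] (Fin 3 → ZMod p))
    (γ lam lam' lam'' : ZMod p) : Pt (ZMod p) 2 → ZMod p := fun P =>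
  γ * oddBase p (Projectivization.map g.toLinearMap g.injective P) +
    lam * incVec p (lineM1 p) (Projectivization.map g.toLinearMap g.injective P) +
    lam' * incVec p (lineM2 p) (Projectivization.map g.toLinearMap g.injective P) +
    lam'' * incVec p (lineM3 p) (Projectivization.map g.toLinearMap g.injective P)

/-- The semilinear embedding of `PG(2,p)` onto the plane of `PG(n,q)` spanned by the linearly
independent vectors `b 0, b 1, b 2`, relative to the field embedding `σ : F_p → F`. -/
def planeEmbed {n : ℕ} {p : ℕ} [Fact p.Prime] (σ : ZMod p →+* F)
    (b : Fin 3 → (Fin (n + 1) → F)) (hb : LinearIndependent F b) :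
    Pt (ZMod p) 2 → Pt F n := fun P =>
  Projectivization.mk F (∑ i, σ (P.rep i) • b i) (by
    intro hzero
    have h0 : ∀ i ∈ Finset.univ, σ (P.rep i) = 0 :=
      linearIndependent_iff'.mp hb Finset.univ (fun i => σ (P.rep i)) hzero
    have h1 : P.rep = 0 := funext fun i => σ.injective (by
      simp only [Pi.zero_apply, map_zero]; exact h0 i (Finset.mem_univ i))
    exact P.rep_nonzero h1)

/-- Type `T^odd`: this requires `q = p` to be prime (`|F| = p`), and `c` restricted to the plane
`W` (spanned by the frame `b`) must coincide, via a semilinear identification of `W` with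
`PG(2,p)`, with a code word `d` of the `T^odd` construction. -/
def TypeOdd (p : ℕ) [Fact p.Prime] [Fintype F] {n : ℕ} (c : Pt F n → ZMod p)
    (W : Submodule F (Fin (n + 1) → F)) : Prop :=
  Fintype.card F = p ∧
  ∃ (σ : ZMod p →+* F) (b : Fin 3 → (Fin (n + 1) → F)) (hb : LinearIndependent F b),
    Submodule.span F (Set.range b) = W ∧
    ∃ (g : (Fin 3 → ZMod p) ≃ₗ[ZMod p] (Fin 3 → ZMod p)) (γ lam lam' lam'' : ZMod p), γ ≠ 0 ∧
      ∀ Q : Pt (ZMod p) 2, c (planeEmbed σ b hb Q) = oddWord p g γ lam lam' lam'' Q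

/-- The list of plane types `T_0, T_{q+1}, T_{2q}, T_{2q+1}, T^odd, T^△, T^★`. -/
inductive PlaneT : Type where
  | T0 | Tq1 | T2q | T2q1 | Todd | Ttri | Tstar
deriving DecidableEq

/-- The restriction of `c` to the plane `W` is a code word of the given type. -/
def PlaneIsType (p q : ℕ) [Fact p.Prime] [Fintype F] {n : ℕ} (c : Pt F n → ZMod p)
    (W : Submodule F (Fin (n + 1) → F)) : PlaneT → Prop
  | .T0 => TwoLineComb p c W ∧ wtRes c W = 0
  | .Tq1 => TwoLineComb p c W ∧ wtRes c W = q + 1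
  | .T2q => TwoLineComb p c W ∧ wtRes c W = 2 * q
  | .T2q1 => TwoLineComb p c W ∧ wtRes c W = 2 * q + 1
  | .Todd => TypeOdd p c W
  | .Ttri => TypeTri p c W
  | .Tstar => TypeStar p c W

/-- The plane `W` is of type `𝒯`. -/
def TypeT (p q : ℕ) [Fact p.Prime] [Fintype F] {n : ℕ} (c : Pt F n → ZMod p)
    (W : Submodule F (Fin (n + 1) → F)) : Prop :=
  IsPlane W ∧ ∃ t : PlaneT, PlaneIsType p q c W t

/-- The plane `W` is of type `𝒪`. -/
def TypeO (p q : ℕ) [Fact p.Prime] [Fintype F] {n : ℕ} (c : Pt F n → ZMod p)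
    (W : Submodule F (Fin (n + 1) → F)) : Prop :=
  IsPlane W ∧ ¬ TypeT p q c W

/-- The restriction of `c` to the `k`-space `Sp` (linear dimension `k+1`) is of type `t`:
there is a `(k-3)`-space `κ ⊆ Sp` on which `c` is a scalar multiple of the all-one function,
a plane `π ⊆ Sp` of type `t` disjoint from `κ`, and `c P = c (⟨κ, P⟩ ∩ π)` for every point
`P` of `Sp` outside `κ`. -/
def SpaceIsType (p q : ℕ) [Fact p.Prime] [Fintype F] {n : ℕ} (c : Pt F n → ZMod p)
    (Sp : Submodule F (Fin (n + 1) → F)) (k : ℕ) (t : PlaneT) : Prop :=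
  Module.finrank F Sp = k + 1 ∧
  ∃ κ : Submodule F (Fin (n + 1) → F), Module.finrank F κ = k - 2 ∧ κ ≤ Sp ∧
    (∃ a : ZMod p, ∀ P : Pt F n, ptIn P κ → c P = a) ∧
    ∃ π : Submodule F (Fin (n + 1) → F), IsPlane π ∧ π ≤ Sp ∧ π ⊓ κ = ⊥ ∧
      PlaneIsType p q c π t ∧
      ∀ P : Pt F n, ptIn P Sp → ¬ ptIn P κ →
        ∃ Q : Pt F n, ptIn Q π ∧
          Projectivization.submodule Q ≤ κ ⊔ Projectivization.submodule P ∧ c P = c Q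

section Hankel
open Polynomial Finset


/-- Hankel matrices of power sums: if the `j`-th power moment `∑ t ^ j * g y t` is a polynomial in
`y` of degree at most `j`, then a fibre with exactly `r` nonzero values forces almost all other
fibres to have at least `r` nonzero values. -/
theorem sum_fibre_defect_le [Fintype F] (g : F → F → F) (m : ℕ → F[X])
    (hdeg : ∀ j, (m j).natDegree ≤ j) (hm : ∀ j y, (m j).eval y = ∑ t, t ^ j * g y t)
    (r : ℕ) (y₀ : F) (hr : #{t | g y₀ t ≠ 0} = r) :
    ∑ y, (r - #{t | g y t ≠ 0}) ≤ r * (r - 1) := by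
  set A : Matrix (Fin r) (Fin r) F[X] := Matrix.of fun i j => m (i + j) with hA
  have hdetdeg : A.det.natDegree ≤ r * (r - 1) := by
    rw [Matrix.det_apply]
    refine natDegree_sum_le_of_forall_le _ _ fun σ _ => ?_
    refine (natDegree_smul_le _ _).trans ?_
    refine (natDegree_prod_le _ _).trans ?_
    calc ∑ i, (A (σ i) i).natDegree ≤ ∑ i : Fin r, ((σ i : ℕ) + (i : ℕ)) :=
          Finset.sum_le_sum fun i _ => hdeg _
      _ = ∑ i : Fin r, (i : ℕ) + ∑ i : Fin r, (i : ℕ) := by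
          rw [Finset.sum_add_distrib]
          congr 1
          exact Equiv.sum_comp σ (fun i : Fin r => (i : ℕ))
      _ = r * (r - 1) := by
          rw [Fin.sum_univ_eq_sum_range (fun i => i) r, ← Finset.sum_range_id_mul_two]
          ring
  have hne : A.det ≠ 0 := by
    intro h0
    have h1 : (A.map (eval y₀)).det = 0 := by
      have := RingHom.map_det (evalRingHom y₀) A
      rw [h0, map_zero] at this
      exact this.symm
    set e : Fin r ≃ {t // t ∈ ({t | g y₀ t ≠ 0} : Finset F)} := (Finset.equivFinOfCardEq hr).symm
    set τ : Fin r → F := fun i => (e i : F)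
    have hτ : Function.Injective τ := Subtype.val_injective.comp e.injective
    have h2 : A.map (eval y₀) = (Matrix.vandermonde τ).transpose *
        Matrix.diagonal (fun i => g y₀ (τ i)) * Matrix.vandermonde τ := by
      ext i j
      rw [Matrix.mul_apply]
      simp only [Matrix.mul_diagonal, Matrix.transpose_apply, Matrix.vandermonde_apply,
        Matrix.map_apply, hA, Matrix.of_apply, hm]
      rw [← Finset.sum_filter_of_ne (p := fun t => g y₀ t ≠ 0)
        (fun t _ ht => right_ne_zero_of_mul ht), ← Finset.sum_coe_sort]
      rw [← Equiv.sum_comp e]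
      refine Finset.sum_congr rfl fun k _ => ?_
      simp only [τ]
      ring
    rw [h2, Matrix.det_mul, Matrix.det_mul, Matrix.det_transpose, Matrix.det_diagonal] at h1
    have hv : (Matrix.vandermonde τ).det ≠ 0 := Matrix.det_vandermonde_ne_zero_iff.mpr hτ
    have hp : ∏ i, g y₀ (τ i) ≠ 0 := Finset.prod_ne_zero_iff.mpr fun i _ => by
      exact (Finset.mem_filter.mp (e i).2).2
    exact (mul_ne_zero (mul_ne_zero hv hp) hv) h1
  have hdvd : ∀ y, (X - C y) ^ (r - #{t | g y t ≠ 0}) ∣ A.det := by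
    intro y
    set s : Finset F := {t | g y t ≠ 0}
    set w : F[X] := ∏ t ∈ s, (X - C t) with hw
    have hwm : w.Monic := monic_prod_of_monic _ _ fun t _ => monic_X_sub_C t
    have hwd : w.natDegree = #s := by simp [hw, natDegree_prod_of_monic, monic_X_sub_C]
    set P : Fin r → F[X] := fun j => if (j : ℕ) < #s then X ^ (j : ℕ) else X ^ ((j : ℕ) - #s) * w
    have hPm : ∀ j, (P j).Monic := by
      intro j; simp only [P]; split_ifs
      · exact monic_X_pow _
      · exact (monic_X_pow _).mul hwm
    have hPd : ∀ j, (P j).natDegree = j := by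
      intro j; simp only [P]; split_ifs with h
      · simp
      · rw [(monic_X_pow _).natDegree_mul hwm, hwd, natDegree_X_pow]; omega
    set U : Matrix (Fin r) (Fin r) F := Matrix.of fun i j => (P j).coeff i
    have hU : U.det = 1 := Matrix.det_matrixOfPolynomials P hPd hPm
    set B := A * U.map C with hB
    have hBdet : B.det = A.det := by
      have : (U.map C).det = 1 := by
        have := RingHom.map_det (C : F →+* F[X]) U
        rw [hU, map_one] at this
        exact this.symm
      rw [hB, Matrix.det_mul, this, mul_one]
    have hcol : ∀ i j : Fin r, ¬ (j : ℕ) < #s → (X - C y) ∣ B i j := by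
      intro i j hj
      rw [dvd_iff_isRoot, IsRoot.def, hB, Matrix.mul_apply, eval_finsetSum]
      have h3 : ∀ k : Fin r, eval y (A i k * U.map C k j) =
          ∑ t, g y t * t ^ (i : ℕ) * ((P j).coeff k * t ^ (k : ℕ)) := by
        intro k
        rw [eval_mul]
        simp only [hA, U, Matrix.of_apply, Matrix.map_apply, eval_C, hm, Finset.sum_mul]
        refine Finset.sum_congr rfl fun t _ => by ring
      rw [Finset.sum_congr rfl fun k _ => h3 k, Finset.sum_comm]
      refine Finset.sum_eq_zero fun t _ => ?_
      rw [← Finset.mul_sum]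
      have h4 : ∑ k : Fin r, (P j).coeff k * t ^ (k : ℕ) = (P j).eval t := by
        rw [eval_eq_sum_range' (n := r) (by rw [hPd]; exact j.2),
          Fin.sum_univ_eq_sum_range (fun k => (P j).coeff k * t ^ k) r]
      rw [h4]
      by_cases ht : g y t = 0
      · simp [ht]
      · have : w.eval t = 0 := by
          rw [hw, eval_prod]
          exact Finset.prod_eq_zero (i := t) (by simpa [s] using ht) (by simp)
        simp [P, hj, this]
    choose! Q hQ using hcol
    set B' : Matrix (Fin r) (Fin r) F[X] :=
      Matrix.of fun i j => if (j : ℕ) < #s then B i j else Q i j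
    set d : Fin r → F[X] := fun j => if (j : ℕ) < #s then 1 else X - C y
    have hBB : B = B' * Matrix.diagonal d := by
      ext1 i j
      rw [Matrix.mul_diagonal]
      simp only [B', d, Matrix.of_apply]
      split_ifs with h
      · simp
      · rw [hQ i j h, mul_comm]
    rw [← hBdet, hBB, Matrix.det_mul, Matrix.det_diagonal]
    refine Dvd.dvd.mul_left ?_ _
    have : ∏ i, d i = (X - C y) ^ (r - #s) := by
      simp only [d]
      rw [Fin.prod_univ_eq_prod_range (fun j => if j < #s then (1 : F[X]) else X - C y) r,
        Finset.prod_ite, Finset.prod_const_one, one_mul, Finset.prod_const]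
      congr 1
      have : (Finset.range r).filter (fun j => ¬ j < #s) = Finset.Ico #s r := by
        ext j; simp; omega
      rw [this, Nat.card_Ico]
    rw [this]
  have hall : (∏ y, (X - C y) ^ (r - #{t | g y t ≠ 0})) ∣ A.det :=
    Finset.prod_dvd_of_coprime
      (fun a _ b _ hab => (pairwise_coprime_X_sub_C Function.injective_id hab).pow)
      fun y _ => hdvd y
  calc ∑ y, (r - #{t | g y t ≠ 0})
      = (∏ y, (X - C y) ^ (r - #{t | g y t ≠ 0})).natDegree := by
        rw [natDegree_prod_of_monic _ _ fun y _ => (monic_X_sub_C y).pow _]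
        simp [(monic_X_sub_C _).natDegree_pow]
    _ ≤ A.det.natDegree := natDegree_le_of_dvd hall hne
    _ ≤ _ := hdetdeg

end Hankel

section Geometry

variable [Fintype F] {n : ℕ}

instance : Fintype (Pt F n) := Fintype.ofFinite _

/-- The points of a projective subspace, as a finite set. -/
def pts (W : Submodule F (Fin (n + 1) → F)) : Finset (Pt F n) := {P | ptIn P W}

@[simp] theorem mem_pts {W : Submodule F (Fin (n + 1) → F)} {P : Pt F n} :
    P ∈ pts W ↔ ptIn P W := by simp [pts]

omit [Fintype F] in
theorem ptIn_iff_rep {W : Submodule F (Fin (n + 1) → F)} {P : Pt F n} :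
    ptIn P W ↔ P.rep ∈ W := by
  rw [ptIn, Projectivization.submodule_eq, Submodule.span_singleton_le_iff_mem]

omit [Fintype F] in
theorem ptIn_mono {W U : Submodule F (Fin (n + 1) → F)} (h : W ≤ U) {P : Pt F n}
    (hP : ptIn P W) : ptIn P U := le_trans hP h

omit [Fintype F] in
theorem ptIn_inf {W U : Submodule F (Fin (n + 1) → F)} {P : Pt F n} :
    ptIn P (W ⊓ U) ↔ ptIn P W ∧ ptIn P U := le_inf_iff

/-- The point spanned by a nonzero vector (with a junk value at zero). -/
def pmk (v : Fin (n + 1) → F) : Pt F n :=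
  if h : v ≠ 0 then Projectivization.mk F v h else Projectivization.mk F 1 one_ne_zero

omit [Fintype F] in
theorem pmk_of_ne {v : Fin (n + 1) → F} (h : v ≠ 0) : pmk v = Projectivization.mk F v h :=
  dif_pos h

omit [Fintype F] in
theorem submodule_pmk {v : Fin (n + 1) → F} (h : v ≠ 0) :
    (pmk v).submodule = Submodule.span F {v} := by
  rw [pmk_of_ne h, Projectivization.submodule_mk]

omit [Fintype F] in
theorem ptIn_pmk {W : Submodule F (Fin (n + 1) → F)} {v : Fin (n + 1) → F} (h : v ≠ 0) :
    ptIn (pmk v) W ↔ v ∈ W := by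
  rw [ptIn, submodule_pmk h, Submodule.span_singleton_le_iff_mem]

omit [Fintype F] in
theorem pmk_eq_iff {v w : Fin (n + 1) → F} (hv : v ≠ 0) (hw : w ≠ 0) :
    pmk v = pmk w ↔ ∃ a : F, a • w = v := by
  rw [pmk_of_ne hv, pmk_of_ne hw, Projectivization.mk_eq_mk_iff']

omit [Fintype F] in
theorem pmk_rep (P : Pt F n) : pmk P.rep = P := by
  rw [pmk_of_ne P.rep_nonzero, Projectivization.mk_rep]

theorem card_pts (W : Submodule F (Fin (n + 1) → F)) :
    (pts W).card = ∑ i ∈ Finset.range (Module.finrank F W), Fintype.card F ^ i := by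
  rw [← Nat.card_eq_fintype_card, ← Projectivization.card_of_finrank F W rfl]
  have hinj := Projectivization.map_injective (τ := RingHom.id F) W.subtype W.injective_subtype
  have : (pts W : Set (Pt F n)) =
      Set.range (Projectivization.map W.subtype W.injective_subtype) := by
    ext P
    simp only [Finset.mem_coe, mem_pts, Set.mem_range]
    constructor
    · intro h
      rw [ptIn_iff_rep] at h
      refine ⟨Projectivization.mk F ⟨P.rep, h⟩ ?_, ?_⟩
      · intro h0
        exact P.rep_nonzero (congrArg Subtype.val h0)
      · rw [Projectivization.map_mk]
        exact P.mk_rep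
    · rintro ⟨Q, rfl⟩
      induction Q using Projectivization.ind with
      | h v hv =>
        rw [Projectivization.map_mk, ptIn, Projectivization.submodule_mk,
          Submodule.span_singleton_le_iff_mem]
        exact v.2
  rw [← Set.ncard_coe_finset, this, Set.ncard_range_of_injective hinj]

theorem card_pts_line {l : Submodule F (Fin (n + 1) → F)} (hl : Module.finrank F l = 2) :
    (pts l).card = Fintype.card F + 1 := by
  rw [card_pts, hl]; simp [Finset.sum_range_succ, add_comm]

omit [Fintype F] in
theorem finrank_join {P Q : Pt F n} (h : P ≠ Q) :
    Module.finrank F ↥(P.submodule ⊔ Q.submodule) = 2 := by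
  have h1 := Submodule.finrank_sup_add_finrank_inf_eq P.submodule Q.submodule
  rw [P.finrank_submodule, Q.finrank_submodule] at h1
  have h2 : Module.finrank F ↥(P.submodule ⊓ Q.submodule) = 0 := by
    by_contra h0
    have hle : Module.finrank F ↥(P.submodule ⊓ Q.submodule) ≤ Module.finrank F P.submodule :=
      Submodule.finrank_mono inf_le_left
    rw [P.finrank_submodule] at hle
    have e1 := Submodule.eq_of_le_of_finrank_eq (inf_le_left : P.submodule ⊓ Q.submodule ≤ _)
      (by rw [P.finrank_submodule]; omega)
    have e2 := Submodule.eq_of_le_of_finrank_eq (inf_le_right : P.submodule ⊓ Q.submodule ≤ _)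
      (by rw [Q.finrank_submodule]; omega)
    exact h (Projectivization.submodule_injective (e1.symm.trans e2))
  omega

omit [Fintype F] in
theorem line_eq_join {l : Submodule F (Fin (n + 1) → F)} (hl : Module.finrank F l = 2)
    {P Q : Pt F n} (h : P ≠ Q) (hP : ptIn P l) (hQ : ptIn Q l) :
    l = P.submodule ⊔ Q.submodule :=
  (Submodule.eq_of_le_of_finrank_eq (sup_le hP hQ) (by rw [finrank_join h, hl])).symm

omit [Fintype F] in
theorem line_unique_of_mem {l m : Submodule F (Fin (n + 1) → F)} (hl : Module.finrank F l = 2)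
    (hm : Module.finrank F m = 2) {P Q : Pt F n} (h : P ≠ Q) (hP : ptIn P l) (hQ : ptIn Q l)
    (hP' : ptIn P m) (hQ' : ptIn Q m) : l = m :=
  (line_eq_join hl h hP hQ).trans (line_eq_join hm h hP' hQ').symm

omit [Fintype F] in
theorem exists_pt_of_finrank_one {U : Submodule F (Fin (n + 1) → F)}
    (hU : Module.finrank F U = 1) : ∃ X : Pt F n, X.submodule = U :=
  ⟨Projectivization.mk'' U hU, Projectivization.submodule_mk'' U hU⟩

omit [Fintype F] in
theorem ptIn_submodule {P X : Pt F n} : ptIn P X.submodule ↔ P = X := by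
  constructor
  · intro h
    exact Projectivization.submodule_injective
      (Submodule.eq_of_le_of_finrank_eq h (by rw [P.finrank_submodule, X.finrank_submodule]))
  · rintro rfl; exact le_refl _

omit [Fintype F] in
theorem finrank_inf_lines {l m W : Submodule F (Fin (n + 1) → F)} (hl : Module.finrank F l = 2)
    (hm : Module.finrank F m = 2) (hW : Module.finrank F W = 3) (hlW : l ≤ W) (hmW : m ≤ W)
    (hne : l ≠ m) : Module.finrank F ↥(l ⊓ m) = 1 := by
  have h1 := Submodule.finrank_sup_add_finrank_inf_eq l m
  have h2 : Module.finrank F ↥(l ⊔ m) ≤ Module.finrank F W :=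
    Submodule.finrank_mono (sup_le hlW hmW)
  have h3 : Module.finrank F ↥(l ⊓ m) ≠ 2 := by
    intro h
    have e1 := Submodule.eq_of_le_of_finrank_eq (inf_le_left : l ⊓ m ≤ _) (by rw [h, hl])
    have e2 := Submodule.eq_of_le_of_finrank_eq (inf_le_right : l ⊓ m ≤ _) (by rw [h, hm])
    exact hne (e1.symm.trans e2)
  have h4 : Module.finrank F ↥(l ⊓ m) ≤ Module.finrank F l := Submodule.finrank_mono inf_le_left
  omega

omit [Fintype F] in
/-- Two distinct lines of a plane meet in exactly one point. -/
theorem exists_pt_inf_lines {l m W : Submodule F (Fin (n + 1) → F)}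
    (hl : Module.finrank F l = 2)
    (hm : Module.finrank F m = 2) (hW : Module.finrank F W = 3) (hlW : l ≤ W) (hmW : m ≤ W)
    (hne : l ≠ m) : ∃ X : Pt F n, ∀ P, ptIn P l ∧ ptIn P m ↔ P = X := by
  obtain ⟨X, hX⟩ := exists_pt_of_finrank_one (finrank_inf_lines hl hm hW hlW hmW hne)
  refine ⟨X, fun P => ?_⟩
  rw [← ptIn_inf, ← hX, ptIn_submodule]

omit [Fintype F] in
/-- Hyperplanes are kernels of linear forms. -/
theorem exists_eq_ker {W : Submodule F (Fin (n + 1) → F)} (hW : Module.finrank F W = n) :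
    ∃ f : (Fin (n + 1) → F) →ₗ[F] F, W = LinearMap.ker f := by
  have hlt : W < ⊤ := by
    rw [lt_top_iff_ne_top]
    rintro rfl
    simp at hW
  obtain ⟨f, hf0, hf⟩ := Submodule.exists_le_ker_of_lt_top W hlt
  refine ⟨f, Submodule.eq_of_le_of_finrank_eq hf ?_⟩
  have h1 := LinearMap.finrank_range_add_finrank_ker f
  have h2 : Module.finrank F (LinearMap.range f) = 1 := by
    rw [LinearMap.range_eq_top.mpr (LinearMap.surjective hf0)]
    simp
  simp at h1
  omega

variable {p : ℕ} [Fact p.Prime]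

/-- The word `c` has the same sum on all lines. -/
theorem exists_lineSum (hp : (Fintype.card F : ZMod p) = 0) {c : Pt F n → ZMod p}
    (hc : c ∈ code F p n) :
    ∃ s : ZMod p, ∀ l : Submodule F (Fin (n + 1) → F), Module.finrank F l = 2 →
      ∑ P ∈ pts l, c P = s := by
  induction hc using Submodule.span_induction with
  | mem v hv =>
    obtain ⟨W, hW, rfl⟩ := hv
    refine ⟨1, fun l hl => ?_⟩
    have h0 : ∑ P ∈ pts l, incVec p W P = ((pts (l ⊓ W)).card : ZMod p) := by
      simp only [incVec]
      rw [Finset.sum_ite, Finset.sum_const_zero, add_zero, Finset.sum_const, nsmul_one]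
      congr 2
      ext P
      simp [ptIn_inf]
    rw [h0, card_pts]
    have h1 := Submodule.finrank_sup_add_finrank_inf_eq l W
    have h2 : Module.finrank F ↥(l ⊔ W) ≤ n + 1 := by
      simpa using Submodule.finrank_le (l ⊔ W)
    have h3 : Module.finrank F ↥(l ⊓ W) ≤ Module.finrank F l := Submodule.finrank_mono inf_le_left
    have : Module.finrank F ↥(l ⊓ W) = 1 ∨ Module.finrank F ↥(l ⊓ W) = 2 := by omega
    rcases this with h | h <;> rw [h] <;> simp [Finset.sum_range_succ, hp]
  | zero => exact ⟨0, fun l _ => by simp⟩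
  | add x y _ _ hx hy =>
    obtain ⟨s, hs⟩ := hx
    obtain ⟨t, ht⟩ := hy
    exact ⟨s + t, fun l hl => by
      simp only [Pi.add_apply, Finset.sum_add_distrib, hs l hl, ht l hl]⟩
  | smul a x _ hx =>
    obtain ⟨s, hs⟩ := hx
    exact ⟨a * s, fun l hl => by
      simp only [Pi.smul_apply, smul_eq_mul, ← Finset.mul_sum, hs l hl]⟩

open Polynomial in
/-- Along the lines through a point, the power moments of a code word are polynomials. -/
theorem exists_moment_polynomial (ι : ZMod p →+* F) {c : Pt F n → ZMod p}
    (hc : c ∈ code F p n) {e₀ e₁ e₂ : Fin (n + 1) → F}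
    (hind : ∀ y t : F, e₁ + y • e₂ + t • e₀ ≠ 0) (j : ℕ) :
    ∃ m : F[X], m.natDegree ≤ j ∧
      ∀ y, m.eval y = ∑ t, t ^ j * ι (c (pmk (e₁ + y • e₂ + t • e₀))) := by
  induction hc using Submodule.span_induction with
  | mem v hv =>
    obtain ⟨W, hW, rfl⟩ := hv
    obtain ⟨f, rfl⟩ := exists_eq_ker hW
    have hval : ∀ y t : F, ι (incVec p (LinearMap.ker f) (pmk (e₁ + y • e₂ + t • e₀))) =
        if f e₁ + y * f e₂ + t * f e₀ = 0 then 1 else 0 := by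
      intro y t
      simp only [incVec, ptIn_pmk (hind y t), LinearMap.mem_ker, map_add, map_smul, smul_eq_mul]
      split_ifs <;> simp
    simp only [hval]
    by_cases ha : f e₀ = 0
    · simp only [ha, mul_zero, add_zero, ← Finset.sum_mul]
      by_cases hj : j < Fintype.card F - 1
      · exact ⟨0, by simp, fun y => by simp [FiniteField.sum_pow_lt_card_sub_one F j hj]⟩
      · set u : F → F := fun y => (∑ t : F, t ^ j) * if f e₁ + y * f e₂ = 0 then 1 else 0
        refine ⟨Lagrange.interpolate Finset.univ id u, ?_, fun y => ?_⟩
        · have := Lagrange.degree_interpolate_lt (s := (Finset.univ : Finset F)) (v := id) u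
            Function.injective_id.injOn
          rw [Finset.card_univ] at this
          refine natDegree_le_iff_coeff_eq_zero.mpr fun i hi => coeff_eq_zero_of_degree_lt ?_
          exact this.trans_le (by exact_mod_cast (by omega : Fintype.card F ≤ i))
        · have := Lagrange.eval_interpolate_at_node (s := (Finset.univ : Finset F)) (v := id) u
            Function.injective_id.injOn (Finset.mem_univ y)
          exact this
    · refine ⟨(C (-(f e₁) / f e₀) + C (-(f e₂) / f e₀) * X) ^ j, ?_, fun y => ?_⟩
      · refine natDegree_pow_le.trans ?_
        have : (C (-(f e₁) / f e₀) + C (-(f e₂) / f e₀) * X : F[X]).natDegree ≤ 1 := by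
          compute_degree
        nlinarith
      · rw [Finset.sum_eq_single (-(f e₁) / f e₀ + -(f e₂) / f e₀ * y)]
        · have : f e₁ + y * f e₂ + (-(f e₁) / f e₀ + -(f e₂) / f e₀ * y) * f e₀ = 0 := by
            field_simp; ring
          rw [if_pos this]
          simp
        · intro t _ ht
          rw [if_neg, mul_zero]
          intro h0
          apply ht
          field_simp
          linear_combination h0
        · simp
  | zero => exact ⟨0, by simp, fun y => by simp⟩
  | add x y _ _ hx hy =>
    obtain ⟨m₁, hd₁, hm₁⟩ := hx
    obtain ⟨m₂, hd₂, hm₂⟩ := hy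
    refine ⟨m₁ + m₂, (natDegree_add_le _ _).trans (max_le hd₁ hd₂), fun z => ?_⟩
    simp only [eval_add, hm₁, hm₂, Pi.add_apply, map_add, mul_add, Finset.sum_add_distrib]
  | smul a x _ hx =>
    obtain ⟨m, hd, hm⟩ := hx
    refine ⟨C (ι a) * m, (natDegree_C_mul_le _ _).trans hd, fun z => ?_⟩
    simp only [eval_mul, eval_C, hm, Pi.smul_apply, smul_eq_mul, map_mul, Finset.mul_sum]
    exact Finset.sum_congr rfl fun t _ => by ring

end Geometry

section Planes

variable [Fintype F] {n : ℕ}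

theorem pts_line_param {l : Submodule F (Fin (n + 1) → F)} (hl : Module.finrank F l = 2)
    {e₀ e₁ : Fin (n + 1) → F} (h₀ : e₀ ∈ l) (h₁ : e₁ ∈ l)
    (hli : ∀ a b : F, a • e₀ + b • e₁ = 0 → a = 0 ∧ b = 0) :
    (Function.Injective fun t : F => (pmk (e₁ + t • e₀) : Pt F n)) ∧
    pmk e₀ ∉ Finset.univ.image (fun t : F => (pmk (e₁ + t • e₀) : Pt F n)) ∧
    pts l = insert (pmk e₀) (Finset.univ.image fun t : F => pmk (e₁ + t • e₀)) := by
  have he0 : e₀ ≠ 0 := by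
    rintro rfl
    have := hli 1 0 (by simp)
    exact one_ne_zero this.1
  have hne : ∀ t : F, e₁ + t • e₀ ≠ 0 := by
    intro t h
    have := hli t 1 (by rw [← h]; module)
    exact one_ne_zero this.2
  have hinj : Function.Injective fun t : F => (pmk (e₁ + t • e₀) : Pt F n) := by
    intro t t' h
    obtain ⟨a, ha⟩ := (pmk_eq_iff (hne t) (hne t')).mp h
    have := hli (a * t' - t) (a - 1) (by
      linear_combination (norm := module) ha)
    obtain ⟨h1, h2⟩ := this
    have : a = 1 := sub_eq_zero.mp h2
    rw [this, one_mul] at h1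
    exact (sub_eq_zero.mp h1).symm
  have hnot : pmk e₀ ∉ Finset.univ.image (fun t : F => (pmk (e₁ + t • e₀) : Pt F n)) := by
    intro h
    obtain ⟨t, -, ht⟩ := Finset.mem_image.mp h
    obtain ⟨a, ha⟩ := (pmk_eq_iff (hne t) he0).mp ht
    have := hli (t - a) 1 (by linear_combination (norm := module) -ha)
    exact one_ne_zero this.2
  refine ⟨hinj, hnot, (Finset.eq_of_subset_of_card_le ?_ ?_).symm⟩
  · intro P hP
    rw [Finset.mem_insert] at hP
    rcases hP with rfl | hP
    · rw [mem_pts, ptIn_pmk he0]; exact h₀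
    · obtain ⟨t, -, rfl⟩ := Finset.mem_image.mp hP
      rw [mem_pts, ptIn_pmk (hne t)]
      exact l.add_mem h₁ (l.smul_mem _ h₀)
  · rw [Finset.card_insert_of_notMem hnot, Finset.card_image_of_injective _ hinj, card_pts_line hl,
      Finset.card_univ]

theorem sum_pts_line_param {M : Type*} [AddCommMonoid M] (f : Pt F n → M)
    {l : Submodule F (Fin (n + 1) → F)} (hl : Module.finrank F l = 2)
    {e₀ e₁ : Fin (n + 1) → F} (h₀ : e₀ ∈ l) (h₁ : e₁ ∈ l)
    (hli : ∀ a b : F, a • e₀ + b • e₁ = 0 → a = 0 ∧ b = 0) :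
    ∑ P ∈ pts l, f P = f (pmk e₀) + ∑ t : F, f (pmk (e₁ + t • e₀)) := by
  obtain ⟨hinj, hnot, heq⟩ := pts_line_param hl h₀ h₁ hli
  rw [heq, Finset.sum_insert hnot, Finset.sum_image fun a _ b _ h => hinj h]

/-- A line through a zero of `c` meeting the support in `r` points forces every plane through it
to contain at least `r * (q - r)` further support points. -/
theorem mul_le_card_plane_diff_line {p : ℕ} [Fact p.Prime] (ι : ZMod p →+* F)
    {c : Pt F n → ZMod p} (hc : c ∈ code F p n) {W l : Submodule F (Fin (n + 1) → F)}
    (hl : Module.finrank F l = 2) (hlW : l < W) {P : Pt F n}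
    (hP : ptIn P l) (hcP : c P = 0) :
    (((pts l).filter fun Q => c Q ≠ 0).card) *
      (Fintype.card F - ((pts l).filter fun Q => c Q ≠ 0).card) ≤
      ((pts W).filter fun Q => ¬ ptIn Q l ∧ c Q ≠ 0).card := by
  set r := ((pts l).filter fun Q => c Q ≠ 0).card with hr
  obtain ⟨e₂, he₂W, he₂⟩ := SetLike.exists_of_lt hlW
  obtain ⟨e₀, he₀, hPe⟩ : ∃ e₀ : Fin (n + 1) → F, e₀ ≠ 0 ∧ pmk e₀ = P :=
    ⟨P.rep, P.rep_nonzero, pmk_rep P⟩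
  have he₀l : e₀ ∈ l := by rw [← ptIn_pmk he₀, hPe]; exact hP
  have hlt : Submodule.span F {e₀} < l := by
    refine lt_of_le_of_ne ((Submodule.span_singleton_le_iff_mem _ _).mpr he₀l) ?_
    rintro rfl
    rw [finrank_span_singleton he₀] at hl
    omega
  obtain ⟨e₁, he₁l, he₁⟩ := SetLike.exists_of_lt hlt
  have hli : ∀ a b : F, a • e₀ + b • e₁ = 0 → a = 0 ∧ b = 0 := by
    intro a b h
    have hb : b = 0 := by
      by_contra hb
      apply he₁
      rw [Submodule.mem_span_singleton]
      refine ⟨-(b⁻¹ * a), ?_⟩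
      have : e₁ = b⁻¹ • (b • e₁) := by rw [smul_smul, inv_mul_cancel₀ hb, one_smul]
      rw [this, eq_neg_of_add_eq_zero_right h, smul_neg, smul_smul, neg_smul]
    subst hb
    simp only [zero_smul, add_zero, smul_eq_zero, he₀, or_false] at h
    exact ⟨h, rfl⟩
  have hli3 : ∀ a b d : F, a • e₀ + b • e₁ + d • e₂ = 0 → a = 0 ∧ b = 0 ∧ d = 0 := by
    intro a b d h
    have hd : d = 0 := by
      by_contra hd
      apply he₂
      have : e₂ = d⁻¹ • (d • e₂) := by rw [smul_smul, inv_mul_cancel₀ hd, one_smul]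
      rw [this, eq_neg_of_add_eq_zero_right h]
      exact l.smul_mem _ (l.neg_mem (l.add_mem (l.smul_mem _ he₀l) (l.smul_mem _ he₁l)))
    subst hd
    rw [zero_smul, add_zero] at h
    exact ⟨(hli a b h).1, (hli a b h).2, rfl⟩
  have hne : ∀ y t : F, e₁ + y • e₂ + t • e₀ ≠ 0 := by
    intro y t h
    have := hli3 t 1 y (by rw [← h]; module)
    exact one_ne_zero this.2.1
  choose m hmdeg hm using fun j => exists_moment_polynomial ι hc hne j
  have hr0 : (Finset.univ.filter fun t : F => ι (c (pmk (e₁ + (0 : F) • e₂ + t • e₀))) ≠ 0).card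
      = r := by
    have h1 := sum_pts_line_param (fun Q => if c Q ≠ 0 then 1 else 0) hl he₀l he₁l hli
    rw [hPe, hcP, ← Finset.card_filter, ← hr] at h1
    simp only [ne_eq, not_true_eq_false, if_false, zero_add] at h1
    rw [h1, ← Finset.card_filter]
    simp
  have hH := sum_fibre_defect_le (fun y t => ι (c (pmk (e₁ + y • e₂ + t • e₀)))) m hmdeg
    (fun j y => hm j y) r 0 hr0
  set N : F → ℕ := fun y =>
    (Finset.univ.filter fun t : F => ι (c (pmk (e₁ + y • e₂ + t • e₀))) ≠ 0).card with hN
  have hrq : r * Fintype.card F ≤ r * (r - 1) + r + ∑ y ∈ Finset.univ.erase (0 : F), N y := by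
    have h1 : ∑ y : F, r ≤ ∑ y : F, ((r - N y) + N y) :=
      Finset.sum_le_sum fun y _ => by omega
    rw [Finset.sum_const, Finset.card_univ, Finset.sum_add_distrib, smul_eq_mul] at h1
    rw [← Finset.add_sum_erase Finset.univ N (Finset.mem_univ 0)] at h1
    have : N 0 = r := hr0
    rw [this] at h1
    have h2 : ∑ y, (r - N y) ≤ r * (r - 1) := hH
    nlinarith
  have hcard : ∑ y ∈ Finset.univ.erase (0 : F), N y ≤
      ((pts W).filter fun Q => ¬ ptIn Q l ∧ c Q ≠ 0).card := by
    rw [hN, ← Finset.card_sigma]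
    refine Finset.card_le_card_of_injOn
      (fun x : (_ : F) × F => (pmk (e₁ + x.1 • e₂ + x.2 • e₀) : Pt F n)) ?_ ?_
    · rintro ⟨y, t⟩ hyt
      simp only [Finset.coe_sigma, Set.mem_sigma_iff, Finset.mem_coe, Finset.mem_erase,
        Finset.mem_univ, and_true, Finset.mem_filter, true_and] at hyt
      simp only [Finset.mem_coe, Finset.mem_filter, mem_pts, ptIn_pmk (hne y t)]
      refine ⟨W.add_mem (W.add_mem (hlW.le he₁l) (W.smul_mem _ he₂W))
        (W.smul_mem _ (hlW.le he₀l)), ?_, ?_⟩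
      · intro h
        apply he₂
        have h2 : y • e₂ ∈ l := by
          have h3 := l.sub_mem h (l.add_mem he₁l (l.smul_mem t he₀l))
          have h4 : e₁ + y • e₂ + t • e₀ - (e₁ + t • e₀) = y • e₂ := by abel
          rwa [h4] at h3
        exact (Submodule.smul_mem_iff l hyt.1).mp h2
      · intro h
        exact hyt.2 (by rw [h, map_zero])
    · rintro ⟨y, t⟩ - ⟨y', t'⟩ - h
      obtain ⟨a, ha⟩ := (pmk_eq_iff (hne y t) (hne y' t')).mp h
      have h5 := hli3 (a * t' - t) (a - 1) (a * y' - y) (by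
        linear_combination (norm := module) ha)
      have ha1 : a = 1 := sub_eq_zero.mp h5.2.1
      rw [ha1, one_mul, one_mul] at h5
      rw [sub_eq_zero.mp h5.1, sub_eq_zero.mp h5.2.2]
  rcases Nat.eq_zero_or_pos r with h0 | h0
  · simp [h0]
  · have h6 : r * (Fintype.card F - r) = r * Fintype.card F - r * r := Nat.mul_sub _ _ _
    have h7 : r * (r - 1) + r = r * r := by
      obtain ⟨k, hk⟩ : ∃ k, r = k + 1 := ⟨r - 1, by omega⟩
      rw [hk, Nat.add_sub_cancel]; ring
    omega

instance : Fintype (Submodule F (Fin (n + 1) → F)) := Fintype.ofFinite _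

/-- The planes through a line. -/
def planesThrough (l : Submodule F (Fin (n + 1) → F)) :
    Finset (Submodule F (Fin (n + 1) → F)) := {W | Module.finrank F W = 3 ∧ l ≤ W}

omit [Fintype F] in
theorem finrank_sup_pt {U : Submodule F (Fin (n + 1) → F)} {P : Pt F n} (h : ¬ ptIn P U) :
    Module.finrank F ↥(U ⊔ P.submodule) = Module.finrank F U + 1 := by
  have h1 := Submodule.finrank_sup_add_finrank_inf_eq U P.submodule
  have h2 : Module.finrank F ↥(U ⊓ P.submodule) ≤ Module.finrank F P.submodule :=
    Submodule.finrank_mono inf_le_right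
  have h3 : Module.finrank F ↥(U ⊓ P.submodule) ≠ 1 := by
    intro h3
    have := Submodule.eq_of_le_of_finrank_eq (inf_le_right : U ⊓ P.submodule ≤ _)
      (by rw [h3, P.finrank_submodule])
    exact h (by rw [ptIn, ← this]; exact inf_le_left)
  rw [P.finrank_submodule] at h1 h2
  omega

/-- The planes through a line partition the points off that line. -/
theorem card_filter_off_line (T : Pt F n → Prop) {l : Submodule F (Fin (n + 1) → F)}
    (hl : Module.finrank F l = 2) :
    (Finset.univ.filter fun P => ¬ ptIn P l ∧ T P).card =
      ∑ W ∈ planesThrough l, ((pts W).filter fun P => ¬ ptIn P l ∧ T P).card := by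
  rw [Finset.card_eq_sum_card_fiberwise (f := fun P => l ⊔ P.submodule) (t := planesThrough l)]
  · refine Finset.sum_congr rfl fun W hW => ?_
    simp only [planesThrough, Finset.mem_filter, Finset.mem_univ, true_and] at hW
    congr 1
    ext P
    simp only [Finset.mem_filter, Finset.mem_univ, true_and, mem_pts]
    constructor
    · rintro ⟨h, rfl⟩
      exact ⟨(le_sup_right : P.submodule ≤ l ⊔ P.submodule), h⟩
    · rintro ⟨hP, h⟩
      refine ⟨h, Submodule.eq_of_le_of_finrank_eq (sup_le hW.2 hP) ?_⟩
      rw [finrank_sup_pt h.1, hl, hW.1]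
  · intro P hP
    simp only [Finset.coe_filter, Finset.mem_univ, true_and, Set.mem_ofPred_eq] at hP
    simp only [planesThrough, Finset.coe_filter, Finset.mem_univ, true_and, Set.mem_ofPred_eq]
    exact ⟨by rw [finrank_sup_pt hP.1, hl], le_sup_left⟩

theorem card_planesThrough (hn : 1 ≤ n) {l : Submodule F (Fin (n + 1) → F)}
    (hl : Module.finrank F l = 2) :
    (planesThrough l).card = ∑ i ∈ Finset.range (n - 1), Fintype.card F ^ i := by
  obtain ⟨T, hT⟩ : ∃ T : Pt F n → Prop, ∀ P, T P := ⟨fun _ => True, fun _ => trivial⟩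
  have h1 := card_filter_off_line T hl
  have hdiff : ∀ W : Submodule F (Fin (n + 1) → F), l ≤ W →
      ((pts W).filter fun P => ¬ ptIn P l ∧ T P).card = (pts W).card - (pts l).card := by
    intro W hW
    rw [← Finset.card_sdiff_of_subset (fun P hP => by
      rw [mem_pts] at *; exact ptIn_mono hW hP)]
    congr 1
    ext P; simp [hT]
  have h2 : ∀ W ∈ planesThrough l,
      ((pts W).filter fun P => ¬ ptIn P l ∧ T P).card = Fintype.card F ^ 2 := by
    intro W hW
    simp only [planesThrough, Finset.mem_filter, Finset.mem_univ, true_and] at hW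
    rw [hdiff W hW.2, card_pts, card_pts, hW.1, hl]
    simp [Finset.sum_range_succ]
  have huniv : (Finset.univ : Finset (Pt F n)) = pts ⊤ := by
    ext P; simp [ptIn]
  rw [Finset.sum_congr rfl h2, Finset.sum_const, smul_eq_mul, huniv, hdiff ⊤ le_top,
    card_pts,
    card_pts, hl] at h1
  obtain ⟨k, rfl⟩ : ∃ k, n = k + 1 := ⟨n - 1, by omega⟩
  have h3 : Module.finrank F (⊤ : Submodule F (Fin (k + 1 + 1) → F)) = 2 + k := by simp; ring
  rw [h3, Finset.sum_range_add, Nat.add_sub_cancel_left] at h1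
  have hq : 0 < Fintype.card F ^ 2 := pow_pos Fintype.card_pos 2
  simp only [pow_add, ← Finset.mul_sum] at h1
  rw [mul_comm] at h1
  simpa using (Nat.eq_of_mul_eq_mul_right hq h1).symm

end Planes

section GapPlanes

variable {P K : Type} [Field K]

/-- The zeros of a word on a line. -/
def zeros (c : P → K) (l : Finset P) : Finset P := l.filter fun x => c x = 0

/-- The number of nonzero values of a word on a line. -/
def nz (c : P → K) (l : Finset P) : ℕ := (l.filter fun x => c x ≠ 0).card

/-- A finite projective plane of order `q` with a word having constant line sum `s`. -/
structure PlaneWord (Ω : Finset P) (𝓛 : Finset (Finset P)) (q : ℕ) (c : P → K) (s : K) :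
    Prop where
  sub : ∀ l ∈ 𝓛, l ⊆ Ω
  card : ∀ l ∈ 𝓛, l.card = q + 1
  join : ∀ x ∈ Ω, ∀ y ∈ Ω, x ≠ y → ∃ l ∈ 𝓛, x ∈ l ∧ y ∈ l
  meet : ∀ l ∈ 𝓛, ∀ m ∈ 𝓛, l ≠ m → ∃ x, x ∈ l ∧ x ∈ m ∧ ∀ y, y ∈ l → y ∈ m → y = x
  card_points : Ω.card = q ^ 2 + q + 1
  sum : ∀ l ∈ 𝓛, ∑ x ∈ l, c x = s

variable {Ω : Finset P} {𝓛 : Finset (Finset P)} {q : ℕ} {c : P → K} {s : K}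

theorem zeros_card_add_nz (l : Finset P) : (zeros c l).card + nz c l = l.card :=
  Finset.card_filter_add_card_filter_not _

theorem four_le_card_of_mem {t : Finset P} {x y z w : P} (hx : x ∈ t) (hy : y ∈ t) (hz : z ∈ t)
    (hw : w ∈ t) (h1 : x ≠ y) (h2 : x ≠ z) (h3 : x ≠ w) (h4 : y ≠ z) (h5 : y ≠ w) (h6 : z ≠ w) :
    4 ≤ t.card := by
  have : ({x, y, z, w} : Finset P).card = 4 := by
    rw [Finset.card_insert_of_notMem, Finset.card_insert_of_notMem, Finset.card_insert_of_notMem,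
      Finset.card_singleton] <;> simp [*]
  rw [← this]
  refine Finset.card_le_card ?_
  intro a ha
  simp only [Finset.mem_insert, Finset.mem_singleton] at ha
  rcases ha with rfl | rfl | rfl | rfl <;> assumption

namespace PlaneWord

theorem line_unique (H : PlaneWord Ω 𝓛 q c s) {l m : Finset P} (hl : l ∈ 𝓛) (hm : m ∈ 𝓛)
    {x y : P} (hxy : x ≠ y) (hxl : x ∈ l) (hyl : y ∈ l) (hxm : x ∈ m) (hym : y ∈ m) : l = m := by
  by_contra h
  obtain ⟨z, -, -, hz⟩ := H.meet l hl m hm h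
  exact hxy ((hz x hxl hxm).trans (hz y hyl hym).symm)

theorem card_inter_le (H : PlaneWord Ω 𝓛 q c s) {l m : Finset P} (hl : l ∈ 𝓛) (hm : m ∈ 𝓛)
    (h : l ≠ m) : (l ∩ m).card ≤ 1 := by
  rw [Finset.card_le_one]
  intro x hx y hy
  rw [Finset.mem_inter] at hx hy
  by_contra hxy
  exact h (H.line_unique hl hm hxy hx.1 hy.1 hx.2 hy.2)

theorem sum_pencil (H : PlaneWord Ω 𝓛 q c s) {Z : P} (hZ : Z ∈ Ω) {R : Finset P} (hR : R ⊆ Ω)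
    (hZR : Z ∉ R) :
    ∑ l ∈ 𝓛.filter (fun l => Z ∈ l), (R.filter fun x => x ∈ l).card = R.card := by
  simp only [Finset.card_filter]
  rw [Finset.sum_comm, Finset.card_eq_sum_ones]
  refine Finset.sum_congr rfl fun x hx => ?_
  have hZx : Z ≠ x := fun h => hZR (h ▸ hx)
  obtain ⟨l, hl, hZl, hxl⟩ := H.join Z hZ x (hR hx) hZx
  rw [Finset.sum_eq_single l]
  · simp [hxl]
  · intro m hm hml
    rw [Finset.mem_filter] at hm
    rw [if_neg]
    intro hxm
    exact hml (H.line_unique hm.1 hl hZx hm.2 hxm hZl hxl)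
  · intro h
    exact absurd (Finset.mem_filter.mpr ⟨hl, hZl⟩) h

theorem card_pencil (H : PlaneWord Ω 𝓛 q c s) (hq : 0 < q) {Z : P} (hZ : Z ∈ Ω) :
    (𝓛.filter fun l => Z ∈ l).card = q + 1 := by
  have h := H.sum_pencil hZ (Finset.erase_subset Z Ω) (Finset.notMem_erase Z Ω)
  have h2 : ∀ l ∈ 𝓛.filter (fun l => Z ∈ l),
      ((Ω.erase Z).filter fun x => x ∈ l).card = q := by
    intro l hl
    rw [Finset.mem_filter] at hl
    have : (Ω.erase Z).filter (fun x => x ∈ l) = l.erase Z := by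
      ext x
      simp only [Finset.mem_filter, Finset.mem_erase]
      exact ⟨fun h => ⟨h.1.1, h.2⟩, fun h => ⟨⟨h.1, H.sub l hl.1 h.2⟩, h.2⟩⟩
    rw [this, Finset.card_erase_of_mem hl.2, H.card l hl.1, Nat.add_sub_cancel]
  rw [Finset.sum_congr rfl h2, Finset.sum_const, smul_eq_mul, Finset.card_erase_of_mem hZ,
    H.card_points, Nat.add_sub_cancel] at h
  exact Nat.eq_of_mul_eq_mul_right hq (by rw [h]; ring)

theorem card_pencil_meeting_le (H : PlaneWord Ω 𝓛 q c s) {Z : P} (hZ : Z ∈ Ω) {B : Finset P}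
    (hB : B ⊆ Ω) (hZB : Z ∉ B) :
    ((𝓛.filter fun l => Z ∈ l).filter fun l => ∃ x ∈ B, x ∈ l).card ≤ B.card := by
  rw [← H.sum_pencil hZ hB hZB, Finset.card_filter]
  refine Finset.sum_le_sum fun l _ => ?_
  split_ifs with h
  · obtain ⟨x, hx, hxl⟩ := h
    exact Finset.card_pos.mpr ⟨x, Finset.mem_filter.mpr ⟨hx, hxl⟩⟩
  · exact Nat.zero_le _

theorem le_card_pencil_avoiding (H : PlaneWord Ω 𝓛 q c s) (hq : 0 < q) {Z : P} (hZ : Z ∈ Ω)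
    {B : Finset P} (hB : B ⊆ Ω) (hZB : Z ∉ B) (m : Finset P) :
    q ≤ B.card + ((𝓛.filter fun l => Z ∈ l).filter
      fun l => l ≠ m ∧ ∀ x ∈ B, x ∉ l).card := by
  have h1 := H.card_pencil hq hZ
  have h2 := H.card_pencil_meeting_le hZ hB hZB
  have h3 : (𝓛.filter fun l => Z ∈ l) ⊆
      ((𝓛.filter fun l => Z ∈ l).filter fun l => ∃ x ∈ B, x ∈ l) ∪
      (((𝓛.filter fun l => Z ∈ l).filter fun l => l ≠ m ∧ ∀ x ∈ B, x ∉ l) ∪ {m}) := by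
    intro l hl
    simp only [Finset.mem_union, Finset.mem_filter, Finset.mem_singleton] at hl ⊢
    by_cases hlm : l = m
    · exact Or.inr (Or.inr hlm)
    · by_cases hb : ∃ x ∈ B, x ∈ l
      · exact Or.inl ⟨hl, hb⟩
      · push Not at hb
        exact Or.inr (Or.inl ⟨hl, hlm, hb⟩)
  have h4 := (Finset.card_le_card h3).trans (Finset.card_union_le _ _)
  have h5 := Finset.card_union_le
    ((𝓛.filter fun l => Z ∈ l).filter fun l => l ≠ m ∧ ∀ x ∈ B, x ∉ l) {m}
  rw [Finset.card_singleton] at h5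
  omega

theorem add_eq_of_two (H : PlaneWord Ω 𝓛 q c s) {l : Finset P} (hl : l ∈ 𝓛) {x y : P}
    (hxy : x ≠ y) (hx : x ∈ l) (hy : y ∈ l) (h : ∀ z ∈ l, z ≠ x → z ≠ y → c z = 0) :
    c x + c y = s := by
  rw [← H.sum l hl, ← Finset.sum_pair hxy]
  refine Finset.sum_subset (fun z hz => ?_) fun z hz hz' => ?_
  · simp only [Finset.mem_insert, Finset.mem_singleton] at hz
    rcases hz with rfl | rfl <;> assumption
  · simp only [Finset.mem_insert, Finset.mem_singleton, not_or] at hz'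
    exact h z hz hz'.1 hz'.2

theorem add_eq_of_three (H : PlaneWord Ω 𝓛 q c s) {l : Finset P} (hl : l ∈ 𝓛) {x y w : P}
    (hxy : x ≠ y) (hxw : x ≠ w) (hyw : y ≠ w) (hx : x ∈ l) (hy : y ∈ l) (hw : w ∈ l)
    (h : ∀ z ∈ l, z ≠ x → z ≠ y → z ≠ w → c z = 0) :
    c x + c y + c w = s := by
  have : c x + c y + c w = ∑ z ∈ ({x, y, w} : Finset P), c z := by
    rw [Finset.sum_insert (by simp [hxy, hxw]), Finset.sum_pair hyw, add_assoc]
  rw [← H.sum l hl, this]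
  refine Finset.sum_subset (fun z hz => ?_) fun z hz hz' => ?_
  · simp only [Finset.mem_insert, Finset.mem_singleton] at hz
    rcases hz with rfl | rfl | rfl <;> assumption
  · simp only [Finset.mem_insert, Finset.mem_singleton, not_or] at hz'
    exact h z hz hz'.1 hz'.2.1 hz'.2.2

/-- The support points off a line. -/
def offSupp (Ω : Finset P) (c : P → K) (l : Finset P) : Finset P :=
  Ω.filter fun x => x ∉ l ∧ c x ≠ 0

theorem nz_le_card_offSupp_add_one (H : PlaneWord Ω 𝓛 q c s) {l m : Finset P} (hl : l ∈ 𝓛)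
    (hm : m ∈ 𝓛) (h : l ≠ m) : nz c m ≤ ((offSupp Ω c l).filter fun x => x ∈ m).card + 1 := by
  have h1 : m.filter (fun x => c x ≠ 0) ⊆
      ((offSupp Ω c l).filter fun x => x ∈ m) ∪ (l ∩ m) := by
    intro x hx
    simp only [offSupp, Finset.mem_union, Finset.mem_filter, Finset.mem_inter] at hx ⊢
    by_cases hxl : x ∈ l
    · exact Or.inr ⟨hxl, hx.1⟩
    · exact Or.inl ⟨⟨H.sub m hm hx.1, hxl, hx.2⟩, hx.1⟩
  have h2 := (Finset.card_le_card h1).trans (Finset.card_union_le _ _)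
  have h3 := H.card_inter_le hl hm h
  unfold nz
  omega

theorem zeros_card_le (H : PlaneWord Ω 𝓛 q c s) {l : Finset P} (hl : l ∈ 𝓛)
    (h : q ≤ nz c l + 3) : (zeros c l).card ≤ 4 := by
  have := zeros_card_add_nz (c := c) l
  rw [H.card l hl] at this
  omega

/-- Three further long lines make the support quadratically large. -/
theorem dense_of_three_long (H : PlaneWord Ω 𝓛 q c s) (hq : 37 ≤ q)
    (hgap : ∀ l ∈ 𝓛, nz c l ≤ 3 ∨ q ≤ nz c l + 3) {l₀ l₂ l₃ l₄ : Finset P} (h₀ : l₀ ∈ 𝓛)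
    (h₂ : l₂ ∈ 𝓛) (h₃ : l₃ ∈ 𝓛) (h₄ : l₄ ∈ 𝓛) (hz : (zeros c l₀).card ≤ 2)
    (hl₂ : q ≤ nz c l₂ + 3) (hl₃ : q ≤ nz c l₃ + 3) (hl₄ : q ≤ nz c l₄ + 3)
    (h02 : l₀ ≠ l₂) (h03 : l₀ ≠ l₃) (h04 : l₀ ≠ l₄) (h23 : l₂ ≠ l₃) (h24 : l₂ ≠ l₄)
    (h34 : l₃ ≠ l₄) : (q - 15) * (q - 4) ≤ (offSupp Ω c l₀).card := by
  obtain ⟨Z, hZ, hZ'⟩ : ∃ Z ∈ l₀, Z ∉ zeros c l₀ ∪ (l₀ ∩ l₂) ∪ (l₀ ∩ l₃) ∪ (l₀ ∩ l₄) := by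
    apply Finset.exists_mem_notMem_of_card_lt_card
    have e1 := Finset.card_union_le (zeros c l₀ ∪ (l₀ ∩ l₂) ∪ (l₀ ∩ l₃)) (l₀ ∩ l₄)
    have e2 := Finset.card_union_le (zeros c l₀ ∪ (l₀ ∩ l₂)) (l₀ ∩ l₃)
    have e3 := Finset.card_union_le (zeros c l₀) (l₀ ∩ l₂)
    have := H.card_inter_le h₀ h₂ h02
    have := H.card_inter_le h₀ h₃ h03
    have := H.card_inter_le h₀ h₄ h04
    have := H.card l₀ h₀
    omega
  simp only [zeros, Finset.mem_union, Finset.mem_inter, Finset.mem_filter, hZ, true_and,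
    not_or] at hZ'
  obtain ⟨⟨⟨hcZ, hZ2⟩, hZ3⟩, hZ4⟩ := hZ'
  have hZΩ := H.sub l₀ h₀ hZ
  set B : Finset P := zeros c l₂ ∪ zeros c l₃ ∪ zeros c l₄ ∪ (l₂ ∩ l₃) ∪ (l₂ ∩ l₄) ∪ (l₃ ∩ l₄)
    with hB
  have hBc : B.card ≤ 15 := by
    have e1 := Finset.card_union_le
      (zeros c l₂ ∪ zeros c l₃ ∪ zeros c l₄ ∪ (l₂ ∩ l₃) ∪ (l₂ ∩ l₄)) (l₃ ∩ l₄)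
    have e2 := Finset.card_union_le (zeros c l₂ ∪ zeros c l₃ ∪ zeros c l₄ ∪ (l₂ ∩ l₃)) (l₂ ∩ l₄)
    have e3 := Finset.card_union_le (zeros c l₂ ∪ zeros c l₃ ∪ zeros c l₄) (l₂ ∩ l₃)
    have e4 := Finset.card_union_le (zeros c l₂ ∪ zeros c l₃) (zeros c l₄)
    have e5 := Finset.card_union_le (zeros c l₂) (zeros c l₃)
    have := H.card_inter_le h₂ h₃ h23
    have := H.card_inter_le h₂ h₄ h24
    have := H.card_inter_le h₃ h₄ h34
    have := H.zeros_card_le h₂ hl₂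
    have := H.zeros_card_le h₃ hl₃
    have := H.zeros_card_le h₄ hl₄
    rw [hB]
    omega
  have hmemB : ∀ x, x ∈ B → x ∈ l₂ ∨ x ∈ l₃ ∨ x ∈ l₄ := by
    intro x hx
    simp only [hB, zeros, Finset.mem_union, Finset.mem_inter, Finset.mem_filter] at hx
    tauto
  have hBΩ : B ⊆ Ω := by
    intro x hx
    rcases hmemB x hx with h | h | h
    · exact H.sub _ h₂ h
    · exact H.sub _ h₃ h
    · exact H.sub _ h₄ h
  have hZB : Z ∉ B := fun h => by
    have := hmemB Z h
    tauto
  have hgood := H.le_card_pencil_avoiding (by omega) hZΩ hBΩ hZB l₀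
  have hZR : Z ∉ offSupp Ω c l₀ := by simp [offSupp, hZ]
  rw [← H.sum_pencil (R := offSupp Ω c l₀) hZΩ (Finset.filter_subset _ _) hZR]
  refine le_trans ?_ (Finset.sum_le_sum_of_subset (Finset.filter_subset
    (fun l => l ≠ l₀ ∧ ∀ x ∈ B, x ∉ l) (𝓛.filter fun l => Z ∈ l)))
  have hgood' : q - 15 ≤ ((𝓛.filter fun l => Z ∈ l).filter
      fun l => l ≠ l₀ ∧ ∀ x ∈ B, x ∉ l).card := by omega
  refine le_trans (Nat.mul_le_mul_right (q - 4) hgood') ?_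
  refine Finset.card_nsmul_le_sum _ _ _ fun l hl => ?_
  simp only [Finset.mem_filter] at hl
  obtain ⟨⟨hl, hZl⟩, hll₀, hlB⟩ := hl
  have hne : ∀ m, Z ∉ m → l ≠ m := fun m hm h => hm (h ▸ hZl)
  obtain ⟨y₂, hy₂l, hy₂, -⟩ := H.meet l hl l₂ h₂ (hne _ hZ2)
  obtain ⟨y₃, hy₃l, hy₃, -⟩ := H.meet l hl l₃ h₃ (hne _ hZ3)
  obtain ⟨y₄, hy₄l, hy₄, -⟩ := H.meet l hl l₄ h₄ (hne _ hZ4)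
  have b₂ : y₂ ∉ B := fun h => hlB _ h hy₂l
  have b₃ : y₃ ∉ B := fun h => hlB _ h hy₃l
  have b₄ : y₄ ∉ B := fun h => hlB _ h hy₄l
  simp only [hB, zeros, Finset.mem_union, Finset.mem_inter, Finset.mem_filter, not_or, not_and]
    at b₂ b₃ b₄
  obtain ⟨⟨⟨⟨⟨z₂, -⟩, -⟩, n23⟩, n24⟩, -⟩ := b₂
  obtain ⟨⟨⟨⟨⟨-, z₃⟩, -⟩, -⟩, -⟩, n34⟩ := b₃
  obtain ⟨⟨⟨⟨⟨-, -⟩, z₄⟩, -⟩, -⟩, -⟩ := b₄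
  have hfour : 4 ≤ nz c l := by
    refine four_le_card_of_mem (Finset.mem_filter.mpr ⟨hZl, hcZ⟩)
      (Finset.mem_filter.mpr ⟨hy₂l, z₂ hy₂⟩) (Finset.mem_filter.mpr ⟨hy₃l, z₃ hy₃⟩)
      (Finset.mem_filter.mpr ⟨hy₄l, z₄ hy₄⟩) ?_ ?_ ?_ ?_ ?_ ?_
    · exact fun h => hZ2 (h ▸ hy₂)
    · exact fun h => hZ3 (h ▸ hy₃)
    · exact fun h => hZ4 (h ▸ hy₄)
    · exact fun h => n23 hy₂ (h ▸ hy₃)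
    · exact fun h => n24 hy₂ (h ▸ hy₄)
    · exact fun h => n34 hy₃ (h ▸ hy₄)
  have h5 := H.nz_le_card_offSupp_add_one h₀ hl (Ne.symm hll₀)
  rcases hgap l hl with h | h <;> omega

/-- If a line is the only long one, its values different from the line sum all agree. -/
theorem eq_of_unique_long (H : PlaneWord Ω 𝓛 q c s) (hq : 37 ≤ q)
    (hgap : ∀ l ∈ 𝓛, nz c l ≤ 3 ∨ q ≤ nz c l + 3) {l₀ : Finset P} (h₀ : l₀ ∈ 𝓛)
    (hz : (zeros c l₀).card ≤ 2) (hlong : ∀ l ∈ 𝓛, q ≤ nz c l + 3 → l = l₀) {Z Z' : P}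
    (hZ : Z ∈ l₀) (hZ' : Z' ∈ l₀) (hs : c Z ≠ s) (hs' : c Z' ≠ s) : c Z = c Z' := by
  set R := offSupp Ω c l₀ with hR
  have hRΩ : R ⊆ Ω := Finset.filter_subset _ _
  have hRc : R.card ≤ q + 4 := by
    rcases R.eq_empty_or_nonempty with h | ⟨X, hX⟩
    · simp [h]
    have hX' := hX
    rw [hR, offSupp, Finset.mem_filter] at hX'
    obtain ⟨hXΩ, hXl₀, hcX⟩ := hX'
    have hsum := H.sum_pencil hXΩ ((Finset.erase_subset X R).trans hRΩ) (Finset.notMem_erase X R)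
    have hzΩ : zeros c l₀ ⊆ Ω := (Finset.filter_subset _ _).trans (H.sub _ h₀)
    have hbad := H.card_pencil_meeting_le hXΩ hzΩ (fun h => hXl₀ (Finset.mem_filter.mp h).1)
    have hpen := H.card_pencil (by omega) hXΩ
    have hle : ∀ l ∈ 𝓛.filter (fun l => X ∈ l), ((R.erase X).filter fun x => x ∈ l).card ≤
        1 + if ∃ x ∈ zeros c l₀, x ∈ l then 1 else 0 := by
      intro l hl
      rw [Finset.mem_filter] at hl
      obtain ⟨hl, hXl⟩ := hl
      have hne : l ≠ l₀ := fun h => hXl₀ (h ▸ hXl)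
      have h3 : nz c l ≤ 3 := (hgap l hl).resolve_right fun h => hne (hlong l hl h)
      obtain ⟨y, hyl, hy₀, -⟩ := H.meet l hl l₀ h₀ hne
      have hsubX : insert X ((R.erase X).filter fun x => x ∈ l) ⊆ l.filter fun x => c x ≠ 0 := by
        intro x hx
        simp only [hR, offSupp, Finset.mem_insert, Finset.mem_filter, Finset.mem_erase] at hx ⊢
        rcases hx with rfl | hx
        · exact ⟨hXl, hcX⟩
        · exact ⟨hx.2, hx.1.2.2.2⟩
      split_ifs with hb
      · have := Finset.card_le_card hsubX
        rw [Finset.card_insert_of_notMem (by simp)] at this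
        unfold nz at h3
        omega
      · have hcy : c y ≠ 0 := fun h => hb ⟨y, Finset.mem_filter.mpr ⟨hy₀, h⟩, hyl⟩
        have h6 := Finset.card_le_card (Finset.insert_subset
          (Finset.mem_filter.mpr ⟨hyl, hcy⟩ : y ∈ l.filter fun x => c x ≠ 0) hsubX)
        rw [Finset.card_insert_of_notMem, Finset.card_insert_of_notMem (by simp)] at h6
        · unfold nz at h3
          omega
        · simp only [hR, offSupp, Finset.mem_insert, Finset.mem_filter, Finset.mem_erase, not_or]
          exact ⟨fun h => hXl₀ (h ▸ hy₀), fun h => h.1.2.2.1 hy₀⟩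
    have h7 := Finset.sum_le_sum hle
    rw [hsum, Finset.card_erase_of_mem hX, Finset.sum_add_distrib, Finset.sum_const, hpen,
      ← Finset.card_filter, smul_eq_mul, mul_one] at h7
    omega
  have key : ∀ Y ∈ l₀, c Y ≠ s → q ≤ (R.filter fun x => c x = s - c Y).card + 4 := by
    intro Y hY hYs
    have hYΩ := H.sub _ h₀ hY
    have hYR : Y ∉ R := by simp [hR, offSupp, hY]
    have s1 := H.sum_pencil hYΩ hRΩ hYR
    have s2 := H.sum_pencil hYΩ ((Finset.filter_subset (fun x => c x = s - c Y) R).trans hRΩ)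
      (fun h => hYR (Finset.mem_filter.mp h).1)
    have hpen := H.card_pencil (by omega) hYΩ
    have hle : ∀ l ∈ (𝓛.filter fun l => Y ∈ l).erase l₀, 2 ≤ (R.filter fun x => x ∈ l).card +
        ((R.filter fun x => c x = s - c Y).filter fun x => x ∈ l).card := by
      intro l hl
      rw [Finset.mem_erase, Finset.mem_filter] at hl
      obtain ⟨hne, hl, hYl⟩ := hl
      have hoff : ∀ x ∈ l, x ≠ Y → c x ≠ 0 → x ∈ R := by
        intro x hx hxY hcx
        refine Finset.mem_filter.mpr ⟨H.sub _ hl hx, fun hx₀ => hne ?_, hcx⟩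
        exact H.line_unique hl h₀ hxY hx hYl hx₀ hY
      have hpos : (R.filter fun x => x ∈ l).Nonempty := by
        by_contra he
        rw [Finset.not_nonempty_iff_eq_empty] at he
        apply hYs
        rw [← H.sum l hl]
        refine (Finset.sum_eq_single_of_mem Y hYl fun x hx hxY => ?_).symm
        by_contra hcx
        have : x ∈ R.filter fun x => x ∈ l := Finset.mem_filter.mpr ⟨hoff x hx hxY hcx, hx⟩
        rw [he] at this
        exact absurd this (Finset.notMem_empty x)
      have h1 := hpos.card_pos
      by_cases h2 : 2 ≤ (R.filter fun x => x ∈ l).card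
      · omega
      · have h3 : (R.filter fun x => x ∈ l).card = 1 := by omega
        obtain ⟨x, hx⟩ := Finset.card_eq_one.mp h3
        have hxm : x ∈ R.filter fun x => x ∈ l := by rw [hx]; exact Finset.mem_singleton_self x
        rw [Finset.mem_filter] at hxm
        have hxY : x ≠ Y := fun h => hYR (h ▸ hxm.1)
        have hsumx : c Y + c x = s := H.add_eq_of_two hl hxY.symm hYl hxm.2 fun z hz hzY hzx => by
          by_contra hcz
          have : z ∈ R.filter fun x => x ∈ l := Finset.mem_filter.mpr ⟨hoff z hz hzY hcz, hz⟩
          rw [hx] at this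
          exact hzx (Finset.mem_singleton.mp this)
        have : x ∈ (R.filter fun x => c x = s - c Y).filter fun x => x ∈ l := by
          simp only [Finset.mem_filter]
          exact ⟨⟨hxm.1, by rw [← hsumx]; ring⟩, hxm.2⟩
        have := Finset.card_pos.mpr ⟨x, this⟩
        omega
    have h7 := Finset.card_nsmul_le_sum _ _ _ hle
    have h8 := Finset.sum_le_sum_of_subset (f := fun l => (R.filter fun x => x ∈ l).card +
        ((R.filter fun x => c x = s - c Y).filter fun x => x ∈ l).card)
        (Finset.erase_subset l₀ (𝓛.filter fun l => Y ∈ l))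
    have h9 : ∑ l ∈ 𝓛.filter (fun l => Y ∈ l), ((R.filter fun x => x ∈ l).card +
        ((R.filter fun x => c x = s - c Y).filter fun x => x ∈ l).card) =
        R.card + (R.filter fun x => c x = s - c Y).card := by
      rw [Finset.sum_add_distrib, s1, s2]
    rw [Finset.card_erase_of_mem (Finset.mem_filter.mpr ⟨h₀, hY⟩), hpen, smul_eq_mul] at h7
    omega
  by_contra hne
  have k1 := key Z hZ hs
  have k2 := key Z' hZ' hs'
  have hdis : Disjoint (R.filter fun x => c x = s - c Z) (R.filter fun x => c x = s - c Z') := by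
    rw [Finset.disjoint_filter]
    intro x _ h1 h2
    rw [h1] at h2
    exact hne (by linear_combination -h2)
  have k3 := Finset.card_le_card (Finset.union_subset
    (Finset.filter_subset (fun x => c x = s - c Z) R)
    (Finset.filter_subset (fun x => c x = s - c Z') R))
  rw [Finset.card_union_of_disjoint hdis] at k3
  omega

end PlaneWord

end GapPlanes

section GapPlaneCases

variable {P K : Type} [Field K]
variable {Ω : Finset P} {𝓛 : Finset (Finset P)} {q : ℕ} {c : P → K} {s : K}

namespace PlaneWord

/-- If there are exactly two long lines, each is constant off the other. -/
theorem eq_of_two_long (H : PlaneWord Ω 𝓛 q c s) (hq : 37 ≤ q)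
    (hgap : ∀ l ∈ 𝓛, nz c l ≤ 3 ∨ q ≤ nz c l + 3) {l₀ l₂ : Finset P} (h₀ : l₀ ∈ 𝓛)
    (h₂ : l₂ ∈ 𝓛) (hne : l₀ ≠ l₂) (hz : (zeros c l₀).card ≤ 2) (hl₂ : q ≤ nz c l₂ + 3)
    (hlong : ∀ l ∈ 𝓛, q ≤ nz c l + 3 → l = l₀ ∨ l = l₂) {Z Z' : P}
    (hZ : Z ∈ l₀) (hZ' : Z' ∈ l₀) (hZ₂ : Z ∉ l₂) (hZ₂' : Z' ∉ l₂) : c Z = c Z' := by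
  set R := Ω.filter fun x => x ∉ l₀ ∧ x ∉ l₂ ∧ c x ≠ 0 with hR
  have hRΩ : R ⊆ Ω := Finset.filter_subset _ _
  have hRc : R.card ≤ 15 := by
    rcases R.eq_empty_or_nonempty with h | ⟨X, hX⟩
    · simp [h]
    have hX' := hX
    rw [hR, Finset.mem_filter] at hX'
    obtain ⟨hXΩ, hXl₀, hXl₂, hcX⟩ := hX'
    have hsum := H.sum_pencil hXΩ ((Finset.erase_subset X R).trans hRΩ) (Finset.notMem_erase X R)
    set B := zeros c l₀ ∪ zeros c l₂ ∪ (l₀ ∩ l₂) with hB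
    have hBc : B.card ≤ 7 := by
      have e1 := Finset.card_union_le (zeros c l₀ ∪ zeros c l₂) (l₀ ∩ l₂)
      have e2 := Finset.card_union_le (zeros c l₀) (zeros c l₂)
      have := H.card_inter_le h₀ h₂ hne
      have := H.zeros_card_le h₂ hl₂
      rw [hB]
      omega
    have hmemB : ∀ x, x ∈ B → x ∈ l₀ ∨ x ∈ l₂ := by
      intro x hx
      simp only [hB, zeros, Finset.mem_union, Finset.mem_inter, Finset.mem_filter] at hx
      tauto
    have hBΩ : B ⊆ Ω := by
      intro x hx
      rcases hmemB x hx with h | h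
      · exact H.sub _ h₀ h
      · exact H.sub _ h₂ h
    have hbad := H.card_pencil_meeting_le hXΩ hBΩ (fun h => by have := hmemB X h; tauto)
    have hle : ∀ l ∈ 𝓛.filter (fun l => X ∈ l), ((R.erase X).filter fun x => x ∈ l).card ≤
        2 * if ∃ x ∈ B, x ∈ l then 1 else 0 := by
      intro l hl
      rw [Finset.mem_filter] at hl
      obtain ⟨hl, hXl⟩ := hl
      have hne₀ : l ≠ l₀ := fun h => hXl₀ (h ▸ hXl)
      have hne₂ : l ≠ l₂ := fun h => hXl₂ (h ▸ hXl)
      have h3 : nz c l ≤ 3 := (hgap l hl).resolve_right fun h => by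
        rcases hlong l hl h with h | h
        · exact hne₀ h
        · exact hne₂ h
      obtain ⟨y, hyl, hy₀, -⟩ := H.meet l hl l₀ h₀ hne₀
      obtain ⟨y', hyl', hy₂, -⟩ := H.meet l hl l₂ h₂ hne₂
      split_ifs with hb
      · have hsubX : insert X ((R.erase X).filter fun x => x ∈ l) ⊆
            l.filter fun x => c x ≠ 0 := by
          intro x hx
          simp only [hR, Finset.mem_insert, Finset.mem_filter, Finset.mem_erase] at hx ⊢
          rcases hx with rfl | hx
          · exact ⟨hXl, hcX⟩
          · exact ⟨hx.2, hx.1.2.2.2.2⟩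
        have := Finset.card_le_card hsubX
        rw [Finset.card_insert_of_notMem (by simp)] at this
        unfold nz at h3
        omega
      · rw [mul_zero, Nat.le_zero, Finset.card_eq_zero, Finset.eq_empty_iff_forall_notMem]
        intro x hx
        have hyB : y ∉ B := fun h => hb ⟨y, h, hyl⟩
        have hyB' : y' ∉ B := fun h => hb ⟨y', h, hyl'⟩
        simp only [hB, zeros, Finset.mem_union, Finset.mem_inter, Finset.mem_filter, not_or,
          not_and] at hyB hyB'
        simp only [hR, Finset.mem_filter, Finset.mem_erase] at hx
        obtain ⟨⟨hxX, -, hx₀, hx₂, hcx⟩, hxl⟩ := hx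
        have h4 := four_le_card_of_mem (t := l.filter fun x => c x ≠ 0)
          (Finset.mem_filter.mpr ⟨hXl, hcX⟩) (Finset.mem_filter.mpr ⟨hxl, hcx⟩)
          (Finset.mem_filter.mpr ⟨hyl, hyB.1.1 hy₀⟩) (Finset.mem_filter.mpr ⟨hyl', hyB'.1.2 hy₂⟩)
          hxX.symm (fun h => hXl₀ (h ▸ hy₀)) (fun h => hXl₂ (h ▸ hy₂)) (fun h => hx₀ (h ▸ hy₀))
          (fun h => hx₂ (h ▸ hy₂)) (fun h => hyB.2 hy₀ (h ▸ hy₂))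
        unfold nz at h3
        omega
    have h7 := Finset.sum_le_sum hle
    rw [hsum, Finset.card_erase_of_mem hX, ← Finset.mul_sum, ← Finset.card_filter] at h7
    omega
  have key : ∀ Y ∈ l₀, Y ∉ l₂ → (l₂.filter fun u => u ∉ l₀ ∧ c u ≠ s - c Y).card ≤ 15 := by
    intro Y hY hY₂
    have hYΩ := H.sub _ h₀ hY
    have s1 := H.sum_pencil hYΩ hRΩ (by simp [hR, hY])
    have s2 := H.sum_pencil hYΩ
      ((Finset.filter_subset (fun u => u ∉ l₀ ∧ c u ≠ s - c Y) l₂).trans (H.sub _ h₂))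
      (by simp [hY])
    rw [← s2]
    refine le_trans ?_ hRc
    rw [← s1]
    refine Finset.sum_le_sum fun l hl => ?_
    rw [Finset.mem_filter] at hl
    obtain ⟨hl, hYl⟩ := hl
    rcases Finset.eq_empty_or_nonempty
      ((l₂.filter fun u => u ∉ l₀ ∧ c u ≠ s - c Y).filter fun x => x ∈ l) with he | ⟨u, hu⟩
    · rw [he]
      exact Nat.zero_le _
    have hne₂ : l ≠ l₂ := fun h => hY₂ (h ▸ hYl)
    have h1 : ((l₂.filter fun u => u ∉ l₀ ∧ c u ≠ s - c Y).filter fun x => x ∈ l).card ≤ 1 := by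
      refine le_trans (Finset.card_le_card fun x hx => ?_) (H.card_inter_le hl h₂ hne₂)
      simp only [Finset.mem_filter] at hx
      exact Finset.mem_inter.mpr ⟨hx.2, hx.1.1⟩
    refine h1.trans (Finset.card_pos.mpr ?_)
    simp only [Finset.mem_filter] at hu
    obtain ⟨⟨hu₂, hu₀, hcu⟩, hul⟩ := hu
    have hYu : Y ≠ u := fun h => hu₀ (h ▸ hY)
    by_contra hR0
    apply hcu
    have : c Y + c u = s := H.add_eq_of_two hl hYu hYl hul fun z hz hzY hzu => by
      by_contra hcz
      refine hR0 ⟨z, Finset.mem_filter.mpr ⟨Finset.mem_filter.mpr ⟨H.sub _ hl hz, ?_, ?_, hcz⟩, hz⟩⟩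
      · intro hz₀
        have := H.line_unique hl h₀ hzY hz hYl hz₀ hY
        exact hu₀ (this ▸ hul)
      · intro hz₂
        exact hne₂ (H.line_unique hl h₂ hzu hz hul hz₂ hu₂)
    rw [← this]; ring
  by_contra hcc
  have k1 := key Z hZ hZ₂
  have k2 := key Z' hZ' hZ₂'
  have hsub : l₂ ⊆ (l₂.filter fun u => u ∉ l₀ ∧ c u ≠ s - c Z) ∪
      (l₂.filter fun u => u ∉ l₀ ∧ c u ≠ s - c Z') ∪ (l₀ ∩ l₂) := by
    intro u hu
    simp only [Finset.mem_union, Finset.mem_filter, Finset.mem_inter]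
    by_cases hu₀ : u ∈ l₀
    · exact Or.inr ⟨hu₀, hu⟩
    · by_cases h : c u = s - c Z
      · refine Or.inl (Or.inr ⟨hu, hu₀, fun h' => hcc ?_⟩)
        rw [h] at h'
        linear_combination -h'
      · exact Or.inl (Or.inl ⟨hu, hu₀, h⟩)
  have k3 := (Finset.card_le_card hsub).trans (Finset.card_union_le _ _)
  have k4 := Finset.card_union_le (l₂.filter fun u => u ∉ l₀ ∧ c u ≠ s - c Z)
      (l₂.filter fun u => u ∉ l₀ ∧ c u ≠ s - c Z')
  have := H.card_inter_le h₀ h₂ hne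
  have := H.card l₂ h₂
  omega

/-- If there are exactly three long lines, they cover the support. -/
theorem mem_of_three_long (H : PlaneWord Ω 𝓛 q c s) (hq : 37 ≤ q)
    (hgap : ∀ l ∈ 𝓛, nz c l ≤ 3 ∨ q ≤ nz c l + 3) {l₀ l₂ l₃ : Finset P} (h₀ : l₀ ∈ 𝓛)
    (h₂ : l₂ ∈ 𝓛) (h₃ : l₃ ∈ 𝓛) (h02 : l₀ ≠ l₂) (h03 : l₀ ≠ l₃) (h23 : l₂ ≠ l₃)
    (hz : (zeros c l₀).card ≤ 2) (hl₂ : q ≤ nz c l₂ + 3) (hl₃ : q ≤ nz c l₃ + 3)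
    (hlong : ∀ l ∈ 𝓛, q ≤ nz c l + 3 → l = l₀ ∨ l = l₂ ∨ l = l₃) {X : P} (hX : X ∈ Ω)
    (hcX : c X ≠ 0) : X ∈ l₀ ∨ X ∈ l₂ ∨ X ∈ l₃ := by
  by_contra hX'
  push Not at hX'
  obtain ⟨hX₀, hX₂, hX₃⟩ := hX'
  set B : Finset P := zeros c l₀ ∪ zeros c l₂ ∪ zeros c l₃ ∪ (l₀ ∩ l₂) ∪ (l₀ ∩ l₃) ∪ (l₂ ∩ l₃)
    with hB
  have hBc : B.card ≤ 13 := by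
    have e1 := Finset.card_union_le
      (zeros c l₀ ∪ zeros c l₂ ∪ zeros c l₃ ∪ (l₀ ∩ l₂) ∪ (l₀ ∩ l₃)) (l₂ ∩ l₃)
    have e2 := Finset.card_union_le (zeros c l₀ ∪ zeros c l₂ ∪ zeros c l₃ ∪ (l₀ ∩ l₂)) (l₀ ∩ l₃)
    have e3 := Finset.card_union_le (zeros c l₀ ∪ zeros c l₂ ∪ zeros c l₃) (l₀ ∩ l₂)
    have e4 := Finset.card_union_le (zeros c l₀ ∪ zeros c l₂) (zeros c l₃)
    have e5 := Finset.card_union_le (zeros c l₀) (zeros c l₂)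
    have := H.card_inter_le h₀ h₂ h02
    have := H.card_inter_le h₀ h₃ h03
    have := H.card_inter_le h₂ h₃ h23
    have := H.zeros_card_le h₂ hl₂
    have := H.zeros_card_le h₃ hl₃
    rw [hB]
    omega
  have hmemB : ∀ x, x ∈ B → x ∈ l₀ ∨ x ∈ l₂ ∨ x ∈ l₃ := by
    intro x hx
    simp only [hB, zeros, Finset.mem_union, Finset.mem_inter, Finset.mem_filter] at hx
    tauto
  have hBΩ : B ⊆ Ω := by
    intro x hx
    rcases hmemB x hx with h | h | h
    · exact H.sub _ h₀ h
    · exact H.sub _ h₂ h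
    · exact H.sub _ h₃ h
  have hXB : X ∉ B := fun h => by
    have := hmemB X h
    tauto
  have hgood := H.le_card_pencil_avoiding (by omega) hX hBΩ hXB l₀
  obtain ⟨l, hl⟩ := Finset.card_pos.mp (show 0 < ((𝓛.filter fun l => X ∈ l).filter
      fun l => l ≠ l₀ ∧ ∀ x ∈ B, x ∉ l).card by omega)
  simp only [Finset.mem_filter] at hl
  obtain ⟨⟨hl, hXl⟩, hll₀, hlB⟩ := hl
  have hne : ∀ m, X ∉ m → l ≠ m := fun m hm h => hm (h ▸ hXl)
  obtain ⟨y₀, hy₀l, hy₀, -⟩ := H.meet l hl l₀ h₀ (hne _ hX₀)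
  obtain ⟨y₂, hy₂l, hy₂, -⟩ := H.meet l hl l₂ h₂ (hne _ hX₂)
  obtain ⟨y₃, hy₃l, hy₃, -⟩ := H.meet l hl l₃ h₃ (hne _ hX₃)
  have b₀ : y₀ ∉ B := fun h => hlB _ h hy₀l
  have b₂ : y₂ ∉ B := fun h => hlB _ h hy₂l
  have b₃ : y₃ ∉ B := fun h => hlB _ h hy₃l
  simp only [hB, zeros, Finset.mem_union, Finset.mem_inter, Finset.mem_filter, not_or, not_and]
    at b₀ b₂ b₃
  obtain ⟨⟨⟨⟨⟨z₀, -⟩, -⟩, n02⟩, n03⟩, -⟩ := b₀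
  obtain ⟨⟨⟨⟨⟨-, z₂⟩, -⟩, -⟩, -⟩, n23⟩ := b₂
  obtain ⟨⟨⟨⟨⟨-, -⟩, z₃⟩, -⟩, -⟩, -⟩ := b₃
  have hfour : 4 ≤ nz c l := by
    refine four_le_card_of_mem (Finset.mem_filter.mpr ⟨hXl, hcX⟩)
      (Finset.mem_filter.mpr ⟨hy₀l, z₀ hy₀⟩) (Finset.mem_filter.mpr ⟨hy₂l, z₂ hy₂⟩)
      (Finset.mem_filter.mpr ⟨hy₃l, z₃ hy₃⟩) ?_ ?_ ?_ ?_ ?_ ?_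
    · exact fun h => hX₀ (h ▸ hy₀)
    · exact fun h => hX₂ (h ▸ hy₂)
    · exact fun h => hX₃ (h ▸ hy₃)
    · exact fun h => n02 hy₀ (h ▸ hy₂)
    · exact fun h => n03 hy₀ (h ▸ hy₃)
    · exact fun h => n23 hy₂ (h ▸ hy₃)
  rcases hgap l hl with h | h
  · omega
  · rcases hlong l hl h with rfl | rfl | rfl
    · exact hX₀ hXl
    · exact hX₂ hXl
    · exact hX₃ hXl

/-- The possible shapes of a plane word with a gap along a line with at most two zeros. -/
theorem long_cases (H : PlaneWord Ω 𝓛 q c s) (hq : 37 ≤ q)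
    (hgap : ∀ l ∈ 𝓛, nz c l ≤ 3 ∨ q ≤ nz c l + 3) {l₀ : Finset P} (h₀ : l₀ ∈ 𝓛)
    (hz : (zeros c l₀).card ≤ 2) :
    (q - 15) * (q - 4) ≤ (offSupp Ω c l₀).card ∨
    (∀ Z ∈ l₀, ∀ Z' ∈ l₀, c Z ≠ s → c Z' ≠ s → c Z = c Z') ∨
    (∃ X, ∀ Z ∈ l₀, ∀ Z' ∈ l₀, Z ≠ X → Z' ≠ X → c Z = c Z') ∨
    ∃ l₂ ∈ 𝓛, ∃ l₃ ∈ 𝓛, l₀ ≠ l₂ ∧ l₀ ≠ l₃ ∧ l₂ ≠ l₃ ∧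
      ∀ x ∈ Ω, c x ≠ 0 → x ∈ l₀ ∨ x ∈ l₂ ∨ x ∈ l₃ := by
  by_cases h1 : ∀ l ∈ 𝓛, q ≤ nz c l + 3 → l = l₀
  · exact Or.inr (Or.inl fun Z hZ Z' hZ' => H.eq_of_unique_long hq hgap h₀ hz h1 hZ hZ')
  push Not at h1
  obtain ⟨l₂, h₂, hl₂, h20⟩ := h1
  by_cases h2 : ∀ l ∈ 𝓛, q ≤ nz c l + 3 → l = l₀ ∨ l = l₂
  · obtain ⟨X, -, -, hX⟩ := H.meet _ h₀ _ h₂ h20.symm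
    refine Or.inr (Or.inr (Or.inl ⟨X, fun Z hZ Z' hZ' hZX hZX' => ?_⟩))
    exact H.eq_of_two_long hq hgap h₀ h₂ h20.symm hz hl₂ h2 hZ hZ' (fun h => hZX (hX _ hZ h))
      (fun h => hZX' (hX _ hZ' h))
  push Not at h2
  obtain ⟨l₃, h₃, hl₃, h30, h32⟩ := h2
  by_cases h3 : ∀ l ∈ 𝓛, q ≤ nz c l + 3 → l = l₀ ∨ l = l₂ ∨ l = l₃
  · exact Or.inr (Or.inr (Or.inr ⟨l₂, h₂, l₃, h₃, h20.symm, h30.symm, h32.symm, fun x hx hcx =>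
      H.mem_of_three_long hq hgap h₀ h₂ h₃ h20.symm h30.symm h32.symm hz hl₂ hl₃ h3 hx hcx⟩))
  push Not at h3
  obtain ⟨l₄, h₄, hl₄, h40, h42, h43⟩ := h3
  exact Or.inl (H.dense_of_three_long hq hgap h₀ h₂ h₃ h₄ hz hl₂ hl₃ hl₄ h20.symm h30.symm
    h40.symm h32.symm h42.symm h43.symm)

end PlaneWord

end GapPlaneCases

section CoveredPlanes

variable {P K : Type} [Field K]
variable {Ω : Finset P} {𝓛 : Finset (Finset P)} {q : ℕ} {c : P → K} {s : K}

namespace PlaneWord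

theorem add_eq_of_cover_two (H : PlaneWord Ω 𝓛 q c s) {l₀ l₂ l₃ : Finset P}
    (h₀ : l₀ ∈ 𝓛) (h₂ : l₂ ∈ 𝓛) (h₃ : l₃ ∈ 𝓛)
    (hcov : ∀ x ∈ Ω, c x ≠ 0 → x ∈ l₀ ∨ x ∈ l₂ ∨ x ∈ l₃) {v u : P} (hv₀ : v ∈ l₀) (hv₃ : v ∈ l₃)
    (hv₂ : v ∉ l₂) (hu₂ : u ∈ l₂) (hu₀ : u ∉ l₀) (hu₃ : u ∉ l₃) : c v + c u = s := by
  have hvu : v ≠ u := fun h => hv₂ (h ▸ hu₂)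
  obtain ⟨l, hl, hvl, hul⟩ := H.join v (H.sub _ h₀ hv₀) u (H.sub _ h₂ hu₂) hvu
  refine H.add_eq_of_two hl hvu hvl hul fun z hz hzv hzu => ?_
  by_contra hcz
  rcases hcov z (H.sub _ hl hz) hcz with h | h | h
  · exact hu₀ (H.line_unique hl h₀ hzv hz hvl h hv₀ ▸ hul)
  · exact hv₂ (H.line_unique hl h₂ hzu hz hul h hu₂ ▸ hvl)
  · exact hu₃ (H.line_unique hl h₃ hzv hz hvl h hv₃ ▸ hul)

theorem add_eq_of_cover_three (H : PlaneWord Ω 𝓛 q c s) {l₀ l₂ l₃ l : Finset P}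
    (h₀ : l₀ ∈ 𝓛) (h₂ : l₂ ∈ 𝓛) (h₃ : l₃ ∈ 𝓛) (hl : l ∈ 𝓛)
    (hcov : ∀ x ∈ Ω, c x ≠ 0 → x ∈ l₀ ∨ x ∈ l₂ ∨ x ∈ l₃) {z u w : P} (hz₀ : z ∈ l₀) (hz₂ : z ∉ l₂)
    (hu₂ : u ∈ l₂) (hu₃ : u ∉ l₃) (hw₃ : w ∈ l₃) (hw₀ : w ∉ l₀) (hz : z ∈ l) (hu : u ∈ l)
    (hw : w ∈ l) : c z + c u + c w = s := by
  refine H.add_eq_of_three hl (fun h => hz₂ (h ▸ hu₂)) (fun h => hw₀ (h ▸ hz₀))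
    (fun h => hu₃ (h ▸ hw₃)) hz hu hw fun y hy hyz hyu hyw => ?_
  by_contra hcy
  rcases hcov y (H.sub _ hl hy) hcy with h | h | h
  · exact hw₀ (H.line_unique hl h₀ hyz hy hz h hz₀ ▸ hw)
  · exact hz₂ (H.line_unique hl h₂ hyu hy hu h hu₂ ▸ hz)
  · exact hu₃ (H.line_unique hl h₃ hyw hy hw h hw₃ ▸ hu)

/-- A word supported on three nonconcurrent lines. -/
theorem cover_nonconcurrent (H : PlaneWord Ω 𝓛 q c s) {l₀ l₂ l₃ : Finset P}
    (h₀ : l₀ ∈ 𝓛) (h₂ : l₂ ∈ 𝓛) (h₃ : l₃ ∈ 𝓛) (h02 : l₀ ≠ l₂) (h03 : l₀ ≠ l₃) (h23 : l₂ ≠ l₃)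
    (hcov : ∀ x ∈ Ω, c x ≠ 0 → x ∈ l₀ ∨ x ∈ l₂ ∨ x ∈ l₃)
    (hnc : ¬ ∃ x, x ∈ l₀ ∧ x ∈ l₂ ∧ x ∈ l₃) :
    ∃ X₂ ∈ l₀, ∃ X₃ ∈ l₀, ∃ t, (∀ z ∈ l₀, z ≠ X₂ → z ≠ X₃ → c z = t) ∧
      2 * (q - 1) ≤ (Ω.filter fun x => x ∉ l₀ ∧ (c x = s - c X₂ ∨ c x = s - c X₃)).card := by
  obtain ⟨X₂, h20, h22, hX₂⟩ := H.meet _ h₀ _ h₂ h02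
  obtain ⟨X₃, h30, h33, hX₃⟩ := H.meet _ h₀ _ h₃ h03
  obtain ⟨Y, hY2, hY3, hY⟩ := H.meet _ h₂ _ h₃ h23
  have h23' : X₂ ∉ l₃ := fun h => hnc ⟨X₂, h20, h22, h⟩
  have h32' : X₃ ∉ l₂ := fun h => hnc ⟨X₃, h30, h, h33⟩
  have hY0 : Y ∉ l₀ := fun h => hnc ⟨Y, h, hY2, hY3⟩
  refine ⟨X₂, h20, X₃, h30, s - c Y, fun z hz hz2 hz3 => ?_, ?_⟩
  · rw [← H.add_eq_of_cover_two h₂ h₀ h₃ (fun x hx hcx => by have := hcov x hx hcx; tauto)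
      hY2 hY3 hY0 hz (fun h => hz2 (hX₂ _ hz h)) (fun h => hz3 (hX₃ _ hz h))]
    ring
  · have e2 : ∀ u ∈ (l₂.erase X₂).erase Y, u ∉ l₀ ∧ u ∉ l₃ ∧ c u = s - c X₃ := by
      intro u hu
      simp only [Finset.mem_erase] at hu
      have hu0 : u ∉ l₀ := fun h => hu.2.1 (hX₂ _ h hu.2.2)
      have hu3 : u ∉ l₃ := fun h => hu.1 (hY _ hu.2.2 h)
      refine ⟨hu0, hu3, ?_⟩
      rw [← H.add_eq_of_cover_two h₀ h₂ h₃ hcov h30 h33 h32' hu.2.2 hu0 hu3]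
      ring
    have e3 : ∀ u ∈ (l₃.erase X₃).erase Y, u ∉ l₀ ∧ u ∉ l₂ ∧ c u = s - c X₂ := by
      intro u hu
      simp only [Finset.mem_erase] at hu
      have hu0 : u ∉ l₀ := fun h => hu.2.1 (hX₃ _ h hu.2.2)
      have hu2 : u ∉ l₂ := fun h => hu.1 (hY _ h hu.2.2)
      refine ⟨hu0, hu2, ?_⟩
      rw [← H.add_eq_of_cover_two h₀ h₃ h₂ (fun x hx hcx => by have := hcov x hx hcx; tauto)
        h20 h22 h23' hu.2.2 hu0 hu2]
      ring
    have hdis : Disjoint ((l₂.erase X₂).erase Y) ((l₃.erase X₃).erase Y) := by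
      rw [Finset.disjoint_left]
      intro u hu hu'
      simp only [Finset.mem_erase] at hu'
      exact (e2 u hu).2.1 hu'.2.2
    have hsub : ((l₂.erase X₂).erase Y) ∪ ((l₃.erase X₃).erase Y) ⊆
        Ω.filter fun x => x ∉ l₀ ∧ (c x = s - c X₂ ∨ c x = s - c X₃) := by
      refine Finset.union_subset (fun u hu => ?_) fun u hu => ?_
      · have := e2 u hu
        simp only [Finset.mem_erase] at hu
        exact Finset.mem_filter.mpr ⟨H.sub _ h₂ hu.2.2, this.1, Or.inr this.2.2⟩
      · have := e3 u hu
        simp only [Finset.mem_erase] at hu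
        exact Finset.mem_filter.mpr ⟨H.sub _ h₃ hu.2.2, this.1, Or.inl this.2.2⟩
    have := Finset.card_le_card hsub
    rw [Finset.card_union_of_disjoint hdis, Finset.card_erase_of_mem, Finset.card_erase_of_mem h22,
      Finset.card_erase_of_mem, Finset.card_erase_of_mem h33, H.card _ h₂, H.card _ h₃] at this
    · omega
    · exact Finset.mem_erase.mpr ⟨fun h => hY0 (h ▸ h30), hY3⟩
    · exact Finset.mem_erase.mpr ⟨fun h => hY0 (h ▸ h20), hY2⟩

/-- In a word supported on three concurrent lines, value differences transfer between lines. -/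
theorem cover_concurrent_pair (H : PlaneWord Ω 𝓛 q c s) (hq : 5 ≤ q) {l₀ l₂ l₃ : Finset P}
    (h₀ : l₀ ∈ 𝓛) (h₂ : l₂ ∈ 𝓛) (h₃ : l₃ ∈ 𝓛) (h02 : l₀ ≠ l₂) (h03 : l₀ ≠ l₃) (h23 : l₂ ≠ l₃)
    (hcov : ∀ x ∈ Ω, c x ≠ 0 → x ∈ l₀ ∨ x ∈ l₂ ∨ x ∈ l₃) {X : P} (hX₀ : X ∈ l₀) (hX₂ : X ∈ l₂)
    (hX₃ : X ∈ l₃) {u u' : P} (hu : u ∈ l₂) (hu' : u' ∈ l₂) (huX : u ≠ X) (huX' : u' ≠ X)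
    (huu : u ≠ u') {T : Finset P} (hT : T ⊆ l₀) (hT2 : T.card ≤ 2) :
    ∃ z ∈ l₀, ∃ z' ∈ l₀, z ≠ z' ∧ z ≠ X ∧ z' ≠ X ∧ z ∉ T ∧ z' ∉ T ∧ c z + c u = c z' + c u' := by
  have only : ∀ {l m : Finset P}, l ∈ 𝓛 → m ∈ 𝓛 → l ≠ m → X ∈ l → X ∈ m → ∀ {y}, y ∈ l → y ≠ X →
      y ∉ m := fun hl hm hlm hXl hXm y hy hyX hym =>
    hlm (H.line_unique hl hm hyX hy hXl hym hXm)
  set bad : Finset P := (({u, u'} : Finset P) ×ˢ T).biUnion fun vt =>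
    l₃.filter fun w => w ≠ X ∧ ∃ l ∈ 𝓛, vt.1 ∈ l ∧ vt.2 ∈ l ∧ w ∈ l with hbad
  have hbadc : bad.card ≤ 4 := by
    have h1 : bad.card ≤ (({u, u'} : Finset P) ×ˢ T).card * 1 := by
      refine Finset.card_biUnion_le_card_mul _ _ _ fun vt hvt => ?_
      rw [Finset.mem_product, Finset.mem_insert, Finset.mem_singleton] at hvt
      have hv : vt.1 ∈ l₂ ∧ vt.1 ≠ X := by
        rcases hvt.1 with h | h <;> rw [h] <;> exact ⟨‹_›, ‹_›⟩
      have hvt' : vt.1 ≠ vt.2 := fun h =>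
        only h₂ h₀ h02.symm hX₂ hX₀ hv.1 hv.2 (h ▸ hT hvt.2)
      rw [Finset.card_le_one]
      intro w hw w' hw'
      simp only [Finset.mem_filter] at hw hw'
      obtain ⟨hw₃, -, l, hl, hvl, htl, hwl⟩ := hw
      obtain ⟨hw₃', -, l', hl', hvl', htl', hwl'⟩ := hw'
      obtain rfl := H.line_unique hl hl' hvt' hvl htl hvl' htl'
      by_contra hww
      obtain rfl := H.line_unique hl h₃ hww hwl hwl' hw₃ hw₃'
      exact only h₂ h₃ h23 hX₂ hX₃ hv.1 hv.2 hvl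
    rw [Finset.card_product] at h1
    have h2 : ({u, u'} : Finset P).card ≤ 2 := Finset.card_le_two
    nlinarith
  obtain ⟨w, hw, hwbad⟩ : ∃ w ∈ l₃.erase X, w ∉ bad := by
    apply Finset.exists_mem_notMem_of_card_lt_card
    rw [Finset.card_erase_of_mem hX₃, H.card _ h₃]
    omega
  rw [Finset.mem_erase] at hw
  have hw₀ := only h₃ h₀ h03.symm hX₃ hX₀ hw.2 hw.1
  have hw₂ := only h₃ h₂ h23.symm hX₃ hX₂ hw.2 hw.1
  have key : ∀ v ∈ l₂, v ≠ X → (v = u ∨ v = u') → ∃ l ∈ 𝓛, v ∈ l ∧ w ∈ l ∧ l ≠ l₂ ∧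
      ∃ z ∈ l₀, z ∈ l ∧ z ≠ X ∧ z ∉ T ∧ c z + c v + c w = s := by
    intro v hv hvX hvu
    have hv₀ := only h₂ h₀ h02.symm hX₂ hX₀ hv hvX
    have hv₃ := only h₂ h₃ h23 hX₂ hX₃ hv hvX
    have hvw : v ≠ w := fun h => hw₂ (h ▸ hv)
    obtain ⟨l, hl, hvl, hwl⟩ := H.join v (H.sub _ h₂ hv) w (H.sub _ h₃ hw.2) hvw
    have hll₂ : l ≠ l₂ := fun h => hw₂ (h ▸ hwl)
    obtain ⟨z, hzl, hz₀, -⟩ := H.meet _ hl _ h₀ (fun h => hv₀ (h ▸ hvl))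
    have hzX : z ≠ X := fun h => hll₂ (H.line_unique hl h₂ hvX hvl (h ▸ hzl) hv hX₂)
    refine ⟨l, hl, hvl, hwl, hll₂, z, hz₀, hzl, hzX, fun hzT => hwbad ?_, ?_⟩
    · rw [hbad, Finset.mem_biUnion]
      refine ⟨(v, z), Finset.mem_product.mpr ⟨?_, hzT⟩, Finset.mem_filter.mpr
        ⟨hw.2, hw.1, l, hl, hvl, hzl, hwl⟩⟩
      simpa using hvu
    · exact H.add_eq_of_cover_three h₀ h₂ h₃ hl hcov hz₀ (only h₀ h₂ h02 hX₀ hX₂ hz₀ hzX) hv hv₃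
        hw.2 hw₀ hzl hvl hwl
  obtain ⟨l, hl, hul, hwl, hl2, z, hz, hzl, hzX, hzT, hzs⟩ := key u hu huX (Or.inl rfl)
  obtain ⟨l', hl', hul', hwl', -, z', hz', hzl', hzX', hzT', hzs'⟩ := key u' hu' huX' (Or.inr rfl)
  refine ⟨z, hz, z', hz', fun h => ?_, hzX, hzX', hzT, hzT', ?_⟩
  · have h1 : l = l' := H.line_unique hl hl' (fun h' : z = w => hw₀ (h' ▸ hz)) hzl hwl (h ▸ hzl') hwl'
    exact hl2 (H.line_unique hl h₂ huu hul (h1 ▸ hul') hu hu')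
  · linear_combination hzs - hzs'

/-- A word supported on three concurrent lines that is constant on one of them off the vertex is
constant on the others. -/
theorem cover_concurrent_const (H : PlaneWord Ω 𝓛 q c s) (hq : 5 ≤ q) {l₀ l₂ l₃ : Finset P}
    (h₀ : l₀ ∈ 𝓛) (h₂ : l₂ ∈ 𝓛) (h₃ : l₃ ∈ 𝓛) (h02 : l₀ ≠ l₂) (h03 : l₀ ≠ l₃) (h23 : l₂ ≠ l₃)
    (hcov : ∀ x ∈ Ω, c x ≠ 0 → x ∈ l₀ ∨ x ∈ l₂ ∨ x ∈ l₃) {X : P} (hX₀ : X ∈ l₀) (hX₂ : X ∈ l₂)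
    (hX₃ : X ∈ l₃)
    (hc₃ : ∀ u ∈ l₃, ∀ u' ∈ l₃, u ≠ X → u' ≠ X → c u = c u') :
    ∀ z ∈ l₀, ∀ z' ∈ l₀, z ≠ X → z' ≠ X → c z = c z' := by
  have only : ∀ {l m : Finset P}, l ∈ 𝓛 → m ∈ 𝓛 → l ≠ m → X ∈ l → X ∈ m → ∀ {y}, y ∈ l → y ≠ X →
      y ∉ m := fun hl hm hlm hXl hXm y hy hyX hym =>
    hlm (H.line_unique hl hm hyX hy hXl hym hXm)
  obtain ⟨u, hu⟩ : (l₂.erase X).Nonempty := Finset.card_pos.mp (by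
    rw [Finset.card_erase_of_mem hX₂, H.card _ h₂]; omega)
  rw [Finset.mem_erase] at hu
  have hu₀ := only h₂ h₀ h02.symm hX₂ hX₀ hu.2 hu.1
  have hu₃ := only h₂ h₃ h23 hX₂ hX₃ hu.2 hu.1
  have key : ∀ z ∈ l₀, z ≠ X → ∃ w ∈ l₃, w ≠ X ∧ c z + c u + c w = s := by
    intro z hz hzX
    have hz₂ := only h₀ h₂ h02 hX₀ hX₂ hz hzX
    have hzu : z ≠ u := fun h => hu₀ (h ▸ hz)
    obtain ⟨l, hl, hzl, hul⟩ := H.join z (H.sub _ h₀ hz) u (H.sub _ h₂ hu.2) hzu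
    obtain ⟨w, hwl, hw, -⟩ := H.meet _ hl _ h₃ (fun h => hu₃ (h ▸ hul))
    have hwX : w ≠ X := fun h => hz₂ (H.line_unique hl h₂ hu.1 hul (h ▸ hwl) hu.2 hX₂ ▸ hzl)
    exact ⟨w, hw, hwX, H.add_eq_of_cover_three h₀ h₂ h₃ hl hcov hz hz₂ hu.2 hu₃ hw
      (only h₃ h₀ h03.symm hX₃ hX₀ hw hwX) hzl hul hwl⟩
  intro z hz z' hz' hzX hzX'
  obtain ⟨w, hw, hwX, h1⟩ := key z hz hzX
  obtain ⟨w', hw', hwX', h2⟩ := key z' hz' hzX'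
  have := hc₃ w hw w' hw' hwX hwX'
  linear_combination h1 - h2 - this

/-- The side of a triangle word: other planes through it are dense or look like the triangle. -/
theorem triangle_side (H : PlaneWord Ω 𝓛 q c s) (hq : 37 ≤ q)
    (hgap : ∀ l ∈ 𝓛, nz c l ≤ 3 ∨ q ≤ nz c l + 3) {l₀ : Finset P} (h₀ : l₀ ∈ 𝓛)
    {V₂ V₃ : P} (hV : V₂ ≠ V₃) (hV₂ : V₂ ∈ l₀) (hV₃ : V₃ ∈ l₀) {a₁ a₂ a₃ : K} (h2 : (2 : K) ≠ 0)
    (ha₁ : a₁ ≠ 0) (ha₂ : a₂ ≠ 0) (ha₃ : a₃ ≠ 0) (hs : s = a₁ + a₂ + a₃)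
    (hgen : ∀ z ∈ l₀, z ≠ V₂ → z ≠ V₃ → c z = a₁) (hcV₂ : c V₂ = a₁ + a₂)
    (hcV₃ : c V₃ = a₁ + a₃) :
    (q - 15) * (q - 4) ≤ (offSupp Ω c l₀).card ∨
    2 * (q - 1) ≤ (Ω.filter fun x => x ∉ l₀ ∧ (c x = a₂ ∨ c x = a₃)).card := by
  have hz : (zeros c l₀).card ≤ 2 := by
    refine (Finset.card_le_card (t := {V₂, V₃}) fun x hx => ?_).trans Finset.card_le_two
    rw [zeros, Finset.mem_filter] at hx
    by_contra h
    simp only [Finset.mem_insert, Finset.mem_singleton, not_or] at h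
    exact ha₁ ((hgen x hx.1 h.1 h.2).symm.trans hx.2)
  have hgenex : ∀ A : Finset P, A.card ≤ 4 → ∃ Z ∈ l₀, Z ∉ A := fun A hA =>
    Finset.exists_mem_notMem_of_card_lt_card (by rw [H.card _ h₀]; omega)
  have hnconst : ∀ X, ¬ ∀ Z ∈ l₀, ∀ Z' ∈ l₀, Z ≠ X → Z' ≠ X → c Z = c Z' := by
    intro X hX
    obtain ⟨Z, hZ, hZ'⟩ := hgenex {V₂, V₃, X} (Finset.card_le_three.trans (by norm_num))
    simp only [Finset.mem_insert, Finset.mem_singleton, not_or] at hZ'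
    have hcZ := hgen Z hZ hZ'.1 hZ'.2.1
    by_cases hX2 : V₂ = X
    · have := hX V₃ hV₃ Z hZ (fun h => hV (hX2.trans h.symm)) hZ'.2.2
      exact ha₃ (by linear_combination this - hcV₃ + hcZ)
    · have := hX V₂ hV₂ Z hZ hX2 hZ'.2.2
      exact ha₂ (by linear_combination this - hcV₂ + hcZ)
  rcases H.long_cases hq hgap h₀ hz with
    h | hX | ⟨X, hX⟩ | ⟨l₂, h₂, l₃, h₃, h02, h03, h23, hcov⟩
  · exact Or.inl h
  · exfalso
    obtain ⟨Z, hZ, hZ'⟩ := hgenex {V₂, V₃} (Finset.card_le_two.trans (by norm_num))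
    simp only [Finset.mem_insert, Finset.mem_singleton, not_or] at hZ'
    have hcZ := hgen Z hZ hZ'.1 hZ'.2
    have sV₂ : c V₂ ≠ s := fun h => ha₃ (by linear_combination -h + hcV₂ - hs)
    have sV₃ : c V₃ ≠ s := fun h => ha₂ (by linear_combination -h + hcV₃ - hs)
    have e := hX V₂ hV₂ V₃ hV₃ sV₂ sV₃
    by_cases sZ : c Z = s
    · apply mul_ne_zero h2 ha₂
      linear_combination e - hcV₂ + hcV₃ - sZ + hcZ - hs
    · have := hX V₂ hV₂ Z hZ sV₂ sZ
      exact ha₂ (by linear_combination this - hcV₂ + hcZ)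
  · exact absurd hX (hnconst X)
  · right
    by_cases hcc : ∃ x, x ∈ l₀ ∧ x ∈ l₂ ∧ x ∈ l₃
    · exfalso
      obtain ⟨X, hX₀, hX₂, hX₃⟩ := hcc
      have hconst : ∀ l m, l ∈ 𝓛 → m ∈ 𝓛 → l₀ ≠ l → l₀ ≠ m → l ≠ m → X ∈ l → X ∈ m →
          (∀ x ∈ Ω, c x ≠ 0 → x ∈ l₀ ∨ x ∈ l ∨ x ∈ m) →
          ∀ u ∈ l, ∀ u' ∈ l, u ≠ X → u' ≠ X → c u = c u' := by
        intro l m hl hm h0l h0m hlm hXl hXm hcov u hu u' hu' huX huX'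
        by_cases huu : u = u'
        · rw [huu]
        obtain ⟨z, hz, z', hz', -, -, -, hzT, hzT', e⟩ := H.cover_concurrent_pair (by omega) h₀ hl
          hm h0l h0m hlm hcov hX₀ hXl hXm hu hu' huX huX' huu (T := {V₂, V₃})
          (by simp [Finset.insert_subset_iff, hV₂, hV₃]) Finset.card_le_two
        simp only [Finset.mem_insert, Finset.mem_singleton, not_or] at hzT hzT'
        rw [hgen z hz hzT.1 hzT.2, hgen z' hz' hzT'.1 hzT'.2] at e
        exact add_left_cancel e
      have hc₀ := H.cover_concurrent_const (by omega) h₀ h₂ h₃ h02 h03 h23 hcov hX₀ hX₂ hX₃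
        (hconst l₃ l₂ h₃ h₂ h03 h02 h23.symm hX₃ hX₂
          (fun x hx hcx => by have := hcov x hx hcx; tauto))
      exact hnconst X hc₀
    · obtain ⟨X₂, hX₂, X₃, hX₃, t, ht, hcard⟩ :=
        H.cover_nonconcurrent h₀ h₂ h₃ h02 h03 h23 hcov hcc
      obtain ⟨Z, hZ, hZ'⟩ := hgenex {V₂, V₃, X₂, X₃} Finset.card_le_four
      simp only [Finset.mem_insert, Finset.mem_singleton, not_or] at hZ'
      have hcZ := hgen Z hZ hZ'.1 hZ'.2.1
      have htZ := ht Z hZ hZ'.2.2.1 hZ'.2.2.2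
      have m2 : V₂ = X₂ ∨ V₂ = X₃ := by
        by_contra h
        rw [not_or] at h
        exact ha₂ (by linear_combination ht V₂ hV₂ h.1 h.2 - htZ - hcV₂ + hcZ)
      have m3 : V₃ = X₂ ∨ V₃ = X₃ := by
        by_contra h
        rw [not_or] at h
        exact ha₃ (by linear_combination ht V₃ hV₃ h.1 h.2 - htZ - hcV₃ + hcZ)
      have e2 : s - c V₂ = a₃ := by rw [hcV₂, hs]; ring
      have e3 : s - c V₃ = a₂ := by rw [hcV₃, hs]; ring
      refine hcard.trans (Finset.card_le_card fun x hx => ?_)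
      rw [Finset.mem_filter] at hx ⊢
      refine ⟨hx.1, hx.2.1, ?_⟩
      rcases m2 with rfl | rfl
      · rcases m3 with rfl | rfl
        · exact absurd rfl hV
        · rw [e2, e3] at hx
          exact hx.2.2.symm
      · rcases m3 with rfl | rfl
        · rw [e2, e3] at hx
          exact hx.2.2
        · exact absurd rfl hV

/-- A line of an odd word: other planes through it are dense or carry many different values. -/
theorem injective_side (H : PlaneWord Ω 𝓛 q c s) (hq : 37 ≤ q)
    (hgap : ∀ l ∈ 𝓛, nz c l ≤ 3 ∨ q ≤ nz c l + 3) {l₀ : Finset P} (h₀ : l₀ ∈ 𝓛)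
    {O : P} (hO : O ∈ l₀) (hinj : ∀ z ∈ l₀, ∀ z' ∈ l₀, z ≠ O → z' ≠ O → c z = c z' → z = z')
    (a₂ a₃ : K) :
    (q - 15) * (q - 4) ≤ (offSupp Ω c l₀).card ∨
    2 * q - 12 ≤ (Ω.filter fun x => x ∉ l₀ ∧ c x ≠ 0 ∧ c x ≠ a₂ ∧ c x ≠ a₃).card := by
  have hz : (zeros c l₀).card ≤ 2 := by
    have h1 : ((zeros c l₀).erase O).card ≤ 1 := by
      rw [Finset.card_le_one]
      intro x hx y hy
      simp only [zeros, Finset.mem_erase, Finset.mem_filter] at hx hy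
      exact hinj x hx.2.1 y hy.2.1 hx.1 hy.1 (hx.2.2.trans hy.2.2.symm)
    have := Finset.pred_card_le_card_erase (s := zeros c l₀) (a := O)
    omega
  have hgenex : ∀ A : Finset P, A.card ≤ 4 → ∃ Z ∈ l₀, Z ∉ A := fun A hA =>
    Finset.exists_mem_notMem_of_card_lt_card (by rw [H.card _ h₀]; omega)
  have hnconst : ∀ X Y, ¬ ∀ Z ∈ l₀, ∀ Z' ∈ l₀, Z ≠ X → Z' ≠ X → Z ≠ Y → Z' ≠ Y → c Z = c Z' := by
    intro X Y hX
    obtain ⟨Z, hZ, hZ'⟩ := hgenex {O, X, Y} (Finset.card_le_three.trans (by norm_num))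
    obtain ⟨W, hW, hW'⟩ := hgenex {O, X, Y, Z} Finset.card_le_four
    simp only [Finset.mem_insert, Finset.mem_singleton, not_or] at hZ' hW'
    exact hW'.2.2.2 (hinj W hW Z hZ hW'.1 hZ'.1
      (hX W hW Z hZ hW'.2.1 hZ'.2.1 hW'.2.2.1 hZ'.2.2))
  rcases H.long_cases hq hgap h₀ hz with
    h | hX | ⟨X, hX⟩ | ⟨l₂, h₂, l₃, h₃, h02, h03, h23, hcov⟩
  · exact Or.inl h
  · exfalso
    have hs : ∀ A : Finset P, A.card ≤ 2 → ∃ Z ∈ l₀, Z ≠ O ∧ Z ∉ A ∧ c Z ≠ s := by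
      intro A hA
      obtain ⟨Z, hZ, hZ'⟩ := hgenex (insert O A) ((Finset.card_insert_le _ _).trans (by omega))
      have hc := Finset.card_insert_le Z (insert O A)
      have hc' := Finset.card_insert_le O A
      obtain ⟨W, hW, hW'⟩ := hgenex (insert Z (insert O A)) (by omega)
      simp only [Finset.mem_insert, not_or] at hZ' hW'
      by_cases h : c Z = s
      · refine ⟨W, hW, hW'.2.1, hW'.2.2, fun h' => hW'.1 ?_⟩
        exact hinj W hW Z hZ hW'.2.1 hZ'.1 (h'.trans h.symm)
      · exact ⟨Z, hZ, hZ'.1, hZ'.2, h⟩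
    obtain ⟨Z, hZ, hZO, -, hcZ⟩ := hs ∅ (by simp)
    obtain ⟨W, hW, hWO, hWZ, hcW⟩ := hs {Z} (by simp)
    exact hWZ (Finset.mem_singleton.mpr (hinj W hW Z hZ hWO hZO (hX W hW Z hZ hcW hcZ)))
  · exact absurd (fun Z hZ Z' hZ' h h' _ _ => hX Z hZ Z' hZ' h h') (hnconst X X)
  · by_cases hcc : ∃ x, x ∈ l₀ ∧ x ∈ l₂ ∧ x ∈ l₃
    · right
      obtain ⟨X, hX₀, hX₂, hX₃⟩ := hcc
      have hcount : ∀ l m, l ∈ 𝓛 → m ∈ 𝓛 → l₀ ≠ l → l₀ ≠ m → l ≠ m → X ∈ l → X ∈ m →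
          (∀ x ∈ Ω, c x ≠ 0 → x ∈ l₀ ∨ x ∈ l ∨ x ∈ m) →
          q ≤ ((l.erase X).filter fun x => c x ≠ 0 ∧ c x ≠ a₂ ∧ c x ≠ a₃).card + 3 := by
        intro l m hl hm h0l h0m hlm hXl hXm hcov
        have hinj' : ∀ u ∈ l, ∀ u' ∈ l, u ≠ X → u' ≠ X → c u = c u' → u = u' := by
          intro u hu u' hu' huX huX' e
          by_contra huu
          obtain ⟨z, hz, z', hz', hzz, -, -, hzT, hzT', e'⟩ := H.cover_concurrent_pair (by omega)
            h₀ hl hm h0l h0m hlm hcov hX₀ hXl hXm hu hu' huX huX' huu (T := {O}) (by simpa using hO)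
            (by simp)
          rw [Finset.mem_singleton] at hzT hzT'
          exact hzz (hinj z hz z' hz' hzT hzT' (by linear_combination e' - e))
        have hone : ∀ a, ((l.erase X).filter fun x => c x = a).card ≤ 1 := by
          intro a
          rw [Finset.card_le_one]
          intro x hx y hy
          simp only [Finset.mem_filter, Finset.mem_erase] at hx hy
          exact hinj' x hx.1.2 y hy.1.2 hx.1.1 hy.1.1 (hx.2.trans hy.2.symm)
        have hsub : l.erase X ⊆ ((l.erase X).filter fun x => c x ≠ 0 ∧ c x ≠ a₂ ∧ c x ≠ a₃) ∪
            (((l.erase X).filter fun x => c x = 0) ∪ (((l.erase X).filter fun x => c x = a₂) ∪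
              ((l.erase X).filter fun x => c x = a₃))) := by
          intro x hx
          simp only [Finset.mem_union, Finset.mem_filter]
          tauto
        have k1 := (Finset.card_le_card hsub).trans (Finset.card_union_le _ _)
        have k2 := Finset.card_union_le ((l.erase X).filter fun x => c x = 0)
          (((l.erase X).filter fun x => c x = a₂) ∪ ((l.erase X).filter fun x => c x = a₃))
        have k3 := Finset.card_union_le ((l.erase X).filter fun x => c x = a₂)
          ((l.erase X).filter fun x => c x = a₃)
        rw [Finset.card_erase_of_mem hXl, H.card _ hl] at k1
        have := hone 0
        have := hone a₂
        have := hone a₃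
        omega
      have c2 := hcount l₂ l₃ h₂ h₃ h02 h03 h23 hX₂ hX₃ hcov
      have c3 := hcount l₃ l₂ h₃ h₂ h03 h02 h23.symm hX₃ hX₂
        (fun x hx hcx => by have := hcov x hx hcx; tauto)
      have only : ∀ {l m : Finset P}, l ∈ 𝓛 → m ∈ 𝓛 → l ≠ m → X ∈ l → X ∈ m →
          ∀ {y}, y ∈ l → y ≠ X → y ∉ m := fun hl hm hlm hXl hXm y hy hyX hym =>
        hlm (H.line_unique hl hm hyX hy hXl hym hXm)
      have hdis : Disjoint ((l₂.erase X).filter fun x => c x ≠ 0 ∧ c x ≠ a₂ ∧ c x ≠ a₃)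
          ((l₃.erase X).filter fun x => c x ≠ 0 ∧ c x ≠ a₂ ∧ c x ≠ a₃) := by
        rw [Finset.disjoint_left]
        intro x hx hx'
        simp only [Finset.mem_filter, Finset.mem_erase] at hx hx'
        exact only h₂ h₃ h23 hX₂ hX₃ hx.1.2 hx.1.1 hx'.1.2
      have hsub : ((l₂.erase X).filter fun x => c x ≠ 0 ∧ c x ≠ a₂ ∧ c x ≠ a₃) ∪
          ((l₃.erase X).filter fun x => c x ≠ 0 ∧ c x ≠ a₂ ∧ c x ≠ a₃) ⊆
          Ω.filter fun x => x ∉ l₀ ∧ c x ≠ 0 ∧ c x ≠ a₂ ∧ c x ≠ a₃ := by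
        refine Finset.union_subset (fun x hx => ?_) fun x hx => ?_ <;>
          simp only [Finset.mem_filter, Finset.mem_erase] at hx ⊢
        · exact ⟨H.sub _ h₂ hx.1.2, only h₂ h₀ h02.symm hX₂ hX₀ hx.1.2 hx.1.1, hx.2⟩
        · exact ⟨H.sub _ h₃ hx.1.2, only h₃ h₀ h03.symm hX₃ hX₀ hx.1.2 hx.1.1, hx.2⟩
      have := Finset.card_le_card hsub
      rw [Finset.card_union_of_disjoint hdis] at this
      omega
    · obtain ⟨X₂, hX₂, X₃, hX₃, t, ht, -⟩ :=
        H.cover_nonconcurrent h₀ h₂ h₃ h02 h03 h23 hcov hcc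
      exact absurd (fun Z hZ Z' hZ' h2 h2' h3 h3' =>
        (ht Z hZ h2 h3).trans (ht Z' hZ' h2' h3').symm) (hnconst X₂ X₃)

end PlaneWord

end CoveredPlanes

section Pencils

variable [Fintype F] {n p : ℕ}

theorem planeWord_pts {c : Pt F n → ZMod p} {s : ZMod p} [Fact p.Prime]
    (hs : ∀ l : Submodule F (Fin (n + 1) → F), Module.finrank F l = 2 → ∑ P ∈ pts l, c P = s)
    {W : Submodule F (Fin (n + 1) → F)} (hW : Module.finrank F W = 3) :
    PlaneWord (pts W) ((Finset.univ.filter fun l : Submodule F (Fin (n + 1) → F) =>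
      Module.finrank F l = 2 ∧ l ≤ W).image pts) (Fintype.card F) c s := by
  constructor
  · intro l hl
    simp only [Finset.mem_image, Finset.mem_filter, Finset.mem_univ, true_and] at hl
    obtain ⟨l, ⟨-, hlW⟩, rfl⟩ := hl
    intro P hP
    rw [mem_pts] at hP ⊢
    exact ptIn_mono hlW hP
  · intro l hl
    simp only [Finset.mem_image, Finset.mem_filter, Finset.mem_univ, true_and] at hl
    obtain ⟨l, ⟨hl, -⟩, rfl⟩ := hl
    exact card_pts_line hl
  · intro x hx y hy hxy
    rw [mem_pts] at hx hy
    refine ⟨pts (x.submodule ⊔ y.submodule), Finset.mem_image_of_mem _ (Finset.mem_filter.mpr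
      ⟨Finset.mem_univ _, finrank_join hxy, sup_le hx hy⟩), ?_, ?_⟩
    · rw [mem_pts]; exact le_sup_left (a := x.submodule)
    · rw [mem_pts]; exact le_sup_right (a := x.submodule)
  · intro l hl m hm hlm
    simp only [Finset.mem_image, Finset.mem_filter, Finset.mem_univ, true_and] at hl hm
    obtain ⟨l, ⟨hl, hlW⟩, rfl⟩ := hl
    obtain ⟨m, ⟨hm, hmW⟩, rfl⟩ := hm
    obtain ⟨X, hX⟩ := exists_pt_inf_lines hl hm hW hlW hmW (fun h => hlm (by rw [h]))
    refine ⟨X, ?_⟩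
    simp only [mem_pts]
    exact ⟨((hX X).mpr rfl).1, ((hX X).mpr rfl).2, fun y h1 h2 => (hX y).mp ⟨h1, h2⟩⟩
  · rw [card_pts, hW]
    simp [Finset.sum_range_succ]
    ring
  · intro l hl
    simp only [Finset.mem_image, Finset.mem_filter, Finset.mem_univ, true_and] at hl
    obtain ⟨l, ⟨hl, -⟩, rfl⟩ := hl
    exact hs l hl

/-- Words of small weight have no lines of intermediate weight. -/
theorem nz_gap [Fact p.Prime] (hn : 2 ≤ n) (ι : ZMod p →+* F) {c : Pt F n → ZMod p}
    (hc : c ∈ code F p n) (hq : 37 ≤ Fintype.card F)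
    (hwt : (Finset.univ.filter fun P => c P ≠ 0).card ≤
      (4 * Fintype.card F - 33) * ∑ i ∈ Finset.range (n - 1), Fintype.card F ^ i)
    {l : Submodule F (Fin (n + 1) → F)} (hl : Module.finrank F l = 2) :
    nz c (pts l) ≤ 3 ∨ Fintype.card F ≤ nz c (pts l) + 3 := by
  by_contra hcon
  rw [not_or, not_le, not_le] at hcon
  obtain ⟨h3, hq3⟩ := hcon
  have hz := zeros_card_add_nz (c := c) (pts l)
  rw [card_pts_line hl] at hz
  obtain ⟨P, hP⟩ := Finset.card_pos.mp (show 0 < (zeros c (pts l)).card by omega)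
  simp only [zeros, Finset.mem_filter, mem_pts] at hP
  have h1 : ∀ W ∈ planesThrough l, nz c (pts l) * (Fintype.card F - nz c (pts l)) ≤
      ((pts W).filter fun Q => ¬ ptIn Q l ∧ c Q ≠ 0).card := by
    intro W hW
    simp only [planesThrough, Finset.mem_filter, Finset.mem_univ, true_and] at hW
    have hne : l ≠ W := by
      rintro rfl
      omega
    unfold nz
    convert mul_le_card_plane_diff_line ι hc hl (lt_of_le_of_ne hW.2 hne) hP.1 hP.2
  have h2 := Finset.card_nsmul_le_sum _ _ _ h1
  have hoff : (Finset.univ.filter fun P => ¬ ptIn P l ∧ c P ≠ 0).card =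
      ∑ W ∈ planesThrough l, ((pts W).filter fun Q => ¬ ptIn Q l ∧ c Q ≠ 0).card := by
    convert card_filter_off_line (fun P => c P ≠ 0) hl
  rw [← hoff, card_planesThrough (by omega) hl, smul_eq_mul] at h2
  have h4 : (Finset.univ.filter fun P => ¬ ptIn P l ∧ c P ≠ 0).card ≤
      (Finset.univ.filter fun P => c P ≠ 0).card :=
    Finset.card_le_card fun x hx => by
      simp only [Finset.mem_filter] at hx ⊢
      exact ⟨hx.1, hx.2.2⟩
  have hN : 0 < ∑ i ∈ Finset.range (n - 1), Fintype.card F ^ i := by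
    refine Finset.sum_pos (fun i _ => by positivity) ?_
    simp only [Finset.nonempty_range_iff]
    omega
  have h5 : 4 * Fintype.card F - 32 ≤ nz c (pts l) * (Fintype.card F - nz c (pts l)) := by
    obtain ⟨t, ht⟩ : ∃ t, nz c (pts l) = t + 4 := ⟨nz c (pts l) - 4, by omega⟩
    obtain ⟨u, hu⟩ : ∃ u, Fintype.card F = t + u + 8 := ⟨Fintype.card F - t - 8, by omega⟩
    rw [ht, hu, show t + u + 8 - (t + 4) = u + 4 by omega]
    have : (t + 4) * (u + 4) = t * u + 4 * t + 4 * u + 16 := by ring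
    have := Nat.zero_le (t * u)
    omega
  have h6 := Nat.mul_le_mul_left (∑ i ∈ Finset.range (n - 1), Fintype.card F ^ i) h5
  have h7 := (h6.trans h2).trans (h4.trans hwt)
  rw [mul_comm] at h7
  have := Nat.le_of_mul_le_mul_right h7 hN
  omega

theorem pencil_weights_contradiction {q N d₁ d₂ : ℤ} (hq : 37 ≤ q) (hN : 0 < N)
    (h1 : d₁ * ((q - 15) * (q - 4)) + (N - d₁) * (2 * (q - 1)) ≤ (4 * q - 33) * N)
    (h2 : d₂ * ((q - 15) * (q - 4)) + (N - d₂) * (2 * q - 12) ≤ (4 * q - 33) * N)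
    (h3 : (N - d₁) * (2 * (q - 1)) + (N - d₂) * (2 * q - 12) ≤ (4 * q - 33) * N) : False := by
  obtain ⟨r, rfl⟩ : ∃ r, q = r + 37 := ⟨q - 37, by ring⟩
  have hr : 0 ≤ r := by linarith
  have e1 : d₁ * (2 * (r + 37) - 12) ≤ 5 * N := by
    have hA : 0 < (r + 37) ^ 2 - 21 * (r + 37) + 62 := by nlinarith
    have h : d₁ * ((r + 37) ^ 2 - 21 * (r + 37) + 62) ≤ (2 * (r + 37) - 31) * N := by linarith
    refine le_of_mul_le_mul_right ?_ hA
    have h' := mul_le_mul_of_nonneg_left h (show 0 ≤ 2 * (r + 37) - 12 by linarith)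
    have h'' : 0 ≤ (r ^ 2 + 55 * r + 604) * N := by positivity
    nlinarith
  have e2 : d₂ * (2 * (r + 37) - 12) ≤ 6 * N := by
    have hA : 0 < (r + 37) ^ 2 - 21 * (r + 37) + 72 := by nlinarith
    have h : d₂ * ((r + 37) ^ 2 - 21 * (r + 37) + 72) ≤ (2 * (r + 37) - 21) * N := by linarith
    refine le_of_mul_le_mul_right ?_ hA
    have h' := mul_le_mul_of_nonneg_left h (show 0 ≤ 2 * (r + 37) - 12 by linarith)
    have h'' : 0 ≤ (2 * r ^ 2 + 88 * r + 698) * N := by positivity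
    nlinarith
  have e3 : 8 * N ≤ 10 * d₁ := by nlinarith
  nlinarith

/-- Counting over a pencil whose members are either dense or satisfy a weaker bound. -/
theorem pencil_count {l : Submodule F (Fin (n + 1) → F)} (hn : 1 ≤ n)
    (hl : Module.finrank F l = 2) {c : Pt F n → ZMod p} {T : Pt F n → Prop}
    (hT : ∀ P, T P → c P ≠ 0) {E M : ℕ}
    (h : ∀ W ∈ planesThrough l, E ≤ ((pts W).filter fun P => ¬ ptIn P l ∧ c P ≠ 0).card ∨
      M ≤ ((pts W).filter fun P => ¬ ptIn P l ∧ T P).card) :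
    ∃ d e : ℕ, d + e = ∑ i ∈ Finset.range (n - 1), Fintype.card F ^ i ∧
      d * E + e * M ≤ (Finset.univ.filter fun P => c P ≠ 0).card ∧
      e * M ≤ (Finset.univ.filter T).card := by
  set D := (planesThrough l).filter fun W =>
    E ≤ ((pts W).filter fun P => ¬ ptIn P l ∧ c P ≠ 0).card with hD
  set D' := (planesThrough l).filter fun W =>
    ¬ E ≤ ((pts W).filter fun P => ¬ ptIn P l ∧ c P ≠ 0).card with hD'
  have hle : ∀ W : Submodule F (Fin (n + 1) → F),
      ((pts W).filter fun P => ¬ ptIn P l ∧ T P).card ≤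
      ((pts W).filter fun P => ¬ ptIn P l ∧ c P ≠ 0).card := fun W =>
    Finset.card_le_card fun x hx => by
      simp only [Finset.mem_filter] at hx ⊢
      exact ⟨hx.1, hx.2.1, hT x hx.2.2⟩
  have k1 : D.card * E ≤ ∑ W ∈ D, ((pts W).filter fun P => ¬ ptIn P l ∧ c P ≠ 0).card :=
    Finset.card_nsmul_le_sum _ _ _ fun W hW => (Finset.mem_filter.mp hW).2
  have k2 : D'.card * M ≤ ∑ W ∈ D', ((pts W).filter fun P => ¬ ptIn P l ∧ T P).card :=
    Finset.card_nsmul_le_sum _ _ _ fun W hW =>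
      (h W (Finset.mem_filter.mp hW).1).resolve_left (Finset.mem_filter.mp hW).2
  have k3 := k2.trans (Finset.sum_le_sum fun W _ => hle W)
  have k4 : ∑ W ∈ D', ((pts W).filter fun P => ¬ ptIn P l ∧ T P).card ≤
      ∑ W ∈ planesThrough l, ((pts W).filter fun P => ¬ ptIn P l ∧ T P).card :=
    Finset.sum_le_sum_of_subset (Finset.filter_subset _ _)
  refine ⟨D.card, D'.card, ?_, ?_, ?_⟩
  · rw [← card_planesThrough hn hl]
    exact Finset.card_filter_add_card_filter_not _
  · have k5 := Finset.sum_filter_add_sum_filter_not (planesThrough l)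
      (fun W => E ≤ ((pts W).filter fun P => ¬ ptIn P l ∧ c P ≠ 0).card)
      (fun W => ((pts W).filter fun P => ¬ ptIn P l ∧ c P ≠ 0).card)
    have hoff : (Finset.univ.filter fun P => ¬ ptIn P l ∧ c P ≠ 0).card =
        ∑ W ∈ planesThrough l, ((pts W).filter fun Q => ¬ ptIn Q l ∧ c Q ≠ 0).card := by
      convert card_filter_off_line (fun P => c P ≠ 0) hl
    rw [← hoff] at k5
    have k6 : (Finset.univ.filter fun P => ¬ ptIn P l ∧ c P ≠ 0).card ≤
        (Finset.univ.filter fun P => c P ≠ 0).card :=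
      Finset.card_le_card fun x hx => by
        simp only [Finset.mem_filter] at hx ⊢
        exact ⟨hx.1, hx.2.2⟩
    exact (add_le_add k1 k3).trans (k5.le.trans k6)
  · rw [← card_filter_off_line T hl] at k4
    refine (k2.trans k4).trans (Finset.card_le_card fun x hx => ?_)
    simp only [Finset.mem_filter] at hx ⊢
    exact ⟨hx.1, hx.2.2⟩

/-- A word of small weight cannot contain both a triangle side and an injective line. -/
theorem no_triangle_side_and_injective_line [Fact p.Prime] (hn : 2 ≤ n) (ι : ZMod p →+* F)
    {c : Pt F n → ZMod p} (hc : c ∈ code F p n) (hq : 37 ≤ Fintype.card F)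
    (hwt : (Finset.univ.filter fun P => c P ≠ 0).card ≤
      (4 * Fintype.card F - 33) * ∑ i ∈ Finset.range (n - 1), Fintype.card F ^ i)
    {s : ZMod p} (hs : ∀ l : Submodule F (Fin (n + 1) → F), Module.finrank F l = 2 →
      ∑ P ∈ pts l, c P = s)
    {l m : Submodule F (Fin (n + 1) → F)} (hl : Module.finrank F l = 2)
    (hm : Module.finrank F m = 2) {V₂ V₃ : Pt F n} (hV : V₂ ≠ V₃) (hV₂ : ptIn V₂ l)
    (hV₃ : ptIn V₃ l) {a₁ a₂ a₃ : ZMod p} (h2 : (2 : ZMod p) ≠ 0) (ha₁ : a₁ ≠ 0) (ha₂ : a₂ ≠ 0)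
    (ha₃ : a₃ ≠ 0) (hsa : s = a₁ + a₂ + a₃)
    (hgen : ∀ z, ptIn z l → z ≠ V₂ → z ≠ V₃ → c z = a₁) (hcV₂ : c V₂ = a₁ + a₂)
    (hcV₃ : c V₃ = a₁ + a₃) {O : Pt F n} (hO : ptIn O m)
    (hinj : ∀ z, ptIn z m → ∀ z', ptIn z' m → z ≠ O → z' ≠ O → c z = c z' → z = z') : False := by
  set q := Fintype.card F with hqdef
  have hgap : ∀ W : Submodule F (Fin (n + 1) → F), ∀ x ∈
      ((Finset.univ.filter fun l : Submodule F (Fin (n + 1) → F) =>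
      Module.finrank F l = 2 ∧ l ≤ W).image pts), nz c x ≤ 3 ∨ q ≤ nz c x + 3 := by
    intro W x hx
    simp only [Finset.mem_image, Finset.mem_filter, Finset.mem_univ, true_and] at hx
    obtain ⟨l, ⟨hl, -⟩, rfl⟩ := hx
    exact nz_gap hn ι hc hq hwt hl
  have hmem : ∀ {l W : Submodule F (Fin (n + 1) → F)}, Module.finrank F l = 2 → l ≤ W → pts l ∈
      ((Finset.univ.filter fun l : Submodule F (Fin (n + 1) → F) =>
      Module.finrank F l = 2 ∧ l ≤ W).image pts) := fun hl hlW =>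
    Finset.mem_image_of_mem _ (Finset.mem_filter.mpr ⟨Finset.mem_univ _, hl, hlW⟩)
  obtain ⟨d₁, e₁, hd₁, hw₁, ht₁⟩ := pencil_count (c := c) (l := l) (by omega) hl
    (T := fun P => c P = a₂ ∨ c P = a₃) (E := (q - 15) * (q - 4)) (M := 2 * (q - 1))
    (by rintro P (h | h) <;> rw [h] <;> assumption) (by
      intro W hW
      simp only [planesThrough, Finset.mem_filter, Finset.mem_univ, true_and] at hW
      have := (planeWord_pts hs hW.1).triangle_side hq (hgap W) (hmem hl hW.2) hV
        ((mem_pts).mpr hV₂) ((mem_pts).mpr hV₃) h2 ha₁ ha₂ ha₃ hsa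
        (fun z hz => hgen z ((mem_pts).mp hz)) hcV₂ hcV₃
      simp only [PlaneWord.offSupp, mem_pts] at this
      convert this)
  obtain ⟨d₂, e₂, hd₂, hw₂, ht₂⟩ := pencil_count (c := c) (l := m) (by omega) hm
    (T := fun P => c P ≠ 0 ∧ c P ≠ a₂ ∧ c P ≠ a₃) (E := (q - 15) * (q - 4)) (M := 2 * q - 12)
    (fun P hP => hP.1) (by
      intro W hW
      simp only [planesThrough, Finset.mem_filter, Finset.mem_univ, true_and] at hW
      have := (planeWord_pts hs hW.1).injective_side hq (hgap W) (hmem hm hW.2)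
        ((mem_pts).mpr hO)
        (fun z hz z' hz' => hinj z ((mem_pts).mp hz) z' ((mem_pts).mp hz')) a₂ a₃
      simp only [PlaneWord.offSupp, mem_pts] at this
      convert this)
  have hdis : Disjoint (Finset.univ.filter fun P => c P = a₂ ∨ c P = a₃)
      (Finset.univ.filter fun P => c P ≠ 0 ∧ c P ≠ a₂ ∧ c P ≠ a₃) := by
    rw [Finset.disjoint_filter]
    rintro x - (h | h) h'
    · exact h'.2.1 h
    · exact h'.2.2 h
  have hsum : (Finset.univ.filter fun P => c P = a₂ ∨ c P = a₃).card +
      (Finset.univ.filter fun P => c P ≠ 0 ∧ c P ≠ a₂ ∧ c P ≠ a₃).card ≤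
      (Finset.univ.filter fun P => c P ≠ 0).card := by
    rw [← Finset.card_union_of_disjoint hdis]
    refine Finset.card_le_card fun x hx => ?_
    simp only [Finset.mem_union, Finset.mem_filter, Finset.mem_univ, true_and] at hx ⊢
    rcases hx with (h | h) | h
    · rw [h]; exact ha₂
    · rw [h]; exact ha₃
    · exact h.1
  set N := ∑ i ∈ Finset.range (n - 1), q ^ i with hN
  have hNpos : 0 < N := by
    refine Finset.sum_pos (fun i _ => pow_pos (by omega) _) ?_
    simp only [Finset.nonempty_range_iff]
    omega
  have c1 := hw₁.trans hwt
  have c2 := hw₂.trans hwt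
  have c3 := (add_le_add ht₁ ht₂).trans ((le_of_eq (by congr)).trans (hsum.trans hwt))
  obtain ⟨r, hr⟩ : ∃ r, q = r + 37 := ⟨q - 37, by omega⟩
  clear_value N q
  subst hr
  rw [show r + 37 - 15 = r + 22 by omega, show r + 37 - 4 = r + 33 by omega,
    show 4 * (r + 37) - 33 = 4 * r + 115 by omega] at c1 c2
  rw [show 4 * (r + 37) - 33 = 4 * r + 115 by omega] at c3
  rw [show r + 37 - 1 = r + 36 by omega] at c1 c3
  rw [show 2 * (r + 37) - 12 = 2 * r + 62 by omega] at c2 c3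
  have f1 : (e₁ : ℤ) = N - d₁ := by
    have := congrArg (Nat.cast : ℕ → ℤ) hd₁
    push_cast at this
    linarith
  have f2 : (e₂ : ℤ) = N - d₂ := by
    have := congrArg (Nat.cast : ℕ → ℤ) hd₂
    push_cast at this
    linarith
  zify at c1 c2 c3
  rw [f1] at c1 c3
  rw [f2] at c2 c3
  refine pencil_weights_contradiction (q := (r : ℤ) + 37) (N := N) (d₁ := d₁) (d₂ := d₂)
    (by omega) (by exact_mod_cast hNpos) ?_ ?_ ?_ <;>
    ring_nf at * <;> linarith

end Pencils

section Weights

variable [Fintype F] {n p : ℕ}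

/-- The contribution of a value to the weight. -/
def ind (x : ZMod p) : ℕ := if x = 0 then 0 else 1

theorem ind_of_ne {x : ZMod p} (h : x ≠ 0) : ind x = 1 := if_neg h

theorem ind_zero : ind (0 : ZMod p) = 0 := if_pos rfl

theorem ind_le_one (x : ZMod p) : ind x ≤ 1 := by unfold ind; split_ifs <;> simp

theorem wtRes_eq_sum (c : Pt F n → ZMod p) (W : Submodule F (Fin (n + 1) → F)) :
    wtRes c W = ∑ P ∈ pts W, ind (c P) := by
  have h1 : (ptsIn W ∩ supp c) = ((pts W).filter fun P => c P ≠ 0 : Finset (Pt F n)) := by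
    ext P
    simp [ptsIn, supp]
  rw [wtRes, h1, Set.ncard_coe_finset, Finset.card_filter]
  refine Finset.sum_congr rfl fun P _ => ?_
  unfold ind
  split_ifs <;> simp_all

theorem wt_eq_card (c : Pt F n → ZMod p) :
    wt c = (Finset.univ.filter fun P => c P ≠ 0).card := by
  have h1 : supp c = (Finset.univ.filter fun P => c P ≠ 0 : Finset (Pt F n)) := by
    ext P
    simp [supp]
  rw [wt, h1, Set.ncard_coe_finset]

theorem sum_pts_ite_le {M : Type} [AddCommMonoid M] (f : Pt F n → M)
    {l W : Submodule F (Fin (n + 1) → F)} (hlW : l ≤ W) :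
    ∑ P ∈ pts W, (if ptIn P l then f P else 0) = ∑ P ∈ pts l, f P := by
  rw [← Finset.sum_filter]
  refine Finset.sum_congr ?_ fun _ _ => rfl
  ext P
  simp only [Finset.mem_filter, mem_pts, and_iff_right_iff_imp]
  exact ptIn_mono hlW

theorem sum_pts_ite_eq {M : Type} [AddCommMonoid M] (f : Pt F n → M)
    {W : Submodule F (Fin (n + 1) → F)} {X : Pt F n} (hX : ptIn X W) :
    ∑ P ∈ pts W, (if P = X then f P else 0) = f X := by
  rw [Finset.sum_ite_eq' (pts W) X f, if_pos (mem_pts.mpr hX)]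

/-- The weight of a word supported on three concurrent lines. -/
theorem wtRes_concurrent {c : Pt F n → ZMod p} {W l₁ l₂ l₃ : Submodule F (Fin (n + 1) → F)}
    (h₁ : Module.finrank F l₁ = 2) (h₂ : Module.finrank F l₂ = 2) (h₃ : Module.finrank F l₃ = 2)
    (hW₁ : l₁ ≤ W) (hW₂ : l₂ ≤ W) (hW₃ : l₃ ≤ W) (h12 : l₁ ≠ l₂) (h13 : l₁ ≠ l₃) (h23 : l₂ ≠ l₃)
    {O : Pt F n} (hO₁ : ptIn O l₁) (hO₂ : ptIn O l₂) (hO₃ : ptIn O l₃)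
    (hc : ∀ P, ptIn P W → ¬ ptIn P l₁ → ¬ ptIn P l₂ → ¬ ptIn P l₃ → c P = 0) :
    wtRes c W + 2 * ind (c O) = wtRes c l₁ + wtRes c l₂ + wtRes c l₃ := by
  have key : ∀ P ∈ pts W, ind (c P) + 2 * (if P = O then ind (c P) else 0) =
      (if ptIn P l₁ then ind (c P) else 0) + (if ptIn P l₂ then ind (c P) else 0) +
      (if ptIn P l₃ then ind (c P) else 0) := by
    intro P hP
    by_cases hPO : P = O
    · subst hPO
      simp only [hO₁, hO₂, hO₃, if_true]
      ring
    · have n12 : ptIn P l₁ → ¬ ptIn P l₂ := fun a b =>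
        h12 (line_unique_of_mem h₁ h₂ hPO a hO₁ b hO₂)
      have n13 : ptIn P l₁ → ¬ ptIn P l₃ := fun a b =>
        h13 (line_unique_of_mem h₁ h₃ hPO a hO₁ b hO₃)
      have n23 : ptIn P l₂ → ¬ ptIn P l₃ := fun a b =>
        h23 (line_unique_of_mem h₂ h₃ hPO a hO₂ b hO₃)
      by_cases a : ptIn P l₁
      · simp [hPO, a, n12 a, n13 a]
      · by_cases b : ptIn P l₂
        · simp [hPO, a, b, n23 b]
        · by_cases d : ptIn P l₃
          · simp [hPO, a, b, d]
          · simp [hPO, a, b, d, hc P (mem_pts.mp hP) a b d, ind_zero]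
  have := Finset.sum_congr rfl key
  rw [Finset.sum_add_distrib, Finset.sum_add_distrib, Finset.sum_add_distrib, ← Finset.mul_sum,
    sum_pts_ite_eq _ (ptIn_mono hW₁ hO₁), sum_pts_ite_le _ hW₁, sum_pts_ite_le _ hW₂,
    sum_pts_ite_le _ hW₃] at this
  simpa only [wtRes_eq_sum] using this

/-- The weight of a word supported on three nonconcurrent lines. -/
theorem wtRes_triangle {c : Pt F n → ZMod p} {W l₁ l₂ l₃ : Submodule F (Fin (n + 1) → F)}
    (hW₁ : l₁ ≤ W) (hW₂ : l₂ ≤ W) (hW₃ : l₃ ≤ W) {X₁ X₂ X₃ : Pt F n}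
    (hX₃ : ∀ P, ptIn P l₁ ∧ ptIn P l₂ ↔ P = X₃) (hX₂ : ∀ P, ptIn P l₁ ∧ ptIn P l₃ ↔ P = X₂)
    (hX₁ : ∀ P, ptIn P l₂ ∧ ptIn P l₃ ↔ P = X₁)
    (hnc : ¬ ∃ P, ptIn P l₁ ∧ ptIn P l₂ ∧ ptIn P l₃)
    (hc : ∀ P, ptIn P W → ¬ ptIn P l₁ → ¬ ptIn P l₂ → ¬ ptIn P l₃ → c P = 0) :
    wtRes c W + (ind (c X₁) + ind (c X₂) + ind (c X₃)) =
      wtRes c l₁ + wtRes c l₂ + wtRes c l₃ := by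
  have key : ∀ P ∈ pts W, ind (c P) + ((if P = X₁ then ind (c P) else 0) +
      (if P = X₂ then ind (c P) else 0) + (if P = X₃ then ind (c P) else 0)) =
      (if ptIn P l₁ then ind (c P) else 0) + (if ptIn P l₂ then ind (c P) else 0) +
      (if ptIn P l₃ then ind (c P) else 0) := by
    intro P hP
    simp only [← hX₁, ← hX₂, ← hX₃]
    by_cases a : ptIn P l₁ <;> by_cases b : ptIn P l₂ <;> by_cases d : ptIn P l₃
    · exact absurd ⟨P, a, b, d⟩ hnc
    all_goals simp [a, b, d]
    rw [hc P (mem_pts.mp hP) a b d, ind_zero]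
  have := Finset.sum_congr rfl key
  rw [Finset.sum_add_distrib, Finset.sum_add_distrib, Finset.sum_add_distrib,
    Finset.sum_add_distrib, Finset.sum_add_distrib,
    sum_pts_ite_eq _ (ptIn_mono hW₂ ((hX₁ X₁).mpr rfl).1),
    sum_pts_ite_eq _ (ptIn_mono hW₁ ((hX₂ X₂).mpr rfl).1),
    sum_pts_ite_eq _ (ptIn_mono hW₁ ((hX₃ X₃).mpr rfl).1),
    sum_pts_ite_le _ hW₁, sum_pts_ite_le _ hW₂, sum_pts_ite_le _ hW₃] at this
  simpa only [wtRes_eq_sum] using this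

theorem sum_pts_eq_of_const_off {M : Type} [AddCommMonoid M] (f : Pt F n → M)
    {l : Submodule F (Fin (n + 1) → F)} (hl : Module.finrank F l = 2) {O : Pt F n}
    (hO : ptIn O l) {a : M} (h : ∀ P, ptIn P l → P ≠ O → f P = a) :
    ∑ P ∈ pts l, f P = f O + Fintype.card F • a := by
  rw [← Finset.add_sum_erase _ _ (mem_pts.mpr hO)]
  congr 1
  rw [Finset.sum_congr rfl (g := fun _ => a) fun P hP => ?_, Finset.sum_const,
    Finset.card_erase_of_mem (mem_pts.mpr hO), card_pts_line hl, Nat.add_sub_cancel]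
  exact h P (mem_pts.mp (Finset.mem_of_mem_erase hP)) (Finset.ne_of_mem_erase hP)

theorem sum_pts_eq_of_const_off_pair {M : Type} [AddCommMonoid M] (f : Pt F n → M)
    {l : Submodule F (Fin (n + 1) → F)} (hl : Module.finrank F l = 2) {X Y : Pt F n}
    (hXY : X ≠ Y) (hX : ptIn X l) (hY : ptIn Y l) {a : M}
    (h : ∀ P, ptIn P l → P ≠ X → P ≠ Y → f P = a) :
    ∑ P ∈ pts l, f P = f X + (f Y + (Fintype.card F - 1) • a) := by
  have hY' : Y ∈ (pts l).erase X := Finset.mem_erase.mpr ⟨hXY.symm, mem_pts.mpr hY⟩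
  rw [← Finset.add_sum_erase _ _ (mem_pts.mpr hX), ← Finset.add_sum_erase _ _ hY']
  congr 2
  rw [Finset.sum_congr rfl (g := fun _ => a) fun P hP => ?_, Finset.sum_const,
    Finset.card_erase_of_mem hY', Finset.card_erase_of_mem (mem_pts.mpr hX), card_pts_line hl,
    Nat.add_sub_cancel]
  have hP' := Finset.mem_of_mem_erase hP
  exact h P (mem_pts.mp (Finset.mem_of_mem_erase hP')) (Finset.ne_of_mem_erase hP')
    (Finset.ne_of_mem_erase hP)

theorem wtRes_star (hp : (Fintype.card F : ZMod p) = 0) {c : Pt F n → ZMod p} {s : ZMod p}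
    (hs : ∀ l : Submodule F (Fin (n + 1) → F), Module.finrank F l = 2 → ∑ P ∈ pts l, c P = s)
    {W : Submodule F (Fin (n + 1) → F)} (hT : TypeStar p c W) :
    wtRes c W = 3 * Fintype.card F + ind s := by
  obtain ⟨l₁, l₂, l₃, h₁, h₂, h₃, hW₁, hW₂, hW₃, h12, h13, h23, ⟨O, hO₁, hO₂, hO₃⟩, a₁, a₂, a₃,
    ha₁, ha₂, ha₃, hc⟩ := hT
  have only : ∀ {l m : Submodule F (Fin (n + 1) → F)}, IsLine l → IsLine m → l ≠ m → ptIn O l →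
      ptIn O m → ∀ P, ptIn P l → P ≠ O → ¬ ptIn P m := fun hl hm hlm hOl hOm P hP hPO hPm =>
    hlm (line_unique_of_mem hl hm hPO hP hOl hPm hOm)
  have c₁ : ∀ P, ptIn P l₁ → P ≠ O → c P = a₁ := fun P hP hPO => by
    rw [hc P (ptIn_mono hW₁ hP)]
    simp [incVec, hP, only h₁ h₂ h12 hO₁ hO₂ P hP hPO, only h₁ h₃ h13 hO₁ hO₃ P hP hPO]
  have c₂ : ∀ P, ptIn P l₂ → P ≠ O → c P = a₂ := fun P hP hPO => by
    rw [hc P (ptIn_mono hW₂ hP)]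
    simp [incVec, hP, only h₂ h₁ h12.symm hO₂ hO₁ P hP hPO, only h₂ h₃ h23 hO₂ hO₃ P hP hPO]
  have c₃ : ∀ P, ptIn P l₃ → P ≠ O → c P = a₃ := fun P hP hPO => by
    rw [hc P (ptIn_mono hW₃ hP)]
    simp [incVec, hP, only h₃ h₁ h13.symm hO₃ hO₁ P hP hPO, only h₃ h₂ h23.symm hO₃ hO₂ P hP hPO]
  have hcO : c O = s := by
    have := hs l₁ h₁
    rw [sum_pts_eq_of_const_off c h₁ hO₁ c₁, nsmul_eq_mul, hp] at this
    simpa using this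
  have w : ∀ {l : Submodule F (Fin (n + 1) → F)} {a : ZMod p}, IsLine l → ptIn O l → a ≠ 0 →
      (∀ P, ptIn P l → P ≠ O → c P = a) → wtRes c l = Fintype.card F + ind s := by
    intro l a hl hO ha h
    rw [wtRes_eq_sum, sum_pts_eq_of_const_off (fun P => ind (c P)) hl hO (a := 1)
      fun P hP hPO => by rw [h P hP hPO, ind_of_ne ha], hcO, smul_eq_mul, mul_one, add_comm]
  have := wtRes_concurrent h₁ h₂ h₃ hW₁ hW₂ hW₃ h12 h13 h23 hO₁ hO₂ hO₃ (c := c)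
    fun P hP n1 n2 n3 => by rw [hc P hP]; simp [incVec, n1, n2, n3]
  rw [w h₁ hO₁ ha₁ c₁, w h₂ hO₂ ha₂ c₂, w h₃ hO₃ ha₃ c₃, hcO] at this
  omega

/-- The structure of a plane of triangle type. -/
theorem exists_triangle (hp : (Fintype.card F : ZMod p) = 0) {c : Pt F n → ZMod p} {s : ZMod p}
    (hs : ∀ l : Submodule F (Fin (n + 1) → F), Module.finrank F l = 2 → ∑ P ∈ pts l, c P = s)
    {W : Submodule F (Fin (n + 1) → F)} (hW : IsPlane W)
    {l₁ l₂ l₃ : Submodule F (Fin (n + 1) → F)} (h₁ : IsLine l₁) (h₂ : IsLine l₂) (h₃ : IsLine l₃)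
    (hW₁ : l₁ ≤ W) (hW₂ : l₂ ≤ W) (hW₃ : l₃ ≤ W) (h12 : l₁ ≠ l₂) (h13 : l₁ ≠ l₃)
    (hnc : ¬ ∃ P : Pt F n, ptIn P l₁ ∧ ptIn P l₂ ∧ ptIn P l₃) {a₁ a₂ a₃ : ZMod p}
    (hc : ∀ P : Pt F n, ptIn P W →
        c P = a₁ * incVec p l₁ P + a₂ * incVec p l₂ P + a₃ * incVec p l₃ P) :
    ∃ X₂ X₃ : Pt F n, X₂ ≠ X₃ ∧ (∀ P, ptIn P l₁ ∧ ptIn P l₂ ↔ P = X₃) ∧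
      (∀ P, ptIn P l₁ ∧ ptIn P l₃ ↔ P = X₂) ∧ (∀ P, ptIn P l₁ → P ≠ X₂ → P ≠ X₃ → c P = a₁) ∧
      c X₃ = a₁ + a₂ ∧ c X₂ = a₁ + a₃ ∧ s = a₁ + a₂ + a₃ := by
  obtain ⟨X₃, hX₃⟩ := exists_pt_inf_lines h₁ h₂ hW hW₁ hW₂ h12
  obtain ⟨X₂, hX₂⟩ := exists_pt_inf_lines h₁ h₃ hW hW₁ hW₃ h13
  have i3 := (hX₃ X₃).mpr rfl
  have i2 := (hX₂ X₂).mpr rfl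
  have hne : X₂ ≠ X₃ := by
    rintro rfl
    exact hnc ⟨X₂, i2.1, i3.2, i2.2⟩
  have n3 : ¬ ptIn X₃ l₃ := fun h => hnc ⟨X₃, i3.1, i3.2, h⟩
  have n2 : ¬ ptIn X₂ l₂ := fun h => hnc ⟨X₂, i2.1, h, i2.2⟩
  have hgen : ∀ P, ptIn P l₁ → P ≠ X₂ → P ≠ X₃ → c P = a₁ := by
    intro P hP hP2 hP3
    rw [hc P (ptIn_mono hW₁ hP)]
    have k2 : ¬ ptIn P l₂ := fun h => hP3 ((hX₃ P).mp ⟨hP, h⟩)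
    have k3 : ¬ ptIn P l₃ := fun h => hP2 ((hX₂ P).mp ⟨hP, h⟩)
    simp [incVec, hP, k2, k3]
  have c3 : c X₃ = a₁ + a₂ := by
    rw [hc X₃ (ptIn_mono hW₁ i3.1)]
    simp [incVec, i3.1, i3.2, n3]
  have c2 : c X₂ = a₁ + a₃ := by
    rw [hc X₂ (ptIn_mono hW₁ i2.1)]
    simp [incVec, i2.1, i2.2, n2]
  refine ⟨X₂, X₃, hne, hX₃, hX₂, hgen, c3, c2, ?_⟩
  have := hs l₁ h₁
  rw [sum_pts_eq_of_const_off_pair c h₁ hne i2.1 i3.1 hgen, c2, c3, nsmul_eq_mul,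
    Nat.cast_sub Fintype.card_pos, hp] at this
  rw [← this]
  push_cast
  ring

theorem wtRes_tri (hp : (Fintype.card F : ZMod p) = 0) {c : Pt F n → ZMod p} {s : ZMod p}
    (hs : ∀ l : Submodule F (Fin (n + 1) → F), Module.finrank F l = 2 → ∑ P ∈ pts l, c P = s)
    {W : Submodule F (Fin (n + 1) → F)} (hW : IsPlane W)
    {l₁ l₂ l₃ : Submodule F (Fin (n + 1) → F)} (h₁ : IsLine l₁) (h₂ : IsLine l₂) (h₃ : IsLine l₃)
    (hW₁ : l₁ ≤ W) (hW₂ : l₂ ≤ W) (hW₃ : l₃ ≤ W) (h12 : l₁ ≠ l₂) (h13 : l₁ ≠ l₃) (h23 : l₂ ≠ l₃)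
    (hnc : ¬ ∃ P : Pt F n, ptIn P l₁ ∧ ptIn P l₂ ∧ ptIn P l₃) {a₁ a₂ a₃ : ZMod p}
    (ha₁ : a₁ ≠ 0) (ha₂ : a₂ ≠ 0) (ha₃ : a₃ ≠ 0)
    (hc : ∀ P : Pt F n, ptIn P W →
        c P = a₁ * incVec p l₁ P + a₂ * incVec p l₂ P + a₃ * incVec p l₃ P) :
    s = a₁ + a₂ + a₃ ∧
    wtRes c W = 3 * (Fintype.card F - 1) + (ind (s - a₁) + ind (s - a₂) + ind (s - a₃)) := by
  obtain ⟨X₂, X₃, hne, hX₃, hX₂, hgen₁, c3, c2, hsum⟩ :=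
    exists_triangle hp hs hW h₁ h₂ h₃ hW₁ hW₂ hW₃ h12 h13 hnc hc
  obtain ⟨X₁, X₃', hne', hX₃', hX₁, hgen₂, -, c1, -⟩ :=
    exists_triangle hp hs hW h₂ h₁ h₃ hW₂ hW₁ hW₃ h12.symm h23
      (fun ⟨P, x, y, z⟩ => hnc ⟨P, y, x, z⟩) (a₁ := a₂) (a₂ := a₁) (a₃ := a₃)
      (fun P hP => by rw [hc P hP]; ring)
  obtain ⟨X₁', X₂', hne'', hX₂', hX₁', hgen₃, -, -, -⟩ :=
    exists_triangle hp hs hW h₃ h₁ h₂ hW₃ hW₁ hW₂ h13.symm h23.symm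
      (fun ⟨P, x, y, z⟩ => hnc ⟨P, y, z, x⟩) (a₁ := a₃) (a₂ := a₁) (a₃ := a₂)
      (fun P hP => by rw [hc P hP]; ring)
  obtain rfl : X₃' = X₃ := (hX₃ _).mp ((hX₃' _).mpr rfl).symm
  obtain rfl : X₂' = X₂ := (hX₂ _).mp ((hX₂' _).mpr rfl).symm
  obtain rfl : X₁' = X₁ := (hX₁ _).mp ((hX₁' _).mpr rfl).symm
  refine ⟨hsum, ?_⟩
  have w : ∀ {l : Submodule F (Fin (n + 1) → F)} {a : ZMod p} {X Y : Pt F n}, IsLine l → X ≠ Y →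
      ptIn X l → ptIn Y l → a ≠ 0 → (∀ P, ptIn P l → P ≠ X → P ≠ Y → c P = a) →
      wtRes c l = ind (c X) + (ind (c Y) + (Fintype.card F - 1)) := by
    intro l a X Y hl hXY hX hY ha h
    rw [wtRes_eq_sum, sum_pts_eq_of_const_off_pair (fun P => ind (c P)) hl hXY hX hY (a := 1)
      fun P hP hPX hPY => by rw [h P hP hPX hPY, ind_of_ne ha], smul_eq_mul, mul_one]
  have := wtRes_triangle hW₁ hW₂ hW₃ hX₃ hX₂ hX₁ hnc (c := c)
    fun P hP n1 n2 n3 => by rw [hc P hP]; simp [incVec, n1, n2, n3]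
  rw [w h₁ hne ((hX₂ _).mpr rfl).1 ((hX₃ _).mpr rfl).1 ha₁ hgen₁,
    w h₂ hne' ((hX₁ _).mpr rfl).1 ((hX₃ _).mpr rfl).2 ha₂ hgen₂,
    w h₃ hne'' ((hX₁ _).mpr rfl).2 ((hX₂ _).mpr rfl).2 ha₃ hgen₃] at this
  have e1 : s - a₁ = c X₁' := by rw [c1, hsum]; ring
  have e2 : s - a₂ = c X₂' := by rw [c2, hsum]; ring
  have e3 : s - a₃ = c X₃' := by rw [c3, hsum]; ring
  rw [e1, e2, e3]
  omega

end Weights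

section Odd

theorem eq_zero_or_eq_one (t : ZMod 2) : t = 0 ∨ t = 1 := by
  revert t
  decide

variable {n p : ℕ} [Fact p.Prime]

theorem oddBase_mk {y : Fin 3 → ZMod p} (hy : y ≠ 0) :
    oddBase p (Projectivization.mk (ZMod p) y hy) =
      if y 0 = 0 ∧ y 1 ≠ 0 then y 2 / y 1
      else if y 1 = 0 ∧ y 0 ≠ 0 then y 2 / y 0
      else if y 0 = y 1 ∧ y 0 ≠ 0 then -(y 2 / y 0) else 0 := by
  obtain ⟨a, ha⟩ := Projectivization.exists_smul_eq_mk_rep (ZMod p) y hy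
  have ha0 : (a : ZMod p) ≠ 0 := a.ne_zero
  have hrep : ∀ i, (Projectivization.mk (ZMod p) y hy).rep i = (a : ZMod p) * y i := fun i => by
    rw [← ha]; rfl
  simp only [oddBase, hrep, mul_eq_zero, ha0, false_or, ne_eq, mul_right_inj' ha0,
    mul_div_mul_left _ _ ha0]

theorem ptIn_mk {U : Submodule (ZMod p) (Fin 3 → ZMod p)} {y : Fin 3 → ZMod p} (hy : y ≠ 0) :
    (ptIn (Projectivization.mk (ZMod p) y hy : Pt (ZMod p) 2) U) ↔ y ∈ U := by
  rw [ptIn, Projectivization.submodule_mk, Submodule.span_singleton_le_iff_mem]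

/-- The values of a word of odd type in a suitable frame of the plane. -/
def oddValue (γ a₁ a₂ a₃ : ZMod p) (y : Fin 3 → ZMod p) : ZMod p :=
  γ * (if y 0 = 0 ∧ y 1 ≠ 0 then y 2 / y 1
      else if y 1 = 0 ∧ y 0 ≠ 0 then y 2 / y 0
      else if y 0 = y 1 ∧ y 0 ≠ 0 then -(y 2 / y 0) else 0) +
    a₁ * (if y 0 = 0 then 1 else 0) + a₂ * (if y 1 = 0 then 1 else 0) +
    a₃ * (if y 0 = y 1 then 1 else 0)

theorem exists_odd_frame [Fintype F] {c : Pt F n → ZMod p}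
    {W : Submodule F (Fin (n + 1) → F)} (hT : TypeOdd p c W) :
    ∃ (σ : ZMod p →+* F) (f : Fin 3 → (Fin (n + 1) → F)) (γ a₁ a₂ a₃ : ZMod p),
      Function.Surjective σ ∧ LinearIndependent F f ∧ Submodule.span F (Set.range f) = W ∧ γ ≠ 0 ∧
      ∀ y : Fin 3 → ZMod p, y ≠ 0 → c (pmk (∑ i, σ (y i) • f i)) = oddValue γ a₁ a₂ a₃ y := by
  obtain ⟨hcard, σ, b, hb, hspan, g, γ, a₁, a₂, a₃, hγ, hc⟩ := hT
  have hσ : Function.Surjective σ := by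
    have := (Fintype.bijective_iff_injective_and_card σ).mpr
      ⟨σ.injective, by rw [ZMod.card, hcard]⟩
    exact this.2
  set u : Fin 3 → (Fin 3 → ZMod p) := fun j => g.symm (Pi.single j 1) with hu
  set f : Fin 3 → (Fin (n + 1) → F) := fun j => ∑ i, σ (u j i) • b i with hf
  have hcomb : ∀ y : Fin 3 → ZMod p, ∑ j, σ (y j) • f j = ∑ i, σ (g.symm y i) • b i := by
    intro y
    have h1 : g.symm y = ∑ j, y j • u j := by
      conv_lhs => rw [← Finset.univ_sum_single y]
      rw [map_sum]
      refine Finset.sum_congr rfl fun j _ => ?_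
      rw [hu, ← map_smul]
      congr 1
      rw [← Pi.single_smul, smul_eq_mul, mul_one]
    rw [h1]
    simp only [hf, Finset.sum_apply, Pi.smul_apply, smul_eq_mul, map_sum, map_mul,
      Finset.smul_sum, Finset.sum_smul, smul_smul]
    exact Finset.sum_comm
  have hb' := Fintype.linearIndependent_iff.mp hb
  have hli : LinearIndependent F f := by
    rw [Fintype.linearIndependent_iff]
    intro t ht
    choose τ hτ using fun j => hσ (t j)
    have h1 : ∑ i, σ (g.symm τ i) • b i = 0 := by
      rw [← hcomb, ← ht]
      simp only [hτ]
    have h2 : g.symm τ = 0 := funext fun i => σ.injective (by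
      rw [hb' _ h1 i]; simp)
    have h3 : τ = 0 := by simpa using h2
    intro i
    rw [← hτ, h3]
    simp
  refine ⟨σ, f, γ, a₁, a₂, a₃, hσ, hli, ?_, hγ, ?_⟩
  · have hle : Submodule.span F (Set.range f) ≤ W := by
      rw [← hspan, Submodule.span_le]
      rintro _ ⟨j, rfl⟩
      refine Submodule.sum_mem _ fun i _ => Submodule.smul_mem _ _ ?_
      exact Submodule.subset_span ⟨i, rfl⟩
    refine Submodule.eq_of_le_of_finrank_eq hle ?_
    rw [← hspan, finrank_span_eq_card hli, finrank_span_eq_card hb]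
  · intro y hy
    have hz : g.symm y ≠ 0 := by simpa using hy
    have hne : ∑ i, σ (g.symm y i) • b i ≠ 0 := by
      intro h
      exact hz (funext fun i => σ.injective (by rw [hb' _ h i]; simp))
    have hQ := hc (Projectivization.mk (ZMod p) (g.symm y) hz)
    have e1 : planeEmbed σ b hb (Projectivization.mk (ZMod p) (g.symm y) hz) =
        pmk (∑ i, σ (y i) • f i) := by
      rw [hcomb, pmk_of_ne hne, planeEmbed, Projectivization.mk_eq_mk_iff']
      obtain ⟨a, ha⟩ := Projectivization.exists_smul_eq_mk_rep (ZMod p) (g.symm y) hz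
      refine ⟨σ a, ?_⟩
      rw [Finset.smul_sum]
      refine Finset.sum_congr rfl fun i _ => ?_
      rw [smul_smul, ← map_mul, ← ha]
      rfl
    have e2 : Projectivization.map g.toLinearMap g.injective
        (Projectivization.mk (ZMod p) (g.symm y) hz) = Projectivization.mk (ZMod p) y hy := by
      rw [Projectivization.map_mk]
      congr 1
      exact g.apply_symm_apply y
    rw [e1] at hQ
    rw [hQ, oddWord, e2, oddBase_mk]
    simp only [incVec, ptIn_mk, lineM1, lineM2, lineM3, LinearMap.mem_ker, LinearMap.sub_apply,
      LinearMap.proj_apply, sub_eq_zero, oddValue]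

/-- A plane of odd type is covered by three concurrent lines on which the word is injective. -/
theorem exists_odd_lines [Fintype F] {c : Pt F n → ZMod p} {s : ZMod p}
    (hs : ∀ l : Submodule F (Fin (n + 1) → F), Module.finrank F l = 2 → ∑ P ∈ pts l, c P = s)
    {W : Submodule F (Fin (n + 1) → F)} (hT : TypeOdd p c W) :
    ∃ (l : Fin 3 → Submodule F (Fin (n + 1) → F)) (O : Pt F n), Function.Injective l ∧
      (∀ i, Module.finrank F (l i) = 2) ∧ (∀ i, l i ≤ W) ∧ (∀ i, ptIn O (l i)) ∧ c O = s ∧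
      (∀ i z z', ptIn z (l i) → ptIn z' (l i) → z ≠ O → z' ≠ O → c z = c z' → z = z') ∧
      ∀ P, ptIn P W → (∀ i, ¬ ptIn P (l i)) → c P = 0 := by
  obtain ⟨σ, f, γ, a₁, a₂, a₃, hσ, hli, hspan, hγ, hc⟩ := exists_odd_frame hT
  have hli' := Fintype.linearIndependent_iff.mp hli
  have hvec : ∀ x y z : ZMod p, ∑ i, σ (![x, y, z] i) • f i = σ x • f 0 + σ y • f 1 + σ z • f 2 := by
    intro x y z
    simp [Fin.sum_univ_three]
  have hc' : ∀ x y z : ZMod p, (x ≠ 0 ∨ y ≠ 0 ∨ z ≠ 0) →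
      c (pmk (σ x • f 0 + σ y • f 1 + σ z • f 2)) = oddValue γ a₁ a₂ a₃ ![x, y, z] := by
    intro x y z h
    rw [← hvec]
    refine hc _ fun h0 => ?_
    have e0 := congrFun h0 0
    have e1 := congrFun h0 1
    have e2 := congrFun h0 2
    simp at e0 e1 e2
    simp [e0, e1, e2] at h
  have hind : ∀ x y z : F, x • f 0 + y • f 1 + z • f 2 = 0 → x = 0 ∧ y = 0 ∧ z = 0 := by
    intro x y z h
    have := hli' ![x, y, z] (by simpa [Fin.sum_univ_three] using h)
    exact ⟨this 0, this 1, this 2⟩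
  have hf : ∀ i, f i ∈ W := fun i => hspan ▸ Submodule.subset_span ⟨i, rfl⟩
  have hf0 : f 0 ≠ 0 := hli.ne_zero 0
  have hf2 : f 2 ≠ 0 := hli.ne_zero 2
  have hcO : c (pmk (f 2)) = a₁ + a₂ + a₃ := by
    have := hc' 0 0 1 (by simp)
    simpa [oddValue] using this
  set v : Fin 3 → (Fin (n + 1) → F) := ![f 1, f 0, f 0 + f 1] with hv
  have hval : ∃ g : Fin 3 → ZMod p, ∃ d : Fin 3 → ZMod p, (∀ i, g i ≠ 0) ∧
      ∀ i t, c (pmk (v i + σ t • f 2)) = g i * t + d i := by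
    refine ⟨![γ, γ, -γ], ![a₁, a₂, a₃], ?_, ?_⟩
    · intro i
      fin_cases i <;> simpa using hγ
    · intro i t
      fin_cases i
      · have := hc' 0 1 t (by simp)
        simpa [oddValue, hv] using this
      · have := hc' 1 0 t (by simp)
        simpa [oddValue, hv] using this
      · have := hc' 1 1 t (by simp)
        simpa [oddValue, hv] using this
  obtain ⟨g, d, hg, hval⟩ := hval
  have hvind : ∀ i, ∀ a b : F, a • f 2 + b • v i = 0 → a = 0 ∧ b = 0 := by
    intro i a b h
    fin_cases i
    · have := hind 0 b a (by rw [← h]; simp [hv]; abel)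
      exact ⟨this.2.2, this.2.1⟩
    · have := hind b 0 a (by rw [← h]; simp [hv]; abel)
      exact ⟨this.2.2, this.1⟩
    · have := hind b b a (by rw [← h]; simp [hv]; abel)
      exact ⟨this.2.2, this.1⟩
  have hvW : ∀ i, v i ∈ W := by
    intro i
    fin_cases i
    · exact hf 1
    · exact hf 0
    · exact W.add_mem (hf 0) (hf 1)
  have hline : ∀ x y : Fin (n + 1) → F, (∀ a b : F, a • x + b • y = 0 → a = 0 ∧ b = 0) →
      Module.finrank F (Submodule.span F ({x, y} : Set (Fin (n + 1) → F))) = 2 := by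
    intro x y h
    have h1 := finrank_span_eq_card (LinearIndependent.pair_iff.mpr h)
    rwa [Matrix.range_cons_cons_empty, Fintype.card_fin] at h1
  set l : Fin 3 → Submodule F (Fin (n + 1) → F) := fun i => Submodule.span F {f 2, v i} with hl
  have hO : ∀ i, f 2 ∈ l i := fun i => Submodule.subset_span (by simp)
  have hvl : ∀ i, v i ∈ l i := fun i => Submodule.subset_span (by simp)
  have hmeml : ∀ i x, x ∈ l i ↔ ∃ a b : F, a • f 2 + b • v i = x := fun i x =>
    Submodule.mem_span_pair
  have hl2 : ∀ i, Module.finrank F (l i) = 2 := fun i => hline _ _ (hvind i)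
  have hpts : ∀ i z, ptIn z (l i) → z ≠ pmk (f 2) → ∃ t, z = pmk (v i + σ t • f 2) := by
    intro i z hz hzO
    obtain ⟨-, -, heq⟩ := pts_line_param (hl2 i) (hO i) (hvl i) (hvind i)
    have : z ∈ pts (l i) := mem_pts.mpr hz
    rw [heq, Finset.mem_insert, Finset.mem_image] at this
    rcases this with h | ⟨t, -, rfl⟩
    · exact absurd h hzO
    · obtain ⟨τ, rfl⟩ := hσ t
      exact ⟨τ, rfl⟩
  have hsum : a₁ + a₂ + a₃ = s := by
    have hi : ∀ a b : F, a • f 1 + b • f 0 = 0 → a = 0 ∧ b = 0 := by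
      intro a b h
      have := hind b a 0 (by rw [← h]; simp; abel)
      exact ⟨this.2.1, this.1⟩
    have h1 := hs _ (hline _ _ hi)
    rw [sum_pts_line_param c (hline _ _ hi) (Submodule.subset_span (by simp))
      (Submodule.subset_span (by simp)) hi] at h1
    have h2 : c (pmk (f 1)) = a₁ := by
      have := hc' 0 1 0 (by simp)
      simpa [oddValue] using this
    have hbij : Function.Bijective σ := ⟨σ.injective, hσ⟩
    have h3 : ∑ t : F, c (pmk (f 0 + t • f 1)) = ∑ t : ZMod p, c (pmk (f 0 + σ t • f 1)) :=
      (Equiv.sum_comp (Equiv.ofBijective σ hbij) fun t => c (pmk (f 0 + t • f 1))).symm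
    have h4 : ∀ t : ZMod p, c (pmk (f 0 + σ t • f 1)) =
        (if t = 0 then a₂ else 0) + (if t = 1 then a₃ else 0) := by
      intro t
      have := hc' 1 t 0 (by simp)
      simp only [map_one, map_zero, one_smul, zero_smul, add_zero] at this
      rw [this]
      by_cases h0 : t = 0
      · simp [oddValue, h0]
      · by_cases h1 : t = 1
        · simp [oddValue, h1]
        · simp [oddValue, h0, h1, Ne.symm h1]
    rw [h2, h3, Finset.sum_congr rfl fun t _ => h4 t, Finset.sum_add_distrib,
      Finset.sum_ite_eq', Finset.sum_ite_eq'] at h1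
    simp only [Finset.mem_univ, if_true] at h1
    rw [← h1]
    ring
  refine ⟨l, pmk (f 2), ?_, hl2, ?_, ?_, hcO.trans hsum, ?_, ?_⟩
  · intro i j hij
    have h1 : v i ∈ l j := by rw [← hij]; exact hvl i
    obtain ⟨a, b, hab⟩ := (hmeml j _).mp h1
    by_contra hne
    revert hab
    fin_cases i <;> fin_cases j <;> simp [hv] at hne ⊢ <;> intro h
    · have := hind b (-1) a (by rw [← sub_eq_zero] at h; rw [← h]; module)
      simp at this
    · have := hind b (b - 1) a (by rw [← sub_eq_zero] at h; rw [← h]; module)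
      have h5 := this.2.1
      simp [this.1] at h5
    · have := hind (-1) b a (by rw [← sub_eq_zero] at h; rw [← h]; module)
      simp at this
    · have := hind (b - 1) b a (by rw [← sub_eq_zero] at h; rw [← h]; module)
      have h5 := this.1
      simp [this.2.1] at h5
    · have := hind (-1) (b - 1) a (by rw [← sub_eq_zero] at h; rw [← h]; module)
      simp at this
    · have := hind (b - 1) (-1) a (by rw [← sub_eq_zero] at h; rw [← h]; module)
      simp at this
  · intro i
    rw [hl, Submodule.span_le]
    rintro x (rfl | rfl)
    · exact hf 2
    · exact hvW i
  · intro i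
    rw [ptIn_pmk hf2]
    exact hO i
  · intro i z z' hz hz' hzO hzO' hcz
    obtain ⟨t, rfl⟩ := hpts i z hz hzO
    obtain ⟨t', rfl⟩ := hpts i z' hz' hzO'
    rw [hval, hval, add_left_inj, mul_right_inj' (hg i)] at hcz
    rw [hcz]
  · intro P hP hPl
    have h1 : P.rep ∈ Submodule.span F (Set.range f) := by rw [hspan]; exact ptIn_iff_rep.mp hP
    obtain ⟨t, ht⟩ := (Submodule.mem_span_range_iff_exists_fun F).mp h1
    choose τ hτ using fun j => hσ (t j)
    have hrep : P.rep = σ (τ 0) • f 0 + σ (τ 1) • f 1 + σ (τ 2) • f 2 := by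
      rw [← ht, Fin.sum_univ_three]
      simp only [hτ]
    have n0 : τ 0 ≠ 0 := by
      intro h
      refine hPl 0 (ptIn_iff_rep.mpr ((hmeml 0 _).mpr ⟨σ (τ 2), σ (τ 1), ?_⟩))
      rw [hrep, h]; simp [hv]; abel
    have n1 : τ 1 ≠ 0 := by
      intro h
      refine hPl 1 (ptIn_iff_rep.mpr ((hmeml 1 _).mpr ⟨σ (τ 2), σ (τ 0), ?_⟩))
      rw [hrep, h]; simp [hv]; abel
    have n2 : τ 0 ≠ τ 1 := by
      intro h
      refine hPl 2 (ptIn_iff_rep.mpr ((hmeml 2 _).mpr ⟨σ (τ 2), σ (τ 0), ?_⟩))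
      rw [hrep, h]; simp [hv]; abel
    have := hc' (τ 0) (τ 1) (τ 2) (Or.inl n0)
    rw [← hrep, pmk_rep] at this
    rw [this]
    simp [oddValue, n0, n1, n2]

theorem sum_line_of_injective [Fintype F] {M : Type} [AddCommMonoid M] (f : ZMod p → M)
    {c : Pt F n → ZMod p} (hcard : Fintype.card F = p) {l : Submodule F (Fin (n + 1) → F)}
    (hl : Module.finrank F l = 2) {O : Pt F n} (hO : ptIn O l)
    (hinj : ∀ z z', ptIn z l → ptIn z' l → z ≠ O → z' ≠ O → c z = c z' → z = z') :
    ∑ P ∈ pts l, f (c P) = f (c O) + ∑ t : ZMod p, f t := by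
  rw [← Finset.add_sum_erase _ _ (mem_pts.mpr hO)]
  congr 1
  have hinj' : Set.InjOn c ((pts l).erase O : Finset (Pt F n)) := by
    intro z hz z' hz' h
    simp only [Finset.coe_erase, Set.mem_sdiff, Finset.mem_coe, mem_pts,
      Set.mem_singleton_iff] at hz hz'
    exact hinj z z' hz.1 hz'.1 hz.2 hz'.2 h
  have himg : ((pts l).erase O).image c = Finset.univ := by
    rw [← Finset.card_eq_iff_eq_univ, Finset.card_image_of_injOn hinj',
      Finset.card_erase_of_mem (mem_pts.mpr hO), card_pts_line hl, ZMod.card, hcard,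
      Nat.add_sub_cancel]
  rw [← himg, Finset.sum_image hinj']

theorem wtRes_odd [Fintype F] {c : Pt F n → ZMod p} {s : ZMod p}
    (hs : ∀ l : Submodule F (Fin (n + 1) → F), Module.finrank F l = 2 → ∑ P ∈ pts l, c P = s)
    {W : Submodule F (Fin (n + 1) → F)} (hT : TypeOdd p c W) :
    p ≠ 2 ∧ wtRes c W = 3 * (p - 1) + ind s := by
  obtain ⟨l, O, hlinj, hl, hlW, hO, hcO, hinj, h0⟩ := exists_odd_lines hs hT
  have hcard := hT.1
  constructor
  · rintro rfl
    have h1 := sum_line_of_injective (fun t => t) hcard (hl 0) (hO 0) (hinj 0)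
    rw [hs _ (hl 0), hcO] at h1
    have h3 : ∀ t : ZMod 2, t = 0 ∨ t = 1 := eq_zero_or_eq_one
    have h4 : (Finset.univ : Finset (ZMod 2)) = {0, 1} := by
      ext t
      simpa using h3 t
    have h2 : ∑ t : ZMod 2, t = 1 := by
      rw [h4, Finset.sum_pair zero_ne_one, zero_add]
    rw [h2] at h1
    simp at h1
  · have hw : ∀ i, wtRes c (l i) = ind s + (p - 1) := by
      intro i
      rw [wtRes_eq_sum, sum_line_of_injective ind hcard (hl i) (hO i) (hinj i), hcO]
      congr 1
      have : ∀ t : ZMod p, ind t = if t ∈ Finset.univ.erase (0 : ZMod p) then 1 else 0 := by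
        intro t
        by_cases h : t = 0
        · simp [h, ind_zero]
        · simp [h, ind_of_ne h]
      simp only [this]
      rw [Finset.sum_ite_mem, Finset.univ_inter, Finset.sum_const, smul_eq_mul, mul_one,
        Finset.card_erase_of_mem (Finset.mem_univ _), Finset.card_univ, ZMod.card]
    have := wtRes_concurrent (hl 0) (hl 1) (hl 2) (hlW 0) (hlW 1) (hlW 2)
      (fun h => by simpa using hlinj h) (fun h => by simpa using hlinj h)
      (fun h => by simpa using hlinj h) (hO 0) (hO 1) (hO 2) (c := c)
      (fun P hP k0 k1 k2 => h0 P hP fun i => by fin_cases i <;> assumption)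
    rw [hw, hw, hw, hcO] at this
    omega

end Odd

section Cones

variable {n p : ℕ} {κ π : Submodule F (Fin (n + 1) → F)}

theorem sup_inf_eq_of_disjoint (hd : π ⊓ κ = ⊥) {l : Submodule F (Fin (n + 1) → F)} (hl : l ≤ π) :
    (κ ⊔ l) ⊓ π = l := by
  rw [sup_comm, sup_inf_assoc_of_le κ hl, inf_comm, hd, sup_bot_eq]

theorem not_ptIn_of_disjoint (hd : π ⊓ κ = ⊥) {Q : Pt F n} (hQ : ptIn Q π) : ¬ ptIn Q κ := by
  intro h
  have h1 : Q.submodule ≤ ⊥ := hd ▸ le_inf hQ h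
  have h2 := Q.finrank_submodule
  rw [le_bot_iff.mp h1, finrank_bot] at h2
  exact zero_ne_one h2

theorem eq_of_ptIn_cone (hd : π ⊓ κ = ⊥) {Q Q' : Pt F n} (hQ : ptIn Q π) (hQ' : ptIn Q' π)
    (h : ptIn Q (κ ⊔ Q'.submodule)) : Q = Q' := by
  rw [← ptIn_submodule, ← sup_inf_eq_of_disjoint hd hQ']
  exact le_inf h hQ

theorem sup_eq_sup_of_ptIn {P Q : Pt F n} (hP : ¬ ptIn P κ) (hQ : ¬ ptIn Q κ)
    (h : ptIn Q (κ ⊔ P.submodule)) : κ ⊔ Q.submodule = κ ⊔ P.submodule :=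
  Submodule.eq_of_le_of_finrank_eq (sup_le le_sup_left h)
    (by rw [finrank_sup_pt hP, finrank_sup_pt hQ])

/-- The word `c` is, on `S`, a cone with vertex `κ` over its restriction to the plane `π`. -/
structure IsCone (c : Pt F n → ZMod p) (S κ π : Submodule F (Fin (n + 1) → F)) : Prop where
  vertex_le : κ ≤ S
  base_le : π ≤ S
  finrank_base : Module.finrank F π = 3
  disjoint : π ⊓ κ = ⊥
  const : ∃ a, ∀ P, ptIn P κ → c P = a
  value : ∀ P : Pt F n, ptIn P S → ¬ ptIn P κ →
    ∃ Q : Pt F n, ptIn Q π ∧ Q.submodule ≤ κ ⊔ P.submodule ∧ c P = c Q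

namespace IsCone

variable {c : Pt F n → ZMod p} {S : Submodule F (Fin (n + 1) → F)}

theorem value_eq (H : IsCone c S κ π) {P Q : Pt F n} (hPκ : ¬ ptIn P κ)
    (hQ : ptIn Q π) (hPQ : ptIn P (κ ⊔ Q.submodule)) : c P = c Q := by
  have hPS : ptIn P S := le_trans hPQ (sup_le H.vertex_le (le_trans hQ H.base_le))
  obtain ⟨Q', hQ', hle, hc⟩ := H.value P hPS hPκ
  have h1 := sup_eq_sup_of_ptIn (not_ptIn_of_disjoint H.disjoint hQ) hPκ hPQ
  rw [h1] at hle
  rw [hc, eq_of_ptIn_cone H.disjoint hQ' hQ hle]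

theorem exists_base (H : IsCone c S κ π) {P : Pt F n} (hP : ptIn P S) (hPκ : ¬ ptIn P κ) :
    ∃ Q : Pt F n, ptIn Q π ∧ κ ⊔ Q.submodule = κ ⊔ P.submodule ∧ c P = c Q := by
  obtain ⟨Q, hQ, hle, hc⟩ := H.value P hP hPκ
  exact ⟨Q, hQ, sup_eq_sup_of_ptIn hPκ (not_ptIn_of_disjoint H.disjoint hQ) hle, hc⟩

variable [Fintype F]

theorem vertex_value (H : IsCone c S κ π) (hp : (Fintype.card F : ZMod p) = 0) {s : ZMod p}
    (hs : ∀ l : Submodule F (Fin (n + 1) → F), Module.finrank F l = 2 → ∑ P ∈ pts l, c P = s)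
    {P : Pt F n} (hP : ptIn P κ) : c P = s := by
  obtain ⟨a, ha⟩ := H.const
  obtain ⟨Q, hQ⟩ : (pts π).Nonempty := by
    rw [← Finset.card_pos, card_pts, H.finrank_base]
    simp [Finset.sum_range_succ]
  rw [mem_pts] at hQ
  have hQκ := not_ptIn_of_disjoint H.disjoint hQ
  have hne : P ≠ Q := fun h => hQκ (h ▸ hP)
  have h1 := hs _ (finrank_join hne)
  have hPl : ptIn P (P.submodule ⊔ Q.submodule) := le_sup_left (a := P.submodule)
  have hQl : ptIn Q (P.submodule ⊔ Q.submodule) := le_sup_right (a := P.submodule)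
  rw [sum_pts_eq_of_const_off c (finrank_join hne) hPl (a := c Q), nsmul_eq_mul, hp, zero_mul,
    add_zero] at h1
  · exact h1
  · intro X hX hXP
    refine H.value_eq (fun hXκ => ?_) hQ (le_trans hX (sup_le_sup_right hP _))
    rw [line_eq_join (finrank_join hne) hXP hX hPl] at hQl
    exact hQκ (le_trans hQl (sup_le hXκ hP))

theorem wtRes_eq (H : IsCone c S κ π) (hp : (Fintype.card F : ZMod p) = 0) {s : ZMod p}
    (hs : ∀ l : Submodule F (Fin (n + 1) → F), Module.finrank F l = 2 → ∑ P ∈ pts l, c P = s) :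
    wtRes c S = (pts κ).card * ind s + Fintype.card F ^ Module.finrank F κ * wtRes c π := by
  simp only [wtRes_eq_sum]
  have hsub : pts κ ⊆ pts S := fun P hP => mem_pts.mpr (ptIn_mono H.vertex_le (mem_pts.mp hP))
  rw [← Finset.sum_sdiff hsub, add_comm]
  congr 1
  · rw [Finset.sum_congr rfl fun P hP => by rw [H.vertex_value hp hs (mem_pts.mp hP)],
      Finset.sum_const, smul_eq_mul]
  · have hex : ∀ P : Pt F n, ∃ Q : Pt F n, P ∈ pts S \ pts κ →
        ptIn Q π ∧ κ ⊔ Q.submodule = κ ⊔ P.submodule ∧ c P = c Q := by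
      intro P
      by_cases hP : P ∈ pts S \ pts κ
      · rw [Finset.mem_sdiff, mem_pts, mem_pts] at hP
        obtain ⟨Q, hQ⟩ := H.exists_base hP.1 hP.2
        exact ⟨Q, fun _ => hQ⟩
      · exact ⟨P, fun h => absurd h hP⟩
    choose f hf using hex
    rw [← Finset.sum_fiberwise_of_maps_to (s := pts S \ pts κ) (t := pts π) (g := f)
      fun P hP => mem_pts.mpr (hf P hP).1, Finset.mul_sum]
    refine Finset.sum_congr rfl fun Q hQ => ?_
    rw [mem_pts] at hQ
    have hQκ := not_ptIn_of_disjoint H.disjoint hQ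
    have hfib : (pts S \ pts κ).filter (fun P => f P = Q) = pts (κ ⊔ Q.submodule) \ pts κ := by
      ext P
      simp only [Finset.mem_filter]
      constructor
      · rintro ⟨hP, rfl⟩
        have h1 := hf P hP
        rw [Finset.mem_sdiff] at hP ⊢
        refine ⟨mem_pts.mpr ?_, hP.2⟩
        rw [h1.2.1]
        exact le_sup_right (a := κ)
      · intro hP
        rw [Finset.mem_sdiff, mem_pts, mem_pts] at hP
        have hPS : P ∈ pts S \ pts κ := by
          rw [Finset.mem_sdiff, mem_pts, mem_pts]
          exact ⟨le_trans hP.1 (sup_le H.vertex_le (le_trans hQ H.base_le)), hP.2⟩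
        refine ⟨hPS, ?_⟩
        have h1 := hf P hPS
        refine eq_of_ptIn_cone H.disjoint h1.1 hQ ?_
        have h2 : ptIn (f P) (κ ⊔ P.submodule) := h1.2.1 ▸ le_sup_right (a := κ)
        exact le_trans h2 (sup_le le_sup_left hP.1)
    have hval : ∀ P ∈ (pts S \ pts κ).filter (fun P => f P = Q), ind (c P) = ind (c Q) := by
      intro P hP
      rw [Finset.mem_filter] at hP
      rw [(hf P hP.1).2.2, hP.2]
    rw [Finset.sum_congr rfl hval, Finset.sum_const, hfib, smul_eq_mul,
      Finset.card_sdiff_of_subset fun P hP =>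
        mem_pts.mpr (ptIn_mono le_sup_left (mem_pts.mp hP)), card_pts, card_pts,
      finrank_sup_pt hQκ, Finset.sum_range_succ, Nat.add_sub_cancel_left]

end IsCone

/-- Values of a word on a line not contained in any of three weighted hyperplanes. -/
theorem line_values [Fintype F] {c : Pt F n → ZMod p} {l : Submodule F (Fin (n + 1) → F)}
    (hl : Module.finrank F l = 2) (hq : 5 ≤ Fintype.card F) (hw : wtRes c l = 3)
    {H₁ H₂ H₃ : Submodule F (Fin (n + 1) → F)}
    (m₁ : ∃ X, ptIn X (l ⊓ H₁)) (m₂ : ∃ X, ptIn X (l ⊓ H₂)) (m₃ : ∃ X, ptIn X (l ⊓ H₃))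
    {a₁ a₂ a₃ s : ZMod p} (ha₁ : a₁ ≠ 0) (ha₂ : a₂ ≠ 0) (ha₃ : a₃ ≠ 0)
    (hc : ∀ P, ptIn P l → c P = a₁ * incVec p H₁ P + a₂ * incVec p H₂ P + a₃ * incVec p H₃ P) :
    ∑ P ∈ pts l, ind (c P) * ind (s - c P) = ind (s - a₁) + ind (s - a₂) + ind (s - a₃) := by
  have one : ∀ {H : Submodule F (Fin (n + 1) → F)}, (∃ X, ptIn X (l ⊓ H)) →
      ∃ X, ptIn X l ∧ ptIn X H ∧ ∀ P, ptIn P l → (ptIn P H ↔ l ≤ H ∨ P = X) := by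
    rintro H ⟨X, hX⟩
    rw [ptIn_inf] at hX
    refine ⟨X, hX.1, hX.2, fun P hP => ⟨fun hPH => ?_, ?_⟩⟩
    · by_cases h : P = X
      · exact Or.inr h
      · left
        rw [line_eq_join hl h hP hX.1]
        exact sup_le hPH hX.2
    · rintro (h | rfl)
      · exact le_trans hP h
      · exact hX.2
  obtain ⟨X₁, hX₁l, -, h₁⟩ := one m₁
  obtain ⟨X₂, hX₂l, -, h₂⟩ := one m₂
  obtain ⟨X₃, hX₃l, -, h₃⟩ := one m₃
  have many : ∀ (Y Z : Pt F n) (g : ZMod p), (∀ P, ptIn P l → P ≠ Y → P ≠ Z → c P = g) →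
      (g = 0 → wtRes c l ≤ ({Y, Z} : Finset (Pt F n)).card) ∧ (g ≠ 0 → 4 ≤ wtRes c l) := by
    intro Y Z g h
    have hcardYZ : ({Y, Z} : Finset (Pt F n)).card ≤ 2 := Finset.card_le_two
    constructor
    · intro hg
      rw [wtRes_eq_sum, Finset.card_eq_sum_ones, ← Finset.sum_subset
        (Finset.inter_subset_left (s₂ := {Y, Z}))]
      · refine (Finset.sum_le_sum fun P _ => ind_le_one _).trans ?_
        exact Finset.sum_le_sum_of_subset Finset.inter_subset_right
      · intro P hP hP'
        simp only [Finset.mem_inter, hP, true_and, Finset.mem_insert, Finset.mem_singleton,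
          not_or] at hP'
        rw [h P (mem_pts.mp hP) hP'.1 hP'.2, hg, ind_zero]
    · intro hg
      have h1 : (pts l \ {Y, Z}).card ≤ wtRes c l := by
        rw [wtRes_eq_sum, Finset.card_eq_sum_ones]
        refine le_trans (Finset.sum_le_sum fun P hP => ?_)
          (Finset.sum_le_sum_of_subset Finset.sdiff_subset)
        simp only [Finset.mem_sdiff, mem_pts, Finset.mem_insert, Finset.mem_singleton,
          not_or] at hP
        rw [h P hP.1 hP.2.1 hP.2.2, ind_of_ne hg]
      have h2 := Finset.le_card_sdiff ({Y, Z} : Finset (Pt F n)) (pts l)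
      rw [card_pts_line hl] at h2
      omega
  have pair : ∀ (Y Z : Pt F n), ({Y, Z} : Finset (Pt F n)).card ≤ 2 := fun _ _ =>
    Finset.card_le_two
  have hc' : ∀ P, ptIn P l → c P = a₁ * (if l ≤ H₁ ∨ P = X₁ then 1 else 0) +
      a₂ * (if l ≤ H₂ ∨ P = X₂ then 1 else 0) + a₃ * (if l ≤ H₃ ∨ P = X₃ then 1 else 0) := by
    intro P hP
    rw [hc P hP]
    simp only [incVec, h₁ P hP, h₂ P hP, h₃ P hP]
  have contra : ∀ (Y Z : Pt F n) (g : ZMod p), (∀ P, ptIn P l → P ≠ Y → P ≠ Z → c P = g) →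
      False := by
    intro Y Z g h
    by_cases hg : g = 0
    · have := (many Y Z g h).1 hg
      have := pair Y Z
      omega
    · have := (many Y Z g h).2 hg
      omega
  have n1 : ¬ l ≤ H₁ := fun h => contra X₂ X₃ (a₁ + a₂ * (if l ≤ H₂ then 1 else 0) +
    a₃ * (if l ≤ H₃ then 1 else 0)) fun P hP k2 k3 => by
      rw [hc' P hP]; simp [h, k2, k3]
  have n2 : ¬ l ≤ H₂ := fun h => contra X₁ X₃ (a₁ * (if l ≤ H₁ then 1 else 0) + a₂ +
    a₃ * (if l ≤ H₃ then 1 else 0)) fun P hP k2 k3 => by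
      rw [hc' P hP]; simp [h, k2, k3]
  have n3 : ¬ l ≤ H₃ := fun h => contra X₁ X₂ (a₁ * (if l ≤ H₁ then 1 else 0) +
    a₂ * (if l ≤ H₂ then 1 else 0) + a₃) fun P hP k2 k3 => by
      rw [hc' P hP]; simp [h, k2, k3]
  simp only [n1, n2, n3, false_or] at hc'
  have x12 : X₁ ≠ X₂ := by
    rintro rfl
    exact contra X₁ X₃ 0 fun P hP k2 k3 => by rw [hc' P hP]; simp [k2, k3]
  have x13 : X₁ ≠ X₃ := by
    rintro rfl
    exact contra X₁ X₂ 0 fun P hP k2 k3 => by rw [hc' P hP]; simp [k2, k3]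
  have x23 : X₂ ≠ X₃ := by
    rintro rfl
    exact contra X₁ X₂ 0 fun P hP k2 k3 => by rw [hc' P hP]; simp [k2, k3]
  have hsub : ({X₁, X₂, X₃} : Finset (Pt F n)) ⊆ pts l := by
    intro P hP
    simp only [Finset.mem_insert, Finset.mem_singleton] at hP
    rw [mem_pts]
    rcases hP with rfl | rfl | rfl <;> assumption
  rw [← Finset.sum_subset hsub]
  · have e1 : c X₁ = a₁ := by rw [hc' X₁ hX₁l]; simp [x12, x13]
    have e2 : c X₂ = a₂ := by rw [hc' X₂ hX₂l]; simp [x12.symm, x23]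
    have e3 : c X₃ = a₃ := by rw [hc' X₃ hX₃l]; simp [x13.symm, x23.symm]
    rw [Finset.sum_insert (by simp [x12, x13]), Finset.sum_pair x23, e1, e2, e3, ind_of_ne ha₁,
      ind_of_ne ha₂, ind_of_ne ha₃]
    ring
  · intro P hP hP'
    simp only [Finset.mem_insert, Finset.mem_singleton, not_or] at hP'
    rw [hc' P (mem_pts.mp hP)]
    simp [hP'.1, hP'.2.1, hP'.2.2, ind_zero]

/-- The type of a triangle cone can be read off from any of its `3`-secants. -/
theorem IsCone.line_values_of_triangle [Fintype F] {c : Pt F n → ZMod p}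
    {S : Submodule F (Fin (n + 1) → F)} (H : IsCone c S κ π)
    (hp : (Fintype.card F : ZMod p) = 0) {s : ZMod p}
    (hs : ∀ l : Submodule F (Fin (n + 1) → F), Module.finrank F l = 2 → ∑ P ∈ pts l, c P = s)
    (hS : Module.finrank F S = Module.finrank F κ + 3)
    {l : Submodule F (Fin (n + 1) → F)} (hl : Module.finrank F l = 2) (hlS : l ≤ S)
    (hq : 5 ≤ Fintype.card F) (hw : wtRes c l = 3)
    {l₁ l₂ l₃ : Submodule F (Fin (n + 1) → F)} (h₁ : IsLine l₁) (h₂ : IsLine l₂) (h₃ : IsLine l₃)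
    (hW₁ : l₁ ≤ π) (hW₂ : l₂ ≤ π) (hW₃ : l₃ ≤ π)
    {a₁ a₂ a₃ : ZMod p} (ha₁ : a₁ ≠ 0) (ha₂ : a₂ ≠ 0) (ha₃ : a₃ ≠ 0) (hsum : s = a₁ + a₂ + a₃)
    (hc : ∀ P : Pt F n, ptIn P π →
        c P = a₁ * incVec p l₁ P + a₂ * incVec p l₂ P + a₃ * incVec p l₃ P) :
    ∑ P ∈ pts l, ind (c P) * ind (s - c P) = ind (s - a₁) + ind (s - a₂) + ind (s - a₃) := by
  have hmeet : ∀ {m : Submodule F (Fin (n + 1) → F)}, IsLine m → m ≤ π →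
      ∃ X : Pt F n, ptIn X (l ⊓ (κ ⊔ m)) := by
    intro m hm hmπ
    have d1 : κ ⊓ m = ⊥ := by
      rw [eq_bot_iff, ← H.disjoint, inf_comm π]
      exact inf_le_inf_left _ hmπ
    have d2 := Submodule.finrank_sup_add_finrank_inf_eq κ m
    rw [d1, finrank_bot, hm] at d2
    have d3 := Submodule.finrank_sup_add_finrank_inf_eq l (κ ⊔ m)
    have d4 : Module.finrank F ↥(l ⊔ (κ ⊔ m)) ≤ Module.finrank F S :=
      Submodule.finrank_mono (sup_le hlS (sup_le H.vertex_le (hmπ.trans H.base_le)))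
    have d5 : 0 < (pts (l ⊓ (κ ⊔ m))).card := by
      rw [card_pts]
      refine Finset.sum_pos (fun i _ => pow_pos Fintype.card_pos i) ?_
      rw [Finset.nonempty_range_iff]
      omega
    obtain ⟨X, hX⟩ := Finset.card_pos.mp d5
    exact ⟨X, mem_pts.mp hX⟩
  refine line_values hl hq hw (hmeet h₁ hW₁) (hmeet h₂ hW₂) (hmeet h₃ hW₃) ha₁ ha₂ ha₃ ?_
  intro P hP
  by_cases hPκ : ptIn P κ
  · have k : ∀ m : Submodule F (Fin (n + 1) → F), incVec p (κ ⊔ m) P = 1 := fun m =>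
      if_pos (ptIn_mono le_sup_left hPκ)
    rw [H.vertex_value hp hs hPκ, k, k, k, hsum]
    ring
  · obtain ⟨Q, hQ, hsup, hval⟩ := H.exists_base (ptIn_mono hlS hP) hPκ
    have k : ∀ {m : Submodule F (Fin (n + 1) → F)}, m ≤ π →
        incVec p m Q = incVec p (κ ⊔ m) P := by
      intro m hm
      have : ptIn P (κ ⊔ m) ↔ ptIn Q m := by
        constructor
        · intro h
          have h1 : ptIn Q (κ ⊔ m) := by
            have h2 : ptIn Q (κ ⊔ P.submodule) := hsup ▸ le_sup_right (a := κ)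
            exact le_trans h2 (sup_le le_sup_left h)
          have h3 := le_inf h1 hQ
          rwa [sup_inf_eq_of_disjoint H.disjoint hm] at h3
        · intro h
          have h2 : ptIn P (κ ⊔ Q.submodule) := hsup.symm ▸ le_sup_right (a := κ)
          exact le_trans h2 (sup_le_sup_left h _)
      simp only [incVec, this]
    rw [hval, hc Q hQ, k hW₁, k hW₂, k hW₃]

end Cones

section TwoSecants

namespace PlaneWord

variable {P K : Type} [Field K] {Ω : Finset P} {𝓛 : Finset (Finset P)} {q : ℕ} {c : P → K} {s : K}

theorem le_card_offSupp (H : PlaneWord Ω 𝓛 q c s) (hq : 0 < q) {l : Finset P} (hl : l ∈ 𝓛) {Z : P}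
    (hZ : Z ∈ l) (hZs : c Z ≠ s) :
    q ≤ (offSupp Ω c l).card ∧
      ((offSupp Ω c l).card ≤ q → ∀ t ∈ offSupp Ω c l, c t = s - c Z) := by
  set R := offSupp Ω c l with hR
  have hRΩ : R ⊆ Ω := Finset.filter_subset _ _
  have hZR : Z ∉ R := by simp [hR, offSupp, hZ]
  have hZΩ := H.sub _ hl hZ
  have hsum := H.sum_pencil hZΩ hRΩ hZR
  have hpen := H.card_pencil hq hZΩ
  have hoff : ∀ m ∈ 𝓛, Z ∈ m → m ≠ l → ∀ x ∈ m, x ≠ Z → c x ≠ 0 →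
      x ∈ R.filter fun x => x ∈ m := by
    intro m hm hZm hne x hx hxZ hcx
    exact Finset.mem_filter.mpr ⟨Finset.mem_filter.mpr ⟨H.sub _ hm hx, fun hxl => hne
      (H.line_unique hm hl hxZ hx hZm hxl hZ), hcx⟩, hx⟩
  have hpos : ∀ m ∈ (𝓛.filter fun m => Z ∈ m).erase l, 1 ≤ (R.filter fun x => x ∈ m).card := by
    intro m hm
    rw [Finset.mem_erase, Finset.mem_filter] at hm
    obtain ⟨hne, hm, hZm⟩ := hm
    rw [Nat.one_le_iff_ne_zero]
    intro h0
    rw [Finset.card_eq_zero] at h0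
    refine hZs ?_
    rw [← H.sum m hm]
    refine (Finset.sum_eq_single_of_mem Z hZm fun x hx hxZ => ?_).symm
    by_contra hcx
    have := hoff m hm hZm hne x hx hxZ hcx
    rw [h0] at this
    exact Finset.notMem_empty x this
  have hlpen : l ∈ 𝓛.filter fun m => Z ∈ m := Finset.mem_filter.mpr ⟨hl, hZ⟩
  have hpen' : ((𝓛.filter fun m => Z ∈ m).erase l).card = q := by
    rw [Finset.card_erase_of_mem hlpen, hpen, Nat.add_sub_cancel]
  have hle : ∑ m ∈ (𝓛.filter fun m => Z ∈ m).erase l, (R.filter fun x => x ∈ m).card ≤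
      R.card := by
    rw [← hsum]
    exact Finset.sum_le_sum_of_subset (Finset.erase_subset _ _)
  refine ⟨?_, fun hRq t ht => ?_⟩
  · refine le_trans ?_ hle
    rw [← hpen', Finset.card_eq_sum_ones]
    exact Finset.sum_le_sum hpos
  · by_contra hct
    have ht' := Finset.mem_filter.mp ht
    have hZt : Z ≠ t := fun h => hZR (h ▸ ht)
    obtain ⟨m, hm, hZm, htm⟩ := H.join Z hZΩ t (hRΩ ht) hZt
    have hne : m ≠ l := fun h => ht'.2.1 (h ▸ htm)
    have hmpen : m ∈ (𝓛.filter fun m => Z ∈ m).erase l :=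
      Finset.mem_erase.mpr ⟨hne, Finset.mem_filter.mpr ⟨hm, hZm⟩⟩
    have h2 : 2 ≤ (R.filter fun x => x ∈ m).card := by
      by_contra h
      have h1 := hpos m hmpen
      refine hct ?_
      rw [← H.add_eq_of_two hm hZt hZm htm fun z hz hzZ hzt => ?_]
      · ring
      · by_contra hcz
        exact hzt (Finset.card_le_one.mp (by omega) z (hoff m hm hZm hne z hz hzZ hcz) t
          (Finset.mem_filter.mpr ⟨ht, htm⟩))
    have h3 : ∑ m' ∈ (𝓛.filter fun m => Z ∈ m).erase l, (1 + if m' = m then 1 else 0) ≤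
        ∑ m ∈ (𝓛.filter fun m => Z ∈ m).erase l, (R.filter fun x => x ∈ m).card := by
      refine Finset.sum_le_sum fun m' hm' => ?_
      split_ifs with h
      · rw [h]; exact h2
      · exact hpos m' hm'
    rw [Finset.sum_add_distrib, Finset.sum_ite_eq' _ m, if_pos hmpen, ← Finset.card_eq_sum_ones,
      hpen'] at h3
    omega

theorem lt_card_offSupp_of_two (H : PlaneWord Ω 𝓛 q c s) (hq : 0 < q) (h2 : (2 : K) ≠ 0)
    {l : Finset P} (hl : l ∈ 𝓛) {X Y Z : P} (hXY : X ≠ Y) (hX : X ∈ l) (hY : Y ∈ l) (hZ : Z ∈ l)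
    (hcX : c X ≠ 0) (hcY : c Y ≠ 0) (hcZ : c Z = 0)
    (h : ∀ z ∈ l, z ≠ X → z ≠ Y → c z = 0) : q < (offSupp Ω c l).card := by
  by_contra hcon
  rw [not_lt] at hcon
  have hs := H.add_eq_of_two hl hXY hX hY h
  have k1 := H.le_card_offSupp hq hl hX fun e => hcY (by linear_combination hs - e)
  have k2 := H.le_card_offSupp hq hl hY fun e => hcX (by linear_combination hs - e)
  obtain ⟨t, ht⟩ := Finset.card_pos.mp (hq.trans_le k1.1)
  have e1 := k1.2 hcon t ht
  have e2 := k2.2 hcon t ht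
  have e3 : c X = c Y := by linear_combination e1 - e2
  have e4 : s = 2 * c X := by linear_combination -hs - e3
  have hZs : c Z ≠ s := by
    rw [hcZ, e4]
    exact (mul_ne_zero h2 hcX).symm
  have e5 := (H.le_card_offSupp hq hl hZ hZs).2 hcon t ht
  exact hcX (by linear_combination e1 - e5 + hcZ)

end PlaneWord

variable [Fintype F] {n p : ℕ} [Fact p.Prime]

/-- Every plane through a `2`-secant contains many further support points. -/
theorem lt_wt_of_two_secant (h2 : (2 : ZMod p) ≠ 0) (hn : 1 ≤ n) {c : Pt F n → ZMod p} {s : ZMod p}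
    (hs : ∀ l : Submodule F (Fin (n + 1) → F), Module.finrank F l = 2 → ∑ P ∈ pts l, c P = s)
    {l W : Submodule F (Fin (n + 1) → F)} (hl : Module.finrank F l = 2)
    (hW : Module.finrank F W = 3) (hlW : l ≤ W) (hwW : Fintype.card F + 4 ≤ wtRes c W)
    {X Y Z : Pt F n} (hXY : X ≠ Y) (hX : ptIn X l) (hY : ptIn Y l) (hZ : ptIn Z l)
    (hcX : c X ≠ 0) (hcY : c Y ≠ 0) (hcZ : c Z = 0)
    (h : ∀ P, ptIn P l → P ≠ X → P ≠ Y → c P = 0) :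
    (Fintype.card F + 1) * ∑ i ∈ Finset.range (n - 1), Fintype.card F ^ i + 2 < wt c := by
  have hsplit : ∀ T : Finset (Pt F n), pts l ⊆ T →
      (T.filter fun P => c P ≠ 0).card = 2 + (T.filter fun P => ¬ ptIn P l ∧ c P ≠ 0).card := by
    intro T hT
    have hpair : T.filter (fun P => ptIn P l ∧ c P ≠ 0) = {X, Y} := by
      ext P
      simp only [Finset.mem_filter, Finset.mem_insert, Finset.mem_singleton]
      constructor
      · rintro ⟨-, hP, hcP⟩
        by_contra hne
        rw [not_or] at hne
        exact hcP (h P hP hne.1 hne.2)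
      · rintro (rfl | rfl)
        · exact ⟨hT (mem_pts.mpr hX), hX, hcX⟩
        · exact ⟨hT (mem_pts.mpr hY), hY, hcY⟩
    rw [← Finset.card_pair hXY, ← hpair, ← Finset.card_union_of_disjoint]
    · congr 1
      ext P
      simp only [Finset.mem_union, Finset.mem_filter]
      tauto
    · rw [Finset.disjoint_filter]
      exact fun P _ h1 h2 => h2.1 h1.1
  have hWmem : W ∈ planesThrough l := Finset.mem_filter.mpr ⟨Finset.mem_univ _, hW, hlW⟩
  have hq : 0 < Fintype.card F := Fintype.card_pos
  have hge : ∀ U ∈ planesThrough l, Fintype.card F + 1 + (if U = W then 1 else 0) ≤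
      ((pts U).filter fun P => ¬ ptIn P l ∧ c P ≠ 0).card := by
    intro U hU
    simp only [planesThrough, Finset.mem_filter, Finset.mem_univ, true_and] at hU
    split_ifs with hUW
    · subst hUW
      have h1 := hsplit (pts U) fun P hP => mem_pts.mpr (ptIn_mono hU.2 (mem_pts.mp hP))
      have h3 : wtRes c U = ((pts U).filter fun P => c P ≠ 0).card := by
        rw [wtRes_eq_sum, Finset.card_filter]
        refine Finset.sum_congr rfl fun P _ => ?_
        unfold ind
        split_ifs <;> simp_all
      omega
    · have h1 := (planeWord_pts hs hU.1).lt_card_offSupp_of_two hq h2 (l := pts l)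
        (Finset.mem_image_of_mem _ (Finset.mem_filter.mpr ⟨Finset.mem_univ _, hl, hU.2⟩)) hXY
        (mem_pts.mpr hX) (mem_pts.mpr hY) (mem_pts.mpr hZ) hcX hcY hcZ
        fun z hz => h z (mem_pts.mp hz)
      simpa [PlaneWord.offSupp, mem_pts] using h1
  have hsum := Finset.sum_le_sum hge
  have hoff : (Finset.univ.filter fun P => ¬ ptIn P l ∧ c P ≠ 0).card =
      ∑ W ∈ planesThrough l, ((pts W).filter fun Q => ¬ ptIn Q l ∧ c Q ≠ 0).card := by
    convert card_filter_off_line (fun P => c P ≠ 0) hl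
  rw [← hoff, Finset.sum_add_distrib, Finset.sum_ite_eq' _ W, if_pos hWmem, Finset.sum_const,
    card_planesThrough hn hl, smul_eq_mul, mul_comm] at hsum
  rw [wt_eq_card, hsplit Finset.univ (Finset.subset_univ _)]
  omega

theorem lt_wt_of_triangle_aux (h2 : (2 : ZMod p) ≠ 0) (hn : 1 ≤ n)
    (hp : (Fintype.card F : ZMod p) = 0) {c : Pt F n → ZMod p} {s : ZMod p}
    (hs : ∀ l : Submodule F (Fin (n + 1) → F), Module.finrank F l = 2 → ∑ P ∈ pts l, c P = s)
    {W : Submodule F (Fin (n + 1) → F)} (hW : IsPlane W) (hwW : Fintype.card F + 4 ≤ wtRes c W)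
    {l₁ l₂ l₃ : Submodule F (Fin (n + 1) → F)} (h₁ : IsLine l₁) (h₂ : IsLine l₂) (h₃ : IsLine l₃)
    (hW₁ : l₁ ≤ W) (hW₂ : l₂ ≤ W) (hW₃ : l₃ ≤ W) (h12 : l₁ ≠ l₂) (h13 : l₁ ≠ l₃) (h23 : l₂ ≠ l₃)
    (hnc : ¬ ∃ P : Pt F n, ptIn P l₁ ∧ ptIn P l₂ ∧ ptIn P l₃) {a₁ a₂ a₃ : ZMod p}
    (ha₁ : a₁ ≠ 0) (ha₂₃ : a₂ + a₃ ≠ 0)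
    (hc : ∀ P : Pt F n, ptIn P W →
        c P = a₁ * incVec p l₁ P + a₂ * incVec p l₂ P + a₃ * incVec p l₃ P) :
    (Fintype.card F + 1) * ∑ i ∈ Finset.range (n - 1), Fintype.card F ^ i + 2 < wt c := by
  obtain ⟨X₂, X₃, -, hX₃, hX₂, hl₁, -, -, -⟩ :=
    exists_triangle hp hs hW h₁ h₂ h₃ hW₁ hW₂ hW₃ h12 h13 hnc hc
  obtain ⟨-, V, -, hV, -, -, hcV, -, -⟩ :=
    exists_triangle (a₁ := a₂) (a₂ := a₃) (a₃ := a₁) hp hs hW h₂ h₃ h₁ hW₂ hW₃ hW₁ h23 h12.symm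
      (fun ⟨P, h⟩ => hnc ⟨P, h.2.2, h.1, h.2.1⟩) (fun P hP => (hc P hP).trans (by ring))
  obtain ⟨hV₂, hV₃⟩ := (hV V).mpr rfl
  have hV₁ : ¬ ptIn V l₁ := fun h => hnc ⟨V, h, hV₂, hV₃⟩
  have hq : 1 < Fintype.card F := Fintype.one_lt_card
  have third : ∀ {l : Submodule F (Fin (n + 1) → F)}, IsLine l → ∀ X Y : Pt F n,
      ∃ Z, ptIn Z l ∧ Z ≠ X ∧ Z ≠ Y := by
    intro l hl X Y
    obtain ⟨Z, hZ, hne⟩ := Finset.exists_mem_notMem_of_card_lt_card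
      (show ({X, Y} : Finset (Pt F n)).card < (pts l).card by
        rw [card_pts_line hl]
        exact Finset.card_le_two.trans_lt (by omega))
    rw [Finset.mem_insert, Finset.mem_singleton, not_or] at hne
    exact ⟨Z, mem_pts.mp hZ, hne.1, hne.2⟩
  obtain ⟨N, hN, hN₂, hN₃⟩ := third h₁ X₂ X₃
  have hVN : V ≠ N := fun h => hV₁ (h ▸ hN)
  have hNl₂ : ¬ ptIn N l₂ := fun h => hN₃ ((hX₃ N).mp ⟨hN, h⟩)
  have hNl₃ : ¬ ptIn N l₃ := fun h => hN₂ ((hX₂ N).mp ⟨hN, h⟩)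
  have hl := finrank_join hVN
  have hVl : ptIn V (V.submodule ⊔ N.submodule) := le_sup_left (a := V.submodule)
  have hNl : ptIn N (V.submodule ⊔ N.submodule) := le_sup_right (a := V.submodule)
  have hlW : V.submodule ⊔ N.submodule ≤ W := sup_le (ptIn_mono hW₂ hV₂) (ptIn_mono hW₁ hN)
  have hzero : ∀ P, ptIn P (V.submodule ⊔ N.submodule) → P ≠ V → P ≠ N → c P = 0 := by
    intro P hP hPV hPN
    have k₁ : ¬ ptIn P l₁ := fun h =>
      hV₁ (line_unique_of_mem hl h₁ hPN hP hNl h hN ▸ hVl)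
    have k₂ : ¬ ptIn P l₂ := fun h =>
      hNl₂ (line_unique_of_mem hl h₂ hPV hP hVl h hV₂ ▸ hNl)
    have k₃ : ¬ ptIn P l₃ := fun h =>
      hNl₃ (line_unique_of_mem hl h₃ hPV hP hVl h hV₃ ▸ hNl)
    rw [hc P (ptIn_mono hlW hP)]
    simp [incVec, k₁, k₂, k₃]
  obtain ⟨Z, hZ, hZV, hZN⟩ := third hl V N
  exact lt_wt_of_two_secant h2 hn hs hl hW hlW hwW hVN hVl hNl hZ (by rwa [hcV])
    (by rwa [hl₁ N hN hN₂ hN₃]) (hzero Z hZ hZV hZN) hzero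

theorem lt_wt_of_triangle (h2 : (2 : ZMod p) ≠ 0) (hn : 1 ≤ n) (hq : Fintype.card F = 3)
    (hp : (Fintype.card F : ZMod p) = 0) {c : Pt F n → ZMod p} {s : ZMod p}
    (hs : ∀ l : Submodule F (Fin (n + 1) → F), Module.finrank F l = 2 → ∑ P ∈ pts l, c P = s)
    {W : Submodule F (Fin (n + 1) → F)} (hW : IsPlane W) (hT : TypeTri p c W) :
    4 * ∑ i ∈ Finset.range (n - 1), 3 ^ i + 2 < wt c := by
  obtain ⟨l₁, l₂, l₃, h₁, h₂, h₃, hW₁, hW₂, hW₃, h12, h13, h23, hnc, a₁, a₂, a₃, ha₁, ha₂, ha₃,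
    hc⟩ := hT
  obtain ⟨hsum, hw⟩ := wtRes_tri hp hs hW h₁ h₂ h₃ hW₁ hW₂ hW₃ h12 h13 h23 hnc ha₁ ha₂ ha₃ hc
  have key : Fintype.card F + 4 ≤ wtRes c W →
      (Fintype.card F + 1) * ∑ i ∈ Finset.range (n - 1), Fintype.card F ^ i + 2 < wt c := by
    intro hwW
    by_cases e₁ : a₂ + a₃ = 0
    · by_cases e₂ : a₃ + a₁ = 0
      · refine lt_wt_of_triangle_aux h2 hn hp hs hW hwW h₃ h₁ h₂ hW₃ hW₁ hW₂ h13.symm h23.symm h12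
          (fun ⟨P, h⟩ => hnc ⟨P, h.2.1, h.2.2, h.1⟩) ha₃ (a₂ := a₁) (a₃ := a₂) (fun e₃ => ?_)
          (fun P hP => (hc P hP).trans (by ring))
        exact mul_ne_zero h2 ha₃ (by linear_combination e₁ + e₂ - e₃)
      · exact lt_wt_of_triangle_aux h2 hn hp hs hW hwW h₂ h₃ h₁ hW₂ hW₃ hW₁ h23 h12.symm h13.symm
          (fun ⟨P, h⟩ => hnc ⟨P, h.2.2, h.1, h.2.1⟩) ha₂ e₂ (fun P hP => (hc P hP).trans (by ring))
    · exact lt_wt_of_triangle_aux h2 hn hp hs hW hwW h₁ h₂ h₃ hW₁ hW₂ hW₃ h12 h13 h23 hnc ha₁ e₁ hc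
  rw [hq] at key hw
  refine key ?_
  by_cases e₁ : s - a₁ = 0
  · by_cases e₂ : s - a₂ = 0
    · rw [ind_of_ne (x := s - a₃) fun e₃ => mul_ne_zero h2 ha₃
        (by linear_combination e₁ + e₂ - e₃ - hsum)] at hw
      omega
    · rw [ind_of_ne e₂] at hw
      omega
  · rw [ind_of_ne e₁] at hw
    omega

end TwoSecants

section Bounds

theorem theta_sub_two (q : ℕ) {n : ℕ} (hn : 3 ≤ n) :
    theta q ((n : ℤ) - 2) = ∑ i ∈ Finset.range (n - 1), q ^ i := by
  rw [theta, if_neg (by omega)]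
  congr 2
  omega

theorem B_three (n : ℕ) :
    B n 3 = 4 * (∑ i ∈ Finset.range (n - 1), 3 ^ i : ℕ) + 2 := by
  have h1 : 3 ^ (n - 1) = 2 * (∑ i ∈ Finset.range (n - 1), 3 ^ i) + 1 := by
    have h2 := geom_sum_mul_add (2 : ℕ) (n - 1)
    norm_num at h2
    omega
  rw [B, if_pos (Or.inl (by norm_num))]
  have h2 : ((3 : ℕ) : ℝ) ^ (n - 1) = ((3 ^ (n - 1) : ℕ) : ℝ) := by push_cast; ring
  rw [h2, h1]
  push_cast
  ring

/-- For odd primes from five on, the weight bounds are compatible only from `37` on. -/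
theorem large_of_weight_bounds {q n w : ℕ} (hq : q.Prime) (h5 : 5 ≤ q) (hn : 3 ≤ n)
    (hlow : (3 * q - 6) * ∑ i ∈ Finset.range (n - 1), q ^ i + 3 ≤ w) (hw : (w : ℝ) ≤ B n q) :
    37 ≤ q ∧ w ≤ (4 * q - 33) * ∑ i ∈ Finset.range (n - 1), q ^ i := by
  obtain ⟨m, rfl⟩ : ∃ m, n = m + 3 := ⟨n - 3, by omega⟩
  have hN : q ^ m * (q + 1) ≤ ∑ i ∈ Finset.range (m + 2), q ^ i := by
    rw [Finset.sum_range_succ, Finset.sum_range_succ]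
    have : q ^ m * (q + 1) = q ^ m + q ^ (m + 1) := by ring
    omega
  rw [show m + 3 - 1 = m + 2 by omega] at hlow ⊢
  have hlow' := (Nat.add_le_add_right (Nat.mul_le_mul_left (3 * q - 6) hN) 3).trans hlow
  have hQ : (0 : ℝ) < (q : ℝ) ^ m := by
    have : (0 : ℝ) < q := by exact_mod_cast hq.pos
    positivity
  have sq : ∀ x y : ℝ, 0 ≤ y → y ^ 2 ≤ x → y ≤ Real.sqrt x := fun x y _ h =>
    Real.le_sqrt_of_sq_le h
  have h37 : 37 ≤ q := by
    by_contra hlt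
    rw [not_le] at hlt
    have hlow'' : (((3 * q - 6 : ℕ) : ℝ) * ((q : ℝ) ^ m * (q + 1)) + 3) ≤ B (m + 3) q := by
      refine le_trans ?_ hw
      exact_mod_cast hlow'
    rw [B, show m + 3 - 1 = m + 2 by omega, show m + 3 - 2 = m + 1 by omega, pow_succ, pow_succ]
      at hlow''
    generalize (q : ℝ) ^ m = Q at hlow'' hQ
    interval_cases q <;> first
      | (exfalso; revert hq; norm_num; done)
      | (norm_num at hlow''
         nlinarith [mul_le_mul_of_nonneg_right (sq 42 6 (by norm_num) (by norm_num)) hQ.le,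
           mul_le_mul_of_nonneg_right (sq 66 8 (by norm_num) (by norm_num)) hQ.le,
           mul_le_mul_of_nonneg_right (sq 78 8 (by norm_num) (by norm_num)) hQ.le,
           mul_le_mul_of_nonneg_right (sq 102 10 (by norm_num) (by norm_num)) hQ.le,
           mul_le_mul_of_nonneg_right (sq 114 10 (by norm_num) (by norm_num)) hQ.le,
           mul_le_mul_of_nonneg_right (sq 184 13 (by norm_num) (by norm_num)) hQ.le,
           mul_le_mul_of_nonneg_right (sq 29 5 (by norm_num) (by norm_num)) hQ.le,
           mul_le_mul_of_nonneg_right (sq 31 (11 / 2) (by norm_num) (by norm_num)) hQ.le])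
  refine ⟨h37, ?_⟩
  have h49 : q ≠ 49 := by rintro rfl; revert hq; norm_num
  have h121 : q ≠ 121 := by rintro rfl; revert hq; norm_num
  rw [B, if_neg (by omega), if_neg (by omega), if_neg (by omega), if_neg (by omega),
    show m + 3 - 2 = m + 1 by omega] at hw
  have h8 : (33 / 2 : ℝ) ≤ Real.sqrt (8 * q) := by
    refine sq _ _ (by norm_num) ?_
    have : (37 : ℝ) ≤ q := by exact_mod_cast h37
    linarith
  have hle : (w : ℝ) ≤ ((4 * q - 33 : ℕ) : ℝ) * ((q ^ (m + 1) : ℕ) : ℝ) := by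
    rw [Nat.cast_sub (by omega)]
    push_cast
    refine hw.trans (mul_le_mul_of_nonneg_right (by linarith) (by positivity))
  have hle' : w ≤ (4 * q - 33) * q ^ (m + 1) := by exact_mod_cast hle
  refine hle'.trans (Nat.mul_le_mul_left _ ?_)
  exact Finset.single_le_sum (f := fun i => q ^ i) (fun _ _ => Nat.zero_le _)
    (Finset.mem_range.mpr (by omega))

end Bounds

section Comparison

theorem ind_three (x : ZMod 3) : ind x = (x ^ 2).val := by
  have h : ∀ x : ZMod 3, x ≠ 0 → (x ^ 2).val = 1 := by decide
  by_cases hx : x = 0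
  · rw [hx, ind_zero]
    rfl
  · rw [ind_of_ne hx, h x hx]

theorem ind_sum_eq_of_three {a₁ a₂ a₃ b₁ b₂ b₃ s : ZMod 3} (ha₁ : a₁ ≠ 0) (ha₂ : a₂ ≠ 0)
    (ha₃ : a₃ ≠ 0) (hb₁ : b₁ ≠ 0) (hb₂ : b₂ ≠ 0) (hb₃ : b₃ ≠ 0) (ha : s = a₁ + a₂ + a₃)
    (hb : s = b₁ + b₂ + b₃) :
    ind (s - a₁) + ind (s - a₂) + ind (s - a₃) = ind (s - b₁) + ind (s - b₂) + ind (s - b₃) := by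
  have h : ∀ x : ZMod 3, x ≠ 0 → x = 1 ∨ x = 2 := by decide
  simp only [ind_three]
  rcases h a₁ ha₁ with rfl | rfl <;> rcases h a₂ ha₂ with rfl | rfl <;>
    rcases h a₃ ha₃ with rfl | rfl <;> rcases h b₁ hb₁ with rfl | rfl <;>
    rcases h b₂ hb₂ with rfl | rfl <;> rcases h b₃ hb₃ with rfl | rfl <;> subst ha <;>
    revert hb <;> decide

variable {n p : ℕ} [Fact p.Prime] [Fintype F]

theorem SpaceIsType.exists_cone {q k : ℕ} (hk : 2 ≤ k) {c : Pt F n → ZMod p}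
    {S : Submodule F (Fin (n + 1) → F)} {t : PlaneT} (h : SpaceIsType p q c S k t) :
    ∃ κ π : Submodule F (Fin (n + 1) → F), Module.finrank F κ = k - 2 ∧ Module.finrank F S = Module.finrank F κ + 3 ∧
      IsCone c S κ π ∧ PlaneIsType p q c π t := by
  obtain ⟨hS, κ, hκ, hκS, hconst, π, hπ, hπS, hdis, ht, hval⟩ := h
  exact ⟨κ, π, hκ, by omega, ⟨hκS, hπS, hπ, hdis, hconst, hval⟩, ht⟩

theorem not_typeOdd_and_typeTri (hn : 3 ≤ n) {c : Pt F n → ZMod p} (hc : c ∈ code F p n)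
    (hlow : (3 * Fintype.card F - 6) * ∑ i ∈ Finset.range (n - 1), Fintype.card F ^ i + 3 ≤ wt c)
    (hwt : (wt c : ℝ) ≤ B n (Fintype.card F)) {s : ZMod p}
    (hs : ∀ l : Submodule F (Fin (n + 1) → F), Module.finrank F l = 2 → ∑ P ∈ pts l, c P = s)
    {W W' : Submodule F (Fin (n + 1) → F)} (hW' : IsPlane W') (hT : TypeOdd p c W)
    (hT' : TypeTri p c W') : False := by
  have hcard := hT.1
  have hp2 := (wtRes_odd hs hT).1
  have hprime : p.Prime := Fact.out
  have hp : (Fintype.card F : ZMod p) = 0 := by rw [hcard]; exact ZMod.natCast_self p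
  have h2 : (2 : ZMod p) ≠ 0 := by
    intro h
    have h' : ((2 : ℕ) : ZMod p) = 0 := by exact_mod_cast h
    rw [ZMod.natCast_eq_zero_iff] at h'
    exact hp2 ((Nat.prime_dvd_prime_iff_eq hprime Nat.prime_two).mp h')
  by_cases hp3 : p = 3
  · have h1 := lt_wt_of_triangle h2 (by omega) (hcard.trans hp3) hp hs hW' hT'
    rw [hcard.trans hp3, B_three n] at hwt
    have h3 : wt c ≤ 4 * (∑ i ∈ Finset.range (n - 1), 3 ^ i) + 2 := by exact_mod_cast hwt
    omega
  · have h5 : 5 ≤ p := by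
      by_contra hlt
      have := hprime.two_le
      have : p = 4 := by omega
      rw [this] at hprime
      revert hprime
      norm_num
    obtain ⟨h37, hwt'⟩ := large_of_weight_bounds (hcard ▸ hprime) (hcard ▸ h5) hn hlow hwt
    have : CharP F p := charP_of_card_eq_prime (by rw [hcard])
    obtain ⟨l₁, l₂, l₃, h₁, h₂, h₃, hW₁, hW₂, hW₃, h12, h13, -, hnc, a₁, a₂, a₃, ha₁, ha₂, ha₃,
      hcW⟩ := hT'
    obtain ⟨X₂, X₃, hne, hX₃, hX₂, hgen, hcX₃, hcX₂, hsum⟩ :=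
      exists_triangle hp hs hW' h₁ h₂ h₃ hW₁ hW₂ hW₃ h12 h13 hnc hcW
    obtain ⟨m, O, -, hm, -, hO, -, hinj, -⟩ := exists_odd_lines hs hT
    rw [wt_eq_card] at hwt'
    exact no_triangle_side_and_injective_line (by omega) (ZMod.castHom dvd_rfl F) hc h37 hwt' hs h₁
      (hm 0) hne.symm ((hX₃ X₃).mpr rfl).1 ((hX₂ X₂).mpr rfl).1 h2 ha₁ ha₂ ha₃ hsum
      (fun z hz hz₃ hz₂ => hgen z hz hz₂ hz₃) hcX₃ hcX₂ (hO 0)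
      fun z hz z' hz' hzO hzO' => hinj 0 z z' hz hz' hzO hzO'

theorem wtRes_eq_of_triangles {h : ℕ} (hh : 1 ≤ h) (hF : Fintype.card F = p ^ h)
    {c : Pt F n → ZMod p} {s : ZMod p}
    (hs : ∀ l : Submodule F (Fin (n + 1) → F), Module.finrank F l = 2 → ∑ P ∈ pts l, c P = s)
    {S S' κ κ' π π' l : Submodule F (Fin (n + 1) → F)} (H : IsCone c S κ π)
    (H' : IsCone c S' κ' π') (hS : Module.finrank F S = Module.finrank F κ + 3)
    (hS' : Module.finrank F S' = Module.finrank F κ' + 3) (hT : TypeTri p c π)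
    (hT' : TypeTri p c π') (hl : Module.finrank F l = 2) (hw : wtRes c l = 3) (hlS : l ≤ S)
    (hlS' : l ≤ S') : wtRes c π = wtRes c π' := by
  have hprime : p.Prime := Fact.out
  have hp : (Fintype.card F : ZMod p) = 0 := by
    rw [hF, Nat.cast_pow, ZMod.natCast_self, zero_pow (by omega)]
  obtain ⟨l₁, l₂, l₃, h₁, h₂, h₃, hW₁, hW₂, hW₃, h12, h13, h23, hnc, a₁, a₂, a₃, ha₁, ha₂, ha₃,
    hc⟩ := hT
  obtain ⟨m₁, m₂, m₃, g₁, g₂, g₃, hU₁, hU₂, hU₃, g12, g13, g23, gnc, b₁, b₂, b₃, hb₁, hb₂, hb₃,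
    hd⟩ := hT'
  obtain ⟨ha, hwa⟩ := wtRes_tri hp hs H.finrank_base h₁ h₂ h₃ hW₁ hW₂ hW₃ h12 h13 h23 hnc
    ha₁ ha₂ ha₃ hc
  obtain ⟨hb, hwb⟩ := wtRes_tri hp hs H'.finrank_base g₁ g₂ g₃ hU₁ hU₂ hU₃ g12 g13 g23 gnc
    hb₁ hb₂ hb₃ hd
  rw [hwa, hwb]
  congr 1
  by_cases hp2 : p = 2
  · subst hp2
    rw [(eq_zero_or_eq_one a₁).resolve_left ha₁, (eq_zero_or_eq_one a₂).resolve_left ha₂,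
      (eq_zero_or_eq_one a₃).resolve_left ha₃, (eq_zero_or_eq_one b₁).resolve_left hb₁,
      (eq_zero_or_eq_one b₂).resolve_left hb₂, (eq_zero_or_eq_one b₃).resolve_left hb₃]
  by_cases hp3 : p = 3
  · subst hp3
    exact ind_sum_eq_of_three ha₁ ha₂ ha₃ hb₁ hb₂ hb₃ ha hb
  have h5 : 5 ≤ Fintype.card F := by
    have h5 : 5 ≤ p := by
      by_contra hlt
      have := hprime.two_le
      have : p = 4 := by omega
      rw [this] at hprime
      revert hprime
      norm_num
    rw [hF]
    exact h5.trans (Nat.le_self_pow (by omega) p)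
  rw [← H.line_values_of_triangle hp hs hS hl hlS h5 hw h₁ h₂ h₃ hW₁ hW₂ hW₃ ha₁ ha₂ ha₃ ha hc,
    ← H'.line_values_of_triangle hp hs hS' hl hlS' h5 hw g₁ g₂ g₃ hU₁ hU₂ hU₃ hb₁ hb₂ hb₃ hb hd]

end Comparison

/-- Lemma 22 of the paper: two `k`-spaces of types in
`{T^odd, T^△, T^★}` sharing a `3`-secant have `T₁ = T^★`, `T₂ = T^★` or `T₁ = T₂`, and equal
types force equal restricted weights. -/
theorem statement11 [Fintype F] {p h q n : ℕ} [Fact p.Prime] (hh : 1 ≤ h) (hq : q = p ^ h)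
    (hF : Fintype.card F = q) (hn : 3 ≤ n)
    (c : Pt F n → ZMod p) (hc : c ∈ code F p n)
    (hlow : (3 * q - 6) * theta q ((n : ℤ) - 2) + 3 ≤ wt c) (hwt : (wt c : ℝ) ≤ B n q)
    (k : ℕ) (hk2 : 2 ≤ k) (hkn : k < n)
    (S₁ S₂ : Submodule F (Fin (n + 1) → F)) (t₁ t₂ : PlaneT)
    (ht₁ : t₁ = PlaneT.Todd ∨ t₁ = PlaneT.Ttri ∨ t₁ = PlaneT.Tstar)
    (ht₂ : t₂ = PlaneT.Todd ∨ t₂ = PlaneT.Ttri ∨ t₂ = PlaneT.Tstar)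
    (hT₁ : SpaceIsType p q c S₁ k t₁) (hT₂ : SpaceIsType p q c S₂ k t₂)
    (hsec : ∃ l : Submodule F (Fin (n + 1) → F), secant c l 3 ∧ l ≤ S₁ ∧ l ≤ S₂) :
    (t₁ = PlaneT.Tstar ∨ t₂ = PlaneT.Tstar ∨ t₁ = t₂) ∧
      (t₁ = t₂ → wtRes c S₁ = wtRes c S₂) := by
  have hprime : p.Prime := Fact.out
  have hF' : Fintype.card F = p ^ h := hF.trans hq
  have hp : (Fintype.card F : ZMod p) = 0 := by
    rw [hF', Nat.cast_pow, ZMod.natCast_self, zero_pow (by omega)]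
  obtain ⟨s, hs⟩ := exists_lineSum hp hc
  rw [theta_sub_two q hn, ← hF] at hlow
  rw [← hF] at hwt
  obtain ⟨κ₁, π₁, hκ₁, hS₁, H₁, hP₁⟩ := hT₁.exists_cone hk2
  obtain ⟨κ₂, π₂, hκ₂, hS₂, H₂, hP₂⟩ := hT₂.exists_cone hk2
  constructor
  · rcases ht₁ with rfl | rfl | rfl <;> rcases ht₂ with rfl | rfl | rfl <;> try tauto
    · exact (not_typeOdd_and_typeTri hn hc hlow hwt hs H₂.finrank_base hP₁ hP₂).elim
    · exact (not_typeOdd_and_typeTri hn hc hlow hwt hs H₁.finrank_base hP₂ hP₁).elim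
  · rintro rfl
    have hπ : wtRes c π₁ = wtRes c π₂ := by
      rcases ht₁ with rfl | rfl | rfl
      · rw [(wtRes_odd hs hP₁).2, (wtRes_odd hs hP₂).2]
      · obtain ⟨l, ⟨hl, hw⟩, hl₁, hl₂⟩ := hsec
        exact wtRes_eq_of_triangles hh hF' hs H₁ H₂ hS₁ hS₂ hP₁ hP₂ hl hw hl₁ hl₂
      · rw [wtRes_star hp hs hP₁, wtRes_star hp hs hP₂]
    rw [H₁.wtRes_eq hp hs, H₂.wtRes_eq hp hs, hπ, card_pts, card_pts, hκ₁, hκ₂]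

end PGCode
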